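/- Let k be a field and I a monomial ideal in Q = k[x_1,…,x_t] with minimal generating set M_I consisting of monomials of degree at least 2, and suppose that m_S = m_T implies S = T for all subsets S, T ⊆ M_I (equivalently, the Taylor complex on M_I is minimal, i.e. L_I is the boolean lattice of subsets of M_I). Then every non-empty subset of M_I is saturated in M_I, and the denominator of the Poincaré series of R = Q/I is b_R(x,z) = Σ_{S ⊆ M_I} (−1)^{c(S)} z^{|S| + c(S)} m_S. -/

import Mathlib

noncomputable section
attribute [local instance] Classical.propDecidable

namespace MonomialRings

/-- Monomials in variables indexed by `σ`, represented by their exponent vectors. -/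
abbrev Mon (σ : Type*) := σ → ℕ

/-- Two monomials have a non-trivial common factor. -/
def NCF {σ : Type*} (a b : Mon σ) : Prop := ∃ i, a i ≠ 0 ∧ b i ≠ 0

/-- Adjacency in the graph associated to a set of monomials: edges go between distinct
monomials having a non-trivial common factor. -/
def mAdj {σ : Type*} (a b : Mon σ) : Prop := a ≠ b ∧ NCF a b

/-- `a` and `b` are joined by a path inside `S`. -/
def ConnIn {σ : Type*} (S : Finset (Mon σ)) (a b : Mon σ) : Prop :=
  a ∈ S ∧ b ∈ S ∧ Relation.ReflTransGen (fun u v => u ∈ S ∧ v ∈ S ∧ mAdj u v) a b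

/-- A monomial set is connected (in particular nonempty). -/
def IsConnected {σ : Type*} (S : Finset (Mon σ)) : Prop :=
  S.Nonempty ∧ ∀ a ∈ S, ∀ b ∈ S, ConnIn S a b

/-- The connected component of `a` in `S`. -/
def compOf {σ : Type*} (S : Finset (Mon σ)) (a : Mon σ) : Finset (Mon σ) :=
  S.filter (fun b => ConnIn S a b)

/-- The set of connected components of a monomial set. -/
def components {σ : Type*} (S : Finset (Mon σ)) : Finset (Finset (Mon σ)) :=
  S.image (compOf S)

/-- The number of connected components of a monomial set. -/
def ncomp {σ : Type*} (S : Finset (Mon σ)) : ℕ := (components S).card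

/-- The least common multiple `m_S` of a finite set of monomials (`m_∅ = 1`). -/
def mlcm {σ : Type*} (S : Finset (Mon σ)) : Mon σ := S.sup id

/-- `S` is saturated in `M`: for all `m ∈ M` and every connected subset `T ⊆ S`,
`m ∣ m_T` implies `m ∈ S`. -/
def Saturated {σ : Type*} (M S : Finset (Mon σ)) : Prop :=
  S ⊆ M ∧ ∀ m ∈ M, ∀ T ⊆ S, IsConnected T → m ≤ mlcm T → m ∈ S

/-- The set `sat M` of non-empty saturated subsets of `M`. -/
def satSets {σ : Type*} (M : Finset (Mon σ)) : Finset (Finset (Mon σ)) :=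
  M.powerset.filter (fun S => S.Nonempty ∧ Saturated M S)

/-- The saturation `S̄` of `S` in `M`. -/
def saturation {σ : Type*} (M S : Finset (Mon σ)) : Finset (Mon σ) :=
  M.filter (fun m => ∃ C ∈ components S, m ≤ mlcm C)

/-- The simplicial complex `Δ'_S`: faces are the `T ⊆ S` with `m_T ≠ m_S`, or such that
`S_i ∩ T` is disconnected for some connected component `S_i` of `S`. -/
def dprime {σ : Type*} (S : Finset (Mon σ)) : Set (Finset (Mon σ)) :=
  {T | T ⊆ S ∧ (mlcm T ≠ mlcm S ∨ ∃ C ∈ components S, ¬ IsConnected (C ∩ T))}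

/-- The simplicial complex `Δ_N`: faces are the `S ⊆ N` with `m_S ≠ m_N` or `S`
disconnected. -/
def dcomplex {σ : Type*} (N : Finset (Mon σ)) : Set (Finset (Mon σ)) :=
  {T | T ⊆ N ∧ (mlcm T ≠ mlcm N ∨ ¬ IsConnected T)}

/-- A discrete monomial set: the monomials are pairwise without common factors. -/
def Discrete {σ : Type*} (S : Finset (Mon σ)) : Prop :=
  ∀ a ∈ S, ∀ b ∈ S, a ≠ b → ¬ NCF a b

/-- The lcm-lattice of the monomial set `M` (as a finite set of monomials,
ordered by divisibility i.e. by `≤` on exponent vectors). -/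
def lcmLattice {σ : Type*} (M : Finset (Mon σ)) : Finset (Mon σ) :=
  M.powerset.image mlcm

/-- `M_l`: the set of monomials in `M` dividing the monomial `l`. -/
def divisorsIn {σ : Type*} (M : Finset (Mon σ)) (l : Mon σ) : Finset (Mon σ) :=
  M.filter (fun m => m ≤ l)

/-- `M_N`: the set of monomials in `M` dividing some monomial of `N`. -/
def divisorsInSet {σ : Type*} (M N : Finset (Mon σ)) : Finset (Mon σ) :=
  M.filter (fun m => ∃ l ∈ N, m ≤ l)

/-- An antichain of monomials (the minimal generating set of the monomial ideal
it generates). -/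
def IsAntichain' {σ : Type*} (M : Finset (Mon σ)) : Prop :=
  ∀ m ∈ M, ∀ n ∈ M, m ≤ n → m = n

/-- total degree of a monomial -/
def mdeg {t : ℕ} (m : Mon (Fin t)) : ℕ := ∑ i, m i

end MonomialRings
namespace MonomialRings

/-! ### The multigraded Poincaré series, via the bar resolution

For a monomial ring `R = k[x₁,…,x_t]/I`, the multigraded vector spaces `Tor^R_{i,α}(k,k)`
are computed by the (normalized) bar resolution of `k` over `R`.  The monomial ring is
determined by the set `J` of exponents of monomials lying in `I`; `R` has `k`-basis the
monomials `x^β` with `β ∉ J`, and the degree-`(i,α)` part of the bar complex has basis the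
lists `[β₁,…,β_i]` of nonzero exponent vectors not in `J` with `β₁ + ⋯ + β_i = α`. -/

/-- Lists forming the basis of the multigraded piece of the bar complex. -/
def barBasis {σ : Type*} (J : Set (Mon σ)) (i : ℕ) (α : Mon σ) : Set (List (Mon σ)) :=
  {l | l.length = i ∧ l.sum = α ∧ ∀ β ∈ l, β ≠ 0 ∧ β ∉ J}

/-- Merging the entries at positions `j` and `j+1` of a list. -/
def mergeAt {σ : Type*} (l : List (Mon σ)) (j : ℕ) : List (Mon σ) :=
  l.take j ++ [l.getD j 0 + l.getD (j + 1) 0] ++ l.drop (j + 2)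

/-- The bar differential on a basis element. -/
def barAux (k : Type*) [Field k] {σ : Type*} (J : Set (Mon σ)) (l : List (Mon σ)) :
    List (Mon σ) →₀ k :=
  ∑ j ∈ Finset.range (l.length - 1),
    if l.getD j 0 + l.getD (j + 1) 0 ∉ J then
      ((-1 : k) ^ (j + 1)) • Finsupp.single (mergeAt l j) (1 : k)
    else 0

/-- The bar differential. -/
def barD (k : Type*) [Field k] {σ : Type*} (J : Set (Mon σ)) :
    (List (Mon σ) →₀ k) →ₗ[k] (List (Mon σ) →₀ k) :=
  Finsupp.linearCombination k (barAux k J)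

/-- The degree-`(i,α)` part of the bar complex. -/
def barSub (k : Type*) [Field k] {σ : Type*} (J : Set (Mon σ)) (i : ℕ) (α : Mon σ) :
    Submodule k (List (Mon σ) →₀ k) :=
  Submodule.span k ((fun l => Finsupp.single l (1 : k)) '' barBasis J i α)

/-- `dim_k Tor^R_{i,α}(k,k)` for the monomial ring `R` determined by `J`. -/
def torDim (k : Type*) [Field k] {σ : Type*} (J : Set (Mon σ)) (i : ℕ) (α : Mon σ) : ℕ :=
  Module.finrank k ↥(barSub k J i α ⊓ LinearMap.ker (barD k J))
    - Module.finrank k ↥(Submodule.map (barD k J) (barSub k J (i + 1) α))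

/-- The set of exponent vectors of monomials lying in the ideal `I`. -/
def expSet {t : ℕ} {k : Type*} [Field k] (I : Ideal (MvPolynomial (Fin t) k)) :
    Set (Mon (Fin t)) :=
  {β | MvPolynomial.monomial (Finsupp.equivFunOnFinite.symm β) (1 : k) ∈ I}

/-- The exponent (in `ℕ^t × ℕ`) of the monomial `x^α z^d`; the extra variable `none`
is the homological variable `z`. -/
def expOf {t : ℕ} (α : Mon (Fin t)) (d : ℕ) : Option (Fin t) →₀ ℕ :=
  Finsupp.equivFunOnFinite.symm (fun o => Option.elim o d α)

/-- The multigraded Poincaré series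
`P^R_k(x,z) = ∑_{i,α} dim_k Tor^R_{i,α}(k,k) x^α z^i` of the monomial ring `R`
determined by `J`, as a formal power series in `x₁,…,x_t` and `z` (the variable `none`). -/
def poincareSeries (k : Type*) [Field k] {t : ℕ} (J : Set (Mon (Fin t))) :
    MvPowerSeries (Option (Fin t)) ℤ :=
  fun e => (torDim k J (e none) (fun i => e (some i)) : ℤ)

/-- The statement that `b` is the Backelin denominator of the Poincaré series:
`P^R_k(x,z) = ∏ᵢ(1+xᵢz) / b(x,z)`. -/
def IsDenominator (k : Type*) [Field k] {t : ℕ} (J : Set (Mon (Fin t)))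
    (b : MvPolynomial (Option (Fin t)) ℤ) : Prop :=
  (b : MvPowerSeries (Option (Fin t)) ℤ) * poincareSeries k J
    = ∏ i : Fin t, (1 + MvPowerSeries.X (some i) * MvPowerSeries.X none)

/-- The multigraded ideal of a monomial set: the exponents `β` with `x^m ∣ x^β` for some
`m ∈ M`. -/
def upperSet {σ : Type*} (M : Finset (Mon σ)) : Set (Mon σ) :=
  {β | ∃ m ∈ M, m ≤ β}

/-- `I` is the monomial ideal generated by the monomial set `M`. -/
def IsMonomialIdealOf {t : ℕ} {k : Type*} [Field k] (M : Finset (Mon (Fin t)))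
    (I : Ideal (MvPolynomial (Fin t) k)) : Prop :=
  I = Ideal.span ((fun m => MvPolynomial.monomial (Finsupp.equivFunOnFinite.symm m) (1 : k)) '' ↑M)

/-- The specialization `b(z) = b(1,…,1,z)` of a polynomial in `x₁,…,x_t,z`. -/
def zSpecialize {t : ℕ} (b : MvPolynomial (Option (Fin t)) ℤ) : Polynomial ℤ :=
  MvPolynomial.aeval (fun o : Option (Fin t) => Option.elim o Polynomial.X (fun _ => 1)) b

end MonomialRings
open MonomialRings

namespace MonomialRings

section WordComplex

variable {k : Type*} [Field k] {X : Type*}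

/-- Prepending a linear combination of letters to a linear combination of words. -/
def prep : (X →₀ k) →ₗ[k] (List X →₀ k) →ₗ[k] (List X →₀ k) :=
  Finsupp.linearCombination k (fun a => Finsupp.lmapDomain k k (List.cons a))

@[simp] lemma prep_single (a : X) (w : List X) (r s : k) :
    prep (Finsupp.single a r) (Finsupp.single w s) = Finsupp.single (a :: w) (r * s) := by
  simp [prep]

/-- The bilinear extension of a product defined on letters. -/
def mulLin (mul : X → X → X →₀ k) : (X →₀ k) →ₗ[k] (X →₀ k) →ₗ[k] (X →₀ k) :=
  Finsupp.linearCombination k (fun a => Finsupp.linearCombination k (mul a))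

@[simp] lemma mulLin_single (mul : X → X → X →₀ k) (a b : X) (r s : k) :
    mulLin mul (Finsupp.single a r) (Finsupp.single b s) = (r * s) • mul a b := by
  simp [mulLin, smul_smul]

/-- Multiplication of the first letter of a word by a given letter. -/
def headMulAux (mul : X → X → X →₀ k) (a : X) : List X → (List X →₀ k)
  | [] => 0
  | b :: w => prep (mul a b) (Finsupp.single w 1)

/-- The bilinear extension of `headMulAux`. -/
def headMul (mul : X → X → X →₀ k) : (X →₀ k) →ₗ[k] (List X →₀ k) →ₗ[k] (List X →₀ k) :=
  Finsupp.linearCombination k (fun a => Finsupp.linearCombination k (headMulAux mul a))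

@[simp] lemma headMul_single (mul : X → X → X →₀ k) (a : X) (w : List X) (r s : k) :
    headMul mul (Finsupp.single a r) (Finsupp.single w s) = (r * s) • headMulAux mul a w := by
  simp [headMul, smul_smul]

/-- The sign operator on letters. -/
def signLin (ε : X → k) : (X →₀ k) →ₗ[k] (X →₀ k) :=
  Finsupp.linearCombination k (fun a => Finsupp.single a (ε a))

@[simp] lemma signLin_single (ε : X → k) (a : X) (r : k) :
    signLin ε (Finsupp.single a r) = Finsupp.single a (r * ε a) := by
  simp [signLin]

/-- The differential of the bar construction on a word. -/
def barDiffAux (d : X → X →₀ k) (mul : X → X → X →₀ k) (ε : X → k) : List X → (List X →₀ k)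
  | [] => 0
  | a :: w => prep (d a) (Finsupp.single w 1) + ε a • (headMulAux mul a w +
      prep (Finsupp.single a 1) (barDiffAux d mul ε w))

/-- The differential of the bar construction of a differential graded algebra given by
structure constants `d`, `mul` and `ε` on a basis. -/
def barDiff (d : X → X →₀ k) (mul : X → X → X →₀ k) (ε : X → k) :
    (List X →₀ k) →ₗ[k] (List X →₀ k) :=
  Finsupp.linearCombination k (barDiffAux d mul ε)

variable (d : X → X →₀ k) (mul : X → X → X →₀ k) (ε : X → k)

@[simp] lemma barDiff_single (w : List X) (r : k) :
    barDiff d mul ε (Finsupp.single w r) = r • barDiffAux d mul ε w := by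
  simp [barDiff]

lemma barDiff_prep (v : X →₀ k) (e : List X →₀ k) :
    barDiff d mul ε (prep v e) = prep (Finsupp.linearCombination k d v) e
      + headMul mul (signLin ε v) e + prep (signLin ε v) (barDiff d mul ε e) := by
  induction v using Finsupp.induction_linear with
  | zero => simp
  | add v₁ v₂ h₁ h₂ => simp only [map_add, LinearMap.add_apply, h₁, h₂]; abel
  | single a r =>
    induction e using Finsupp.induction_linear with
    | zero => simp
    | add v₁ v₂ h₁ h₂ => simp only [map_add, h₁, h₂]; abel
    | single w s =>
      have h1 : Finsupp.single w s = s • Finsupp.single w (1 : k) := by simp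
      have h2 : Finsupp.single a (r * ε a) = (r * ε a) • Finsupp.single a (1 : k) := by simp
      simp only [prep_single, barDiff_single, barDiffAux, Finsupp.linearCombination_single,
        map_smul, LinearMap.smul_apply, signLin_single, headMul_single]
      rw [h1, h2]
      simp only [map_smul, LinearMap.smul_apply, smul_add, smul_smul]
      module

lemma headMul_prep (v u : X →₀ k) (e : List X →₀ k) :
    headMul mul v (prep u e) = prep (mulLin mul v u) e := by
  induction v using Finsupp.induction_linear with
  | zero => simp
  | add v₁ v₂ h₁ h₂ => simp only [map_add, LinearMap.add_apply, h₁, h₂]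
  | single a r =>
    induction u using Finsupp.induction_linear with
    | zero => simp
    | add v₁ v₂ h₁ h₂ => simp only [map_add, LinearMap.add_apply, h₁, h₂]
    | single b q =>
      induction e using Finsupp.induction_linear with
      | zero => simp
      | add v₁ v₂ h₁ h₂ => simp only [map_add, h₁, h₂]
      | single w s =>
        have h1 : Finsupp.single w s = s • Finsupp.single w (1 : k) := by simp
        simp only [prep_single, headMul_single, headMulAux, mulLin_single]
        rw [h1]
        simp only [map_smul, LinearMap.smul_apply, smul_smul]
        module

lemma headMul_headMul
    (assoc : ∀ a b c, mulLin mul (mulLin mul a b) c = mulLin mul a (mulLin mul b c))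
    (v u : X →₀ k) (e : List X →₀ k) :
    headMul mul v (headMul mul u e) = headMul mul (mulLin mul v u) e := by
  induction e using Finsupp.induction_linear with
  | zero => simp
  | add v₁ v₂ h₁ h₂ => simp only [map_add, h₁, h₂]
  | single w s =>
    cases w with
    | nil =>
      have : ∀ x : X →₀ k, headMul mul x (Finsupp.single [] s) = 0 := by
        intro x
        induction x using Finsupp.induction_linear with
        | zero => simp
        | add v₁ v₂ h₁ h₂ => simp only [map_add, LinearMap.add_apply, h₁, h₂, add_zero]
        | single a r => simp [headMulAux]
      simp [this]
    | cons b w =>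
      have : Finsupp.single (b :: w) s = prep (Finsupp.single b 1) (Finsupp.single w s) := by simp
      rw [this]
      simp only [headMul_prep, assoc]

lemma headMul_nil (x : X →₀ k) (s : k) : headMul mul x (Finsupp.single [] s) = 0 := by
  induction x using Finsupp.induction_linear with
  | zero => simp
  | add v₁ v₂ h₁ h₂ => simp only [map_add, LinearMap.add_apply, h₁, h₂, add_zero]
  | single a r => simp [headMulAux]

/-- The bar differential squares to zero. -/
lemma barDiff_barDiff
    (assoc : ∀ a b c, mulLin mul (mulLin mul a b) c = mulLin mul a (mulLin mul b c))
    (dd : ∀ v, Finsupp.linearCombination k d (Finsupp.linearCombination k d v) = 0)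
    (εε : ∀ v, signLin ε (signLin ε v) = v)
    (dε : ∀ v, Finsupp.linearCombination k d (signLin ε v)
      = - signLin ε (Finsupp.linearCombination k d v))
    (εmul : ∀ u v, signLin ε (mulLin mul u v) = - mulLin mul (signLin ε u) (signLin ε v))
    (leib : ∀ u v, Finsupp.linearCombination k d (mulLin mul u v)
      = mulLin mul (Finsupp.linearCombination k d u) v
        - mulLin mul (signLin ε u) (Finsupp.linearCombination k d v))
    (e : List X →₀ k) : barDiff d mul ε (barDiff d mul ε e) = 0 := by
  have key : ∀ w : List X, barDiff d mul ε (barDiff d mul ε (Finsupp.single w 1)) = 0 := by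
    intro w
    induction w with
    | nil => simp [barDiffAux]
    | cons a w ih =>
      have h1 : Finsupp.single (a :: w) (1 : k)
        = prep (Finsupp.single a 1) (Finsupp.single w 1) := by simp
      rw [h1]
      generalize Finsupp.single a (1 : k) = v
      cases w with
      | nil =>
        have h0 : barDiff d mul ε (Finsupp.single [] (1 : k)) = 0 := by simp [barDiffAux]
        simp only [barDiff_prep, headMul_nil, h0, dd, map_zero, LinearMap.zero_apply,
          add_zero]
      | cons b w =>
        have h2 : Finsupp.single (b :: w) (1 : k)
          = prep (Finsupp.single b 1) (Finsupp.single w 1) := by simp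
        rw [h2] at ih ⊢
        generalize Finsupp.single b (1 : k) = u at *
        generalize Finsupp.single w (1 : k) = f at *
        have h3 := barDiff_prep d mul ε u f
        have h4 : headMul mul v (barDiff d mul ε (prep u f)) = prep (mulLin mul v
          (Finsupp.linearCombination k d u)) f + headMul mul (mulLin mul v (signLin ε u)) f
            + prep (mulLin mul v (signLin ε u)) (barDiff d mul ε f) := by
          rw [h3, map_add, map_add, headMul_prep, headMul_prep, headMul_headMul _ assoc]
        rw [barDiff_prep, map_add, map_add, barDiff_prep d mul ε (Finsupp.linearCombination k d v),
          barDiff_prep d mul ε (signLin ε v) (barDiff d mul ε (prep u f)),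
          ih, dd, headMul_prep, headMul_prep, barDiff_prep d mul ε (mulLin mul _ _), leib, εmul,
          εε, dε, h4, h3]
        simp only [map_neg, map_add, map_sub, map_zero, LinearMap.zero_apply, LinearMap.neg_apply,
          LinearMap.sub_apply]
        abel
  induction e using Finsupp.induction_linear with
  | zero => simp
  | add v₁ v₂ h₁ h₂ => simp only [map_add, h₁, h₂, add_zero]
  | single w s =>
    have h1 : Finsupp.single w s = s • Finsupp.single w (1 : k) := by simp
    rw [h1, map_smul, map_smul, key, smul_zero]

lemma prep_apply_nil (v : X →₀ k) (e : List X →₀ k) : prep v e [] = 0 := by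
  induction v using Finsupp.induction_linear with
  | zero => simp
  | add v₁ v₂ h₁ h₂ => simp only [map_add, LinearMap.add_apply, Finsupp.add_apply, h₁, h₂, add_zero]
  | single a r =>
    induction e using Finsupp.induction_linear with
    | zero => simp
    | add v₁ v₂ h₁ h₂ => simp only [map_add, Finsupp.add_apply, h₁, h₂, add_zero]
    | single w s => simp

lemma prep_apply_cons (v : X →₀ k) (e : List X →₀ k) (c : X) (w : List X) :
    prep v e (c :: w) = v c * e w := by
  induction v using Finsupp.induction_linear with
  | zero => simp
  | add v₁ v₂ h₁ h₂ =>
    simp only [map_add, LinearMap.add_apply, Finsupp.add_apply, h₁, h₂, add_mul]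
  | single a r =>
    induction e using Finsupp.induction_linear with
    | zero => simp
    | add v₁ v₂ h₁ h₂ => simp only [map_add, Finsupp.add_apply, h₁, h₂, mul_add]
    | single w' s =>
      simp only [prep_single, Finsupp.single_apply, List.cons.injEq]
      by_cases h1 : a = c <;> by_cases h2 : w' = w <;> simp [h1, h2]

lemma barDiffAux_nil_apply (w : List X) : barDiffAux d mul ε w [] = 0 := by
  cases w with
  | nil => simp [barDiffAux]
  | cons a w =>
    cases w <;> simp [barDiffAux, headMulAux, prep_apply_nil]

end WordComplex

end MonomialRings

namespace MonomialRings

section Exterior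

variable (k : Type*) [Field k] {τ : Type*}

/-- The sign relating `e_s e_t` to the product of `e_s` and `e_t` in increasing order. -/
def transSign (s t : τ) : k := if WellOrderingRel t s then -1 else 1

variable {k}

lemma transSign_mul_self (s t : τ) : transSign k s t * transSign k s t = 1 := by
  unfold transSign; split_ifs <;> simp

lemma transSign_mul_swap {s t : τ} (h : s ≠ t) : transSign k s t * transSign k t s = -1 := by
  unfold transSign
  rcases trichotomous_of (WellOrderingRel (α := τ)) s t with h1 | h1 | h1
  · simp [h1, asymm_of _ h1]
  · exact absurd h1 h
  · simp [h1, asymm_of _ h1]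

lemma transSign_ne_zero (s t : τ) : transSign k s t ≠ 0 := by
  unfold transSign; split_ifs <;> simp

variable (k) in
/-- The sign of the product of two exterior monomials. -/
def shuffleSign (S T : Finset τ) : k := ∏ s ∈ S, ∏ t ∈ T, transSign k s t

variable (k) in
/-- The sign of the contraction of the exterior monomial `S` by the generator `s`. -/
def contrSign (S : Finset τ) (s : τ) : k := ∏ t ∈ S.erase s, transSign k s t

lemma shuffleSign_ne_zero (S T : Finset τ) : shuffleSign k S T ≠ 0 :=
  Finset.prod_ne_zero_iff.2 fun _ _ => Finset.prod_ne_zero_iff.2 fun _ _ => transSign_ne_zero _ _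

lemma contrSign_ne_zero (S : Finset τ) (s : τ) : contrSign k S s ≠ 0 :=
  Finset.prod_ne_zero_iff.2 fun _ _ => transSign_ne_zero _ _

lemma prod_transSign_mul_self (S : Finset τ) (s : τ) :
    (∏ t ∈ S, transSign k s t) * ∏ t ∈ S, transSign k s t = 1 := by
  rw [← Finset.prod_mul_distrib]
  exact Finset.prod_eq_one fun t _ => transSign_mul_self s t

lemma prod_transSign_mul_swap {S : Finset τ} {s : τ} (h : s ∉ S) :
    (∏ t ∈ S, transSign k s t) * ∏ t ∈ S, transSign k t s = (-1) ^ S.card := by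
  rw [← Finset.prod_mul_distrib, ← Finset.prod_const]
  exact Finset.prod_congr rfl fun t ht => transSign_mul_swap (by rintro rfl; exact h ht)

lemma shuffleSign_union_left {S S' : Finset τ} (T : Finset τ) (h : Disjoint S S') :
    shuffleSign k (S ∪ S') T = shuffleSign k S T * shuffleSign k S' T :=
  Finset.prod_union h

lemma shuffleSign_union_right (S : Finset τ) {T T' : Finset τ} (h : Disjoint T T') :
    shuffleSign k S (T ∪ T') = shuffleSign k S T * shuffleSign k S T' := by
  simp only [shuffleSign, Finset.prod_union h, Finset.prod_mul_distrib]

lemma shuffleSign_erase_left {S : Finset τ} (T : Finset τ) {s : τ} (h : s ∈ S) :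
    shuffleSign k S T = (∏ t ∈ T, transSign k s t) * shuffleSign k (S.erase s) T :=
  (Finset.mul_prod_erase S _ h).symm

lemma shuffleSign_erase_right (S : Finset τ) {T : Finset τ} {t : τ} (h : t ∈ T) :
    shuffleSign k S T = (∏ s ∈ S, transSign k s t) * shuffleSign k S (T.erase t) := by
  simp only [shuffleSign, ← Finset.prod_mul_distrib]
  exact Finset.prod_congr rfl fun s _ => (Finset.mul_prod_erase T _ h).symm

end Exterior

section TaylorLetters

variable (k : Type*) [Field k] {σ : Type*}

/-- A letter `(γ, S)` stands for the product of the exterior monomial `S` with the monomial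
making its total multidegree equal to `γ`. -/
abbrev Letter (σ : Type*) := Mon σ × Finset (Mon σ)

/-- The differential on letters. -/
def letterDiff (a : Letter σ) : Letter σ →₀ k :=
  ∑ s ∈ a.2, Finsupp.single (a.1, a.2.erase s) (contrSign k a.2 s)

/-- The product of letters. -/
def letterMul (a b : Letter σ) : Letter σ →₀ k :=
  if Disjoint a.2 b.2 then Finsupp.single (a.1 + b.1, a.2 ∪ b.2) (shuffleSign k a.2 b.2) else 0

/-- The sign of a letter in the bar construction. -/
def letterSign (a : Letter σ) : k := -(-1) ^ a.2.card

variable {k}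

lemma letter_assoc (u v w : Letter σ →₀ k) :
    mulLin (letterMul k) (mulLin (letterMul k) u v) w
      = mulLin (letterMul k) u (mulLin (letterMul k) v w) := by
  induction u using Finsupp.induction_linear with
  | zero => simp
  | add v₁ v₂ h₁ h₂ => simp only [map_add, LinearMap.add_apply, h₁, h₂]
  | single a r =>
  induction v using Finsupp.induction_linear with
  | zero => simp
  | add v₁ v₂ h₁ h₂ => simp only [map_add, LinearMap.add_apply, h₁, h₂]
  | single b s =>
  induction w using Finsupp.induction_linear with
  | zero => simp
  | add v₁ v₂ h₁ h₂ => simp only [map_add, h₁, h₂]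
  | single c q =>
    simp only [mulLin_single, letterMul]
    by_cases h1 : Disjoint a.2 b.2 <;> by_cases h2 : Disjoint b.2 c.2 <;>
      by_cases h3 : Disjoint a.2 c.2 <;>
      simp [h1, h2, h3, letterMul, add_assoc, Finset.union_assoc,
        shuffleSign_union_left, shuffleSign_union_right, Finsupp.smul_single, -Finsupp.single_mul]
    ring_nf

lemma letterSign_mul_self (a : Letter σ) : letterSign k a * letterSign k a = 1 := by
  simp [letterSign, ← mul_pow]

lemma letterSign_ne_zero (a : Letter σ) : letterSign k a ≠ 0 := fun h => by
  simpa [h] using letterSign_mul_self (k := k) a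

lemma letter_sign_sign (v : Letter σ →₀ k) : signLin (letterSign k) (signLin (letterSign k) v) = v := by
  induction v using Finsupp.induction_linear with
  | zero => simp
  | add v₁ v₂ h₁ h₂ => simp only [map_add, h₁, h₂]
  | single a r => simp [mul_assoc, letterSign_mul_self, -Finsupp.single_mul]

lemma letterSign_erase {γ : Mon σ} {S : Finset (Mon σ)} {s : Mon σ} (h : s ∈ S) :
    letterSign k (γ, S.erase s) = - letterSign k (γ, S) := by
  simp only [letterSign, ← Finset.card_erase_add_one h, pow_succ]
  ring

lemma letter_diff_sign (v : Letter σ →₀ k) :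
    Finsupp.linearCombination k (letterDiff k) (signLin (letterSign k) v)
      = - signLin (letterSign k) (Finsupp.linearCombination k (letterDiff k) v) := by
  induction v using Finsupp.induction_linear with
  | zero => simp
  | add v₁ v₂ h₁ h₂ => simp only [map_add, h₁, h₂, neg_add]
  | single a r =>
    simp only [signLin_single, Finsupp.linearCombination_single, letterDiff, map_smul, map_sum,
      Finset.smul_sum, ← Finset.sum_neg_distrib]
    refine Finset.sum_congr rfl fun s hs => ?_
    rw [letterSign_erase hs]
    simp only [Finsupp.smul_single, ← Finsupp.single_neg, smul_eq_mul]
    congr 1; ring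

lemma letter_sign_mul (u v : Letter σ →₀ k) :
    signLin (letterSign k) (mulLin (letterMul k) u v)
      = - mulLin (letterMul k) (signLin (letterSign k) u) (signLin (letterSign k) v) := by
  induction u using Finsupp.induction_linear with
  | zero => simp
  | add v₁ v₂ h₁ h₂ => simp only [map_add, LinearMap.add_apply, h₁, h₂, neg_add]
  | single a r =>
  induction v using Finsupp.induction_linear with
  | zero => simp
  | add v₁ v₂ h₁ h₂ => simp only [map_add, h₁, h₂, neg_add]
  | single b s =>
    simp only [mulLin_single, letterMul, signLin_single]
    split_ifs with h
    · simp only [letterSign, Finsupp.smul_single, signLin_single, Finset.card_union_of_disjoint h,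
        ← Finsupp.single_neg, smul_eq_mul, pow_add]
      congr 1; ring
    · simp

lemma contrSign_erase {S : Finset (Mon σ)} {s t : Mon σ} (ht : t ∈ S) (h : s ≠ t) :
    contrSign k S s = transSign k s t * contrSign k (S.erase t) s := by
  rw [contrSign, contrSign, Finset.erase_right_comm, Finset.mul_prod_erase]
  simp [ht, h.symm]

lemma letter_diff_diff (v : Letter σ →₀ k) :
    Finsupp.linearCombination k (letterDiff k)
      (Finsupp.linearCombination k (letterDiff k) v) = 0 := by
  induction v using Finsupp.induction_linear with
  | zero => simp
  | add v₁ v₂ h₁ h₂ => simp only [map_add, h₁, h₂, add_zero]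
  | single a r =>
    obtain ⟨γ, S⟩ := a
    simp only [Finsupp.linearCombination_single, letterDiff, map_smul, map_sum]
    convert smul_zero _
    simp only [Finset.smul_sum, Finsupp.smul_single]
    rw [Finset.sum_sigma']
    refine Finset.sum_involution (fun p _ => ⟨p.2, p.1⟩) ?_ ?_ ?_ ?_
    · rintro ⟨s, t⟩ h
      simp only [Finset.mem_sigma, Finset.mem_erase] at h
      simp only
      rw [Finset.erase_right_comm, ← Finsupp.single_add]
      rw [Finsupp.single_eq_zero]
      rw [contrSign_erase (s := s) (t := t) h.2.2 h.2.1.symm,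
        contrSign_erase (s := t) (t := s) h.1 h.2.1]
      have := transSign_mul_swap (k := k) h.2.1
      have h2 := transSign_mul_self (k := k) t s
      have h3 : transSign k s t = - transSign k t s := by
        linear_combination (transSign k t s) * this - transSign k s t * h2
      simp only [smul_eq_mul, h3]
      ring
    · rintro ⟨s, t⟩ h _
      simp only [Finset.mem_sigma, Finset.mem_erase] at h
      simp [h.2.1]
    · rintro ⟨s, t⟩ h
      simp only [Finset.mem_sigma, Finset.mem_erase] at h ⊢
      exact ⟨h.2.2, h.2.1.symm, h.1⟩
    · rintro ⟨s, t⟩ h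
      rfl

lemma letter_leibniz_basis (a b : Letter σ) :
    Finsupp.linearCombination k (letterDiff k) (letterMul k a b)
      = mulLin (letterMul k) (letterDiff k a) (Finsupp.single b 1)
        - letterSign k a • mulLin (letterMul k) (Finsupp.single a 1) (letterDiff k b) := by
  obtain ⟨γ, S⟩ := a
  obtain ⟨γ', T⟩ := b
  have e1 : mulLin (letterMul k) (letterDiff k (γ, S)) (Finsupp.single (γ', T) 1)
      = ∑ s ∈ S, contrSign k S s • letterMul k (γ, S.erase s) (γ', T) := by
    simp [letterDiff, LinearMap.sum_apply, mulLin_single]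
  have e2 : mulLin (letterMul k) (Finsupp.single (γ, S) 1) (letterDiff k (γ', T))
      = ∑ t ∈ T, contrSign k T t • letterMul k (γ, S) (γ', T.erase t) := by
    simp [letterDiff, mulLin_single]
  rw [e1, e2]
  by_cases h : Disjoint S T
  · have e3 : Finsupp.linearCombination k (letterDiff k) (letterMul k (γ, S) (γ', T))
        = shuffleSign k S T • ∑ s ∈ S ∪ T, Finsupp.single (γ + γ', (S ∪ T).erase s)
          (contrSign k (S ∪ T) s) := by
      simp [letterMul, h, letterDiff]
    rw [e3, Finset.sum_union h, smul_add, sub_eq_add_neg, Finset.smul_sum, Finset.smul_sum,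
      Finset.smul_sum, ← Finset.sum_neg_distrib]
    congr 1
    · refine Finset.sum_congr rfl fun s hs => ?_
      have hsT : s ∉ T := Finset.disjoint_left.1 h hs
      have hd : Disjoint (S.erase s) T := h.mono_left (Finset.erase_subset _ _)
      have he : (S ∪ T).erase s = S.erase s ∪ T := by
        rw [Finset.erase_union_distrib, Finset.erase_eq_of_notMem hsT]
      simp only [letterMul, hd, if_true, Finsupp.smul_single, he, smul_eq_mul]
      congr 1
      rw [contrSign, he, Finset.prod_union hd, shuffleSign_erase_left T hs, contrSign]
      linear_combination (∏ x ∈ S.erase s, transSign k s x) * shuffleSign k (S.erase s) T *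
        prod_transSign_mul_self (k := k) T s
    · refine Finset.sum_congr rfl fun t ht => ?_
      have htS : t ∉ S := Finset.disjoint_right.1 h ht
      have hd : Disjoint S (T.erase t) := h.mono_right (Finset.erase_subset _ _)
      have he : (S ∪ T).erase t = S ∪ T.erase t := by
        rw [Finset.erase_union_distrib, Finset.erase_eq_of_notMem htS]
      simp only [letterMul, hd, if_true, Finsupp.smul_single, he, smul_eq_mul,
        ← Finsupp.single_neg]
      congr 1
      rw [contrSign, he, Finset.prod_union hd, shuffleSign_erase_right S ht, contrSign, letterSign]
      have := prod_transSign_mul_swap (k := k) htS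
      linear_combination (∏ x ∈ T.erase t, transSign k t x) * shuffleSign k S (T.erase t) * this
  · have e3 : letterMul k (γ, S) (γ', T) = 0 := by simp [letterMul, h]
    rw [e3, map_zero, eq_comm, sub_eq_zero]
    obtain ⟨u, huS, huT⟩ := Finset.not_disjoint_iff.1 h
    rw [Finset.sum_eq_single_of_mem u huS, Finset.sum_eq_single_of_mem u huT]
    · by_cases hd : Disjoint (S.erase u) T
      · have hd2 : Disjoint S (T.erase u) := by
          rw [Finset.disjoint_left] at hd ⊢
          intro x hx hx'
          simp only [Finset.mem_erase] at hd hx'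
          exact hd ⟨hx'.1, hx⟩ hx'.2
        have hun : S ∪ T.erase u = S.erase u ∪ T := by
          ext x
          simp only [Finset.mem_union, Finset.mem_erase]
          by_cases hx : x = u
          · subst hx; simp [huS, huT]
          · simp [hx]
        simp only [letterMul, hd, hd2, if_true, Finsupp.smul_single, hun, smul_eq_mul]
        congr 1
        rw [shuffleSign_erase_right (S.erase u) huT, shuffleSign_erase_left (T.erase u) huS,
          letterSign, ← Finset.card_erase_add_one huS]
        have h1 := prod_transSign_mul_swap (k := k) (Finset.notMem_erase u S)
        have h2 := prod_transSign_mul_self (k := k) (T.erase u) u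
        simp only [contrSign, pow_succ]
        linear_combination shuffleSign k (S.erase u) (T.erase u) * h1
          - (-1) ^ (S.erase u).card * shuffleSign k (S.erase u) (T.erase u) * h2
      · have hd2 : ¬ Disjoint S (T.erase u) := by
          rw [Finset.not_disjoint_iff] at hd ⊢
          obtain ⟨x, hx, hx'⟩ := hd
          simp only [Finset.mem_erase] at hx
          exact ⟨x, hx.2, Finset.mem_erase.2 ⟨hx.1, hx'⟩⟩
        simp [letterMul, hd, hd2]
    · intro t ht htu
      have : ¬ Disjoint S (T.erase t) :=
        Finset.not_disjoint_iff.2 ⟨u, huS, Finset.mem_erase.2 ⟨htu.symm, huT⟩⟩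
      simp [letterMul, this]
    · intro t ht htu
      have : ¬ Disjoint (S.erase t) T :=
        Finset.not_disjoint_iff.2 ⟨u, Finset.mem_erase.2 ⟨htu.symm, huS⟩, huT⟩
      simp [letterMul, this]

lemma letter_leibniz (u v : Letter σ →₀ k) :
    Finsupp.linearCombination k (letterDiff k) (mulLin (letterMul k) u v)
      = mulLin (letterMul k) (Finsupp.linearCombination k (letterDiff k) u) v
        - mulLin (letterMul k) (signLin (letterSign k) u)
          (Finsupp.linearCombination k (letterDiff k) v) := by
  induction u using Finsupp.induction_linear with
  | zero => simp
  | add v₁ v₂ h₁ h₂ => simp only [map_add, LinearMap.add_apply, h₁, h₂]; abel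
  | single a r =>
  induction v using Finsupp.induction_linear with
  | zero => simp
  | add v₁ v₂ h₁ h₂ => simp only [map_add, h₁, h₂]; abel
  | single b s =>
    have hb : Finsupp.single b s = s • Finsupp.single b (1 : k) := by simp
    have ha : Finsupp.single a (r * letterSign k a)
      = (r * letterSign k a) • Finsupp.single a (1 : k) := by simp
    simp only [mulLin_single, map_smul, letter_leibniz_basis, Finsupp.linearCombination_single,
      signLin_single, LinearMap.smul_apply]
    rw [hb, ha]
    simp only [map_smul, LinearMap.smul_apply]
    module

/-- Words in the letters. -/
abbrev Word (σ : Type*) := List (Letter σ)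

variable (k σ) in
/-- The differential of the bar construction of the (untruncated) Taylor algebra. -/
def wordDiff : (Word σ →₀ k) →ₗ[k] (Word σ →₀ k) :=
  barDiff (letterDiff k) (letterMul k) (letterSign k)

lemma wordDiff_wordDiff (e : Word σ →₀ k) : wordDiff k σ (wordDiff k σ e) = 0 :=
  barDiff_barDiff _ _ _ letter_assoc letter_diff_diff letter_sign_sign letter_diff_sign
    letter_sign_mul letter_leibniz e

/-- The relation that `v` occurs in the differential of `u`. -/
inductive Step : Word σ → Word σ → Prop
  | int (γ : Mon σ) (S : Finset (Mon σ)) (w : Word σ) (s : Mon σ) (hs : s ∈ S) :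
      Step ((γ, S) :: w) ((γ, S.erase s) :: w)
  | mrg (a b : Letter σ) (w : Word σ) (h : Disjoint a.2 b.2) :
      Step (a :: b :: w) ((a.1 + b.1, a.2 ∪ b.2) :: w)
  | cons (a : Letter σ) {v w : Word σ} (h : Step v w) : Step (a :: v) (a :: w)

variable (k) in
/-- The coefficient of `v` in the differential of `u`. -/
def wordCoeff (u v : Word σ) : k := wordDiff k σ (Finsupp.single u 1) v

lemma letterDiff_apply (a : Letter σ) (c : Letter σ) :
    letterDiff k a c = if c.1 = a.1 then
      ∑ s ∈ a.2, if a.2.erase s = c.2 then contrSign k a.2 s else 0 else 0 := by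
  obtain ⟨γ, S⟩ := a
  obtain ⟨γ', T⟩ := c
  simp only [letterDiff, Finsupp.finsetSum_apply, Finsupp.single_apply, Prod.mk.injEq]
  by_cases h : γ' = γ
  · simp [h]
  · simp [h, Ne.symm h]

lemma letterDiff_erase {γ : Mon σ} {S : Finset (Mon σ)} {s : Mon σ} (hs : s ∈ S) :
    letterDiff k (γ, S) (γ, S.erase s) = contrSign k S s := by
  rw [letterDiff_apply, if_pos rfl, Finset.sum_eq_single_of_mem s hs, if_pos rfl]
  intro t ht hts
  rw [if_neg]
  intro h
  have : t ∈ S.erase s := Finset.mem_erase.2 ⟨hts, ht⟩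
  rw [← (show S.erase t = S.erase s from h)] at this
  simp at this

lemma wordCoeff_nil (v : Word σ) : wordCoeff k [] v = 0 := by
  simp [wordCoeff, wordDiff, barDiffAux]

lemma wordCoeff_nil_right (u : Word σ) : wordCoeff k u [] = 0 := by
  simp [wordCoeff, wordDiff, barDiffAux_nil_apply]

lemma wordCoeff_singleton (a c : Letter σ) (v : Word σ) :
    wordCoeff k [a] (c :: v) = if v = [] then letterDiff k a c else 0 := by
  simp [wordCoeff, wordDiff, barDiffAux, prep_apply_cons, headMulAux, Finsupp.single_apply,
    eq_comm]

lemma wordCoeff_cons_cons (a b c : Letter σ) (u v : Word σ) :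
    wordCoeff k (a :: b :: u) (c :: v) = (if v = b :: u then letterDiff k a c else 0)
      + letterSign k a * ((if v = u then letterMul k a b c else 0)
        + if c = a then wordCoeff k (b :: u) v else 0) := by
  simp only [wordCoeff, wordDiff, barDiff_single, one_smul, Finsupp.add_apply,
    Finsupp.smul_apply, smul_eq_mul, prep_apply_cons, barDiffAux, headMulAux,
    Finsupp.single_apply, mul_ite, ite_mul, mul_one, mul_zero, zero_mul, one_mul]
  simp only [eq_comm (a := a) (b := c), eq_comm (a := b :: u) (b := v), eq_comm (a := u) (b := v)]

lemma Step.length {u v : Word σ} (h : Step u v) :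
    (v.map (fun a => a.1)).sum = (u.map (fun a => a.1)).sum ∧
    (v.map (fun a => a.2.card + 1)).sum + 1 = (u.map (fun a => a.2.card + 1)).sum := by
  induction h with
  | int γ S w s hs =>
    have := Finset.card_erase_add_one hs
    simp only [List.map_cons, List.sum_cons, true_and]
    omega
  | mrg a b w h =>
    simp only [List.map_cons, List.sum_cons, Finset.card_union_of_disjoint h, add_assoc, true_and]
    omega
  | cons a h ih =>
    simp only [List.map_cons, List.sum_cons, ih.1, true_and]
    omega

lemma Step.of_wordCoeff_ne_zero {u v : Word σ} (h : wordCoeff k u v ≠ 0) : Step u v := by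
  induction u generalizing v with
  | nil => exact absurd (wordCoeff_nil v) h
  | cons a u ih =>
    cases v with
    | nil => exact absurd (wordCoeff_nil_right _) h
    | cons c v =>
      have hint : letterDiff k a c ≠ 0 → Step (a :: u) (c :: u) := by
        intro h'
        rw [letterDiff_apply] at h'
        obtain ⟨γ, S⟩ := a
        obtain ⟨γ', T⟩ := c
        simp only [ne_eq, ite_eq_right_iff, Classical.not_imp] at h'
        obtain ⟨rfl, h'⟩ := h'
        obtain ⟨s, hs, h'⟩ := Finset.exists_ne_zero_of_sum_ne_zero h'
        simp only [ne_eq, ite_eq_right_iff, Classical.not_imp] at h'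
        obtain ⟨rfl, h'⟩ := h'
        exact Step.int _ _ _ _ hs
      cases u with
      | nil =>
        rw [wordCoeff_singleton] at h
        simp only [ne_eq, ite_eq_right_iff, Classical.not_imp] at h
        obtain ⟨rfl, h⟩ := h
        exact hint h
      | cons b u =>
        rw [wordCoeff_cons_cons] at h
        by_cases h1 : v = b :: u ∧ letterDiff k a c ≠ 0
        · rw [h1.1]; exact hint h1.2
        by_cases h2 : v = u ∧ letterMul k a b c ≠ 0
        · obtain ⟨rfl, h2⟩ := h2
          simp only [letterMul] at h2
          split_ifs at h2 with h3
          · simp only [Finsupp.single_apply, ne_eq, ite_eq_right_iff, Classical.not_imp] at h2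
            rw [← h2.1]
            exact Step.mrg _ _ _ h3
          · simp at h2
        by_cases h3 : c = a ∧ wordCoeff k (b :: u) v ≠ 0
        · rw [h3.1]
          exact Step.cons _ (ih h3.2)
        exfalso
        apply h
        simp only [not_and, not_not] at h1 h2 h3
        rw [ite_eq_right_iff.2 h1, ite_eq_right_iff.2 h2, ite_eq_right_iff.2 h3]
        simp

lemma Step.wordCoeff_ne_zero {u v : Word σ} (h : Step u v) (hu : ∀ a ∈ u, a.1 ≠ 0) :
    wordCoeff k u v ≠ 0 := by
  induction h with
  | int γ S w s hs =>
    have h1 := contrSign_ne_zero (k := k) S s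
    have h2 := letterDiff_erase (k := k) (γ := γ) hs
    cases w with
    | nil => rw [wordCoeff_singleton, if_pos rfl, h2]; exact h1
    | cons b w =>
      rw [wordCoeff_cons_cons, if_pos rfl, if_neg, if_neg, h2]
      · simpa using h1
      · simp [Finset.erase_eq_self, hs]
      · simp
  | mrg a b w h =>
    have hb : b.1 ≠ 0 := hu b (by simp)
    rw [wordCoeff_cons_cons, if_neg (by simp), if_pos rfl, if_neg]
    · simp [letterMul, h, letterSign_ne_zero, shuffleSign_ne_zero]
    · intro h
      have := congrArg Prod.fst h
      simp [hb] at this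
  | @cons a v w h ih =>
    have ih := ih (fun x hx => hu x (by simp [hx]))
    cases v with
    | nil => exact absurd (wordCoeff_nil _) ih
    | cons b v =>
      have hvw : w ≠ b :: v := by
        rintro rfl
        have := h.length.2
        omega
      rw [wordCoeff_cons_cons, if_neg hvw, if_pos rfl]
      have : letterMul k a b a = 0 := by
        unfold letterMul
        split_ifs
        · rw [Finsupp.single_apply, if_neg]
          intro h
          have := congrArg Prod.fst h
          have hb : b.1 ≠ 0 := hu b (by simp)
          simp [hb] at this
        · rfl
      simp [this, letterSign_ne_zero, ih]

end TaylorLetters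

end MonomialRings

namespace MonomialRings

section LinearAlgebra

variable {k : Type*} [Field k] {E E' : Type*} [AddCommGroup E] [Module k E]
  [AddCommGroup E'] [Module k E']

lemma finrank_map_add_finrank_inf_ker (f : E →ₗ[k] E') (V : Submodule k E)
    [FiniteDimensional k V] :
    Module.finrank k (V.map f) + Module.finrank k ↥(V ⊓ LinearMap.ker f) = Module.finrank k V := by
  have h := LinearMap.finrank_range_add_finrank_ker (f.domRestrict V)
  rw [LinearMap.range_domRestrict] at h
  rw [← h]
  congr 1
  rw [LinearMap.ker_domRestrict]
  have e := Submodule.equivMapOfInjective V.subtype V.subtype_injective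
    ((LinearMap.ker f).comap V.subtype)
  rw [e.finrank_eq, Submodule.map_comap_subtype]

/-- A linear map inducing an isomorphism `Z / B → Z' / B'` preserves dimension differences. -/
lemma finrank_sub_eq_of_quasiIso (f : E →ₗ[k] E') {Z B : Submodule k E} {Z' B' : Submodule k E'}
    [FiniteDimensional k Z] [FiniteDimensional k Z'] (hBZ : B ≤ Z) (hBZ' : B' ≤ Z')
    (hZ : ∀ z ∈ Z, f z ∈ Z') (hB : ∀ z ∈ B, f z ∈ B')
    (hsurj : ∀ z' ∈ Z', ∃ z ∈ Z, z' - f z ∈ B') (hinj : ∀ z ∈ Z, f z ∈ B' → z ∈ B) :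
    Module.finrank k Z - Module.finrank k B = Module.finrank k Z' - Module.finrank k B' := by
  have h1 := finrank_map_add_finrank_inf_ker (B'.mkQ ∘ₗ f) Z
  have h2 := finrank_map_add_finrank_inf_ker B'.mkQ Z'
  have e1 : Z ⊓ LinearMap.ker (B'.mkQ ∘ₗ f) = B := by
    ext z
    simp only [Submodule.mem_inf, LinearMap.mem_ker, LinearMap.comp_apply, Submodule.mkQ_apply,
      Submodule.Quotient.mk_eq_zero]
    exact ⟨fun h => hinj z h.1 h.2, fun h => ⟨hBZ h, hB z h⟩⟩
  have e2 : Z' ⊓ LinearMap.ker B'.mkQ = B' := by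
    rw [Submodule.ker_mkQ]; exact inf_eq_right.2 hBZ'
  have e3 : Z.map (B'.mkQ ∘ₗ f) = Z'.map B'.mkQ := by
    apply le_antisymm
    · rintro _ ⟨z, hz, rfl⟩
      exact ⟨f z, hZ z hz, rfl⟩
    · rintro _ ⟨z', hz', rfl⟩
      obtain ⟨z, hz, h⟩ := hsurj z' hz'
      refine ⟨z, hz, ?_⟩
      rw [LinearMap.comp_apply, eq_comm]
      exact (Submodule.Quotient.eq B').2 h
  rw [e1, e3] at h1
  rw [e2] at h2
  omega

end LinearAlgebra

section BasedComplex

variable {k : Type*} [Field k] {W : Type*}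

/-- The projection onto the span of a set of basis elements. -/
def projOn (P : Set W) : (W →₀ k) →ₗ[k] (W →₀ k) where
  toFun e := e.filter (· ∈ P)
  map_add' _ _ := Finsupp.filter_add
  map_smul' _ _ := Finsupp.filter_smul

lemma projOn_apply (P : Set W) (e : W →₀ k) (v : W) : projOn P e v = if v ∈ P then e v else 0 := by
  simp [projOn, Finsupp.filter_apply]

lemma projOn_mem (P : Set W) (e : W →₀ k) : projOn P e ∈ Finsupp.supported k k P := by
  rw [Finsupp.mem_supported']
  intro x hx
  rw [projOn_apply, if_neg hx]

lemma projOn_eq_self {P : Set W} {e : W →₀ k} (h : e ∈ Finsupp.supported k k P) :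
    projOn P e = e := by
  ext x
  rw [projOn_apply]
  split_ifs with hx
  · rfl
  · exact ((Finsupp.mem_supported' k e).1 h x hx).symm

variable (D : (W →₀ k) →ₗ[k] (W →₀ k)) (hd : W → ℕ)

/-- The differential induced on the subquotient spanned by the basis elements in `P`. -/
def subD (P : Set W) : (W →₀ k) →ₗ[k] (W →₀ k) := projOn P ∘ₗ D

/-- The basis elements of degree `n` in `P`. -/
def cell (P : Set W) (n : ℕ) : Set W := {w | w ∈ P ∧ hd w = n}

/-- Dimension of the degree-`n` homology of the subquotient spanned by `P`. -/
def hdim (P : Set W) (n : ℕ) : ℕ :=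
  Module.finrank k ↥(Finsupp.supported k k (cell hd P n) ⊓ LinearMap.ker (subD D P))
    - Module.finrank k ↥((Finsupp.supported k k (cell hd P (n + 1))).map (subD D P))

/-- The ambient differential squares to zero and lowers degree by one. -/
structure IsDiff : Prop where
  sq : ∀ e, D (D e) = 0
  deg : ∀ u v, D (Finsupp.single u 1) v ≠ 0 → hd v + 1 = hd u

/-- The set `P` spans a subquotient complex with finite-dimensional components. -/
structure IsSubquot (P : Set W) : Prop where
  fin : ∀ n, (cell hd P n).Finite
  convex : ∀ u ∈ P, ∀ v ∈ P, ∀ a, D (Finsupp.single u 1) a ≠ 0 → D (Finsupp.single a 1) v ≠ 0 →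
    a ∈ P

variable {D hd} {P : Set W}

lemma subD_apply (e : W →₀ k) (v : W) : subD D P e v = if v ∈ P then D e v else 0 :=
  projOn_apply _ _ _

lemma diff_apply (e : W →₀ k) (v : W) :
    D e v = e.sum fun u r => r * D (Finsupp.single u 1) v := by
  induction e using Finsupp.induction_linear with
  | zero => simp
  | add v₁ v₂ h₁ h₂ =>
    rw [map_add, Finsupp.add_apply, h₁, h₂, Finsupp.sum_add_index'] <;> intros <;> ring
  | single a r =>
    rw [Finsupp.sum_single_index (by simp), ← smul_eq_mul, ← Finsupp.smul_apply, ← map_smul]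
    simp

lemma diff_apply_ne_zero {e : W →₀ k} {v : W} (h : D e v ≠ 0) :
    ∃ u, e u ≠ 0 ∧ D (Finsupp.single u 1) v ≠ 0 := by
  rw [diff_apply, Finsupp.sum] at h
  obtain ⟨u, hu, h⟩ := Finset.exists_ne_zero_of_sum_ne_zero h
  exact ⟨u, left_ne_zero_of_mul h, right_ne_zero_of_mul h⟩

lemma IsSubquot.sq (hP : IsSubquot D hd P) (hD : IsDiff D hd) {e : W →₀ k}
    (he : e ∈ Finsupp.supported k k P) : subD D P (subD D P e) = 0 := by
  have key : ∀ u ∈ P, subD D P (subD D P (Finsupp.single u 1)) = 0 := by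
    intro u hu
    ext v
    rw [subD_apply]
    split_ifs with hv
    swap
    · rfl
    have h1 : D (subD D P (Finsupp.single u 1)) v
        = D (subD D P (Finsupp.single u 1) - D (Finsupp.single u 1)) v := by
      rw [map_sub, hD.sq, sub_zero]
    rw [h1]
    by_contra hne
    obtain ⟨a, ha, hav⟩ := diff_apply_ne_zero hne
    rw [Finsupp.sub_apply, subD_apply] at ha
    split_ifs at ha with haP
    · simp at ha
    · exact haP (hP.convex u hu v hv a (by simpa using ha) hav)
  rw [Finsupp.supported_eq_span_single] at he
  refine Submodule.span_induction ?_ ?_ ?_ ?_ he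
  · rintro _ ⟨u, hu, rfl⟩
    exact key u hu
  · simp
  · intro x y _ _ hx hy
    rw [map_add, map_add, hx, hy, add_zero]
  · intro r x _ hx
    rw [map_smul, map_smul, hx, smul_zero]

lemma cell_subset (n : ℕ) : cell hd P n ⊆ P := fun _ h => h.1

lemma supported_cell_le (n : ℕ) :
    Finsupp.supported k k (cell hd P n) ≤ Finsupp.supported k k P :=
  Finsupp.supported_mono (cell_subset n)

lemma subD_mem (hD : IsDiff D hd) {n : ℕ} {e : W →₀ k}
    (he : e ∈ Finsupp.supported k k (cell hd P (n + 1))) :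
    subD D P e ∈ Finsupp.supported k k (cell hd P n) := by
  rw [Finsupp.mem_supported'] at he ⊢
  intro v hv
  by_contra hne
  rw [subD_apply] at hne
  split_ifs at hne with hvP
  · obtain ⟨u, hu, huv⟩ := diff_apply_ne_zero hne
    apply hv
    have := hD.deg u v huv
    have h2 : u ∈ cell hd P (n + 1) := by_contra fun h => hu (he u h)
    exact ⟨hvP, by have := h2.2; omega⟩
  · exact hne rfl

lemma IsSubquot.finiteDimensional (hP : IsSubquot D hd P) (n : ℕ) :
    FiniteDimensional k (Finsupp.supported k k (cell hd P n)) := by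
  have := (hP.fin n).to_subtype
  exact LinearEquiv.finiteDimensional (Finsupp.supportedEquivFinsupp (cell hd P n)).symm

lemma finrank_supported_cell (n : ℕ) :
    Module.finrank k (Finsupp.supported k k (cell hd P n)) = (cell hd P n).ncard := by
  rw [(Finsupp.supportedEquivFinsupp (cell hd P n)).finrank_eq, Module.finrank, rank_finsupp_self]
  rw [Cardinal.toNat_lift]
  rfl

lemma IsSubquot.boundary_le (hP : IsSubquot D hd P) (hD : IsDiff D hd) (n : ℕ) :
    (Finsupp.supported k k (cell hd P (n + 1))).map (subD D P)
      ≤ Finsupp.supported k k (cell hd P n) ⊓ LinearMap.ker (subD D P) := by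
  rintro _ ⟨e, he, rfl⟩
  exact ⟨subD_mem hD he, hP.sq hD (supported_cell_le _ he)⟩

/-- Elimination of matched basis elements: a cycle modulo non-matched elements is homologous to a
combination of unmatched elements. -/
lemma exists_sub_boundary {ι : Type*} [LinearOrder ι] (hD : IsDiff D hd)
    (hP : IsSubquot D hd P) (Up Dn : W → Prop) (m g : W → W) (ρ : W → ι)
    (hm : ∀ u ∈ P, Up u → m u ∈ P ∧ Dn (m u) ∧ g (m u) = u ∧ D (Finsupp.single u 1) (m u) ≠ 0)
    (hlt : ∀ u ∈ P, Up u → ∀ d ∈ P, Dn d → D (Finsupp.single u 1) d ≠ 0 →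
      d = m u ∨ ρ d < ρ (m u))
    (hg : ∀ d ∈ P, Dn d → g d ∈ P ∧ Up (g d) ∧ m (g d) = d)
    {n : ℕ} (hcrit : ∀ c ∈ cell hd P n, ¬ Up c → ¬ Dn c →
      ∀ d ∈ P, Dn d → D (Finsupp.single c 1) d = 0)
    {z : W →₀ k} (hz : z ∈ Finsupp.supported k k (cell hd P n))
    (hDz : ∀ d ∈ P, Dn d → subD D P z d = 0) :
    ∃ y ∈ Finsupp.supported k k (cell hd P (n + 1)),
      ∀ w, Up w ∨ Dn w → (z - subD D P y) w = 0 := by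
  classical
  set DnP : Set W := {d | d ∈ cell hd P n ∧ Dn d} with hDnP
  have hfin : DnP.Finite := (hP.fin n).subset fun _ h => h.1
  set f : (W →₀ k) →ₗ[k] (W →₀ k) := projOn DnP ∘ₗ D
  have hsurj : ∀ d ∈ DnP, ∃ y ∈ Finsupp.supported k k (cell hd P (n + 1)),
      f y = Finsupp.single d 1 := by
    intro d
    induction hN : (hfin.toFinset.filter (fun d' => ρ d' < ρ d)).card using Nat.strong_induction_on
      generalizing d with
    | _ N ih =>
    intro hd'
    obtain ⟨hgP, hgU, hmg⟩ := hg d hd'.1.1 hd'.2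
    have hne := (hm _ hgP hgU).2.2.2
    rw [hmg] at hne
    have hdeg := hD.deg _ _ hne
    set c := D (Finsupp.single (g d) 1) d with hc
    have hlow : f (Finsupp.single (g d) 1) - c • Finsupp.single d 1 ∈
        (Finsupp.supported k k (cell hd P (n + 1))).map f := by
      have : f (Finsupp.single (g d) 1) - c • Finsupp.single d 1 ∈
          Finsupp.supported k k {d' | d' ∈ DnP ∧ ρ d' < ρ d} := by
        rw [Finsupp.mem_supported']
        intro x hx
        by_contra hne'
        apply hx
        rw [Finsupp.sub_apply, LinearMap.comp_apply, projOn_apply, Finsupp.smul_apply,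
          Finsupp.single_apply, smul_eq_mul] at hne'
        by_cases hxd : d = x
        · subst hxd
          rw [if_pos hd', if_pos rfl, mul_one, sub_self] at hne'
          exact absurd rfl hne'
        · rw [if_neg hxd, mul_zero, sub_zero] at hne'
          split_ifs at hne' with hxP
          · refine ⟨hxP, ?_⟩
            rcases hlt _ hgP hgU x hxP.1.1 hxP.2 hne' with h | h
            · rw [hmg] at h; exact absurd h.symm hxd
            · rwa [hmg] at h
          · exact absurd rfl hne'
      rw [Finsupp.supported_eq_span_single] at this
      refine Submodule.span_le.2 ?_ this
      rintro _ ⟨x, hx, rfl⟩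
      obtain ⟨y, hy, hfy⟩ := ih _ (by
        rw [← hN]
        apply Finset.card_lt_card
        refine ⟨?_, fun h => ?_⟩
        · intro x'
          simp only [Finset.mem_filter]
          exact fun h => ⟨h.1, h.2.trans hx.2⟩
        · have : x ∈ hfin.toFinset.filter (fun d' => ρ d' < ρ d) := by
            simp only [Finset.mem_filter, Set.Finite.mem_toFinset]
            exact ⟨hx.1, hx.2⟩
          simpa using h this) x rfl hx.1
      exact ⟨y, hy, hfy⟩
    obtain ⟨y, hy, hfy⟩ := hlow
    refine ⟨c⁻¹ • (Finsupp.single (g d) 1 - y), ?_, ?_⟩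
    · refine Submodule.smul_mem _ _ (Submodule.sub_mem _ ?_ hy)
      apply Finsupp.single_mem_supported
      exact ⟨hgP, by rw [← hdeg, hd'.1.2]⟩
    · rw [map_smul, map_sub, hfy, sub_sub_cancel, smul_smul, inv_mul_cancel₀ hne, one_smul]
  have hzDn : ∃ y ∈ Finsupp.supported k k (cell hd P (n + 1)), f y = projOn DnP z := by
    have h1 : projOn DnP z ∈ Finsupp.supported k k DnP := projOn_mem _ _
    rw [Finsupp.supported_eq_span_single] at h1
    have h2 : Submodule.span k ((fun d => Finsupp.single d (1 : k)) '' DnP)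
        ≤ (Finsupp.supported k k (cell hd P (n + 1))).map f := by
      rw [Submodule.span_le]
      rintro _ ⟨x, hx, rfl⟩
      exact hsurj x hx
    exact h2 h1
  obtain ⟨y, hy, hfy⟩ := hzDn
  refine ⟨y, hy, ?_⟩
  set z' := z - subD D P y with hz'
  have hz'mem : z' ∈ Finsupp.supported k k (cell hd P n) :=
    Submodule.sub_mem _ hz (subD_mem hD hy)
  have hz'mem' := (Finsupp.mem_supported' k z').1 hz'mem
  have hDnz : ∀ w, Dn w → z' w = 0 := by
    intro w hw
    by_cases hwc : w ∈ cell hd P n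
    · have h1 := DFunLike.congr_fun hfy w
      rw [LinearMap.comp_apply, projOn_apply, projOn_apply, if_pos ⟨hwc, hw⟩,
        if_pos ⟨hwc, hw⟩] at h1
      rw [hz', Finsupp.sub_apply, subD_apply, if_pos hwc.1, h1, sub_self]
    · exact hz'mem' w hwc
  have hDz' : ∀ d ∈ P, Dn d → D z' d = 0 := by
    intro d hd1 hd2
    have h1 := hDz d hd1 hd2
    have h2 : subD D P z' = subD D P z := by
      rw [hz', map_sub, hP.sq hD (supported_cell_le _ hy), sub_zero]
    rw [← h2, subD_apply, if_pos hd1] at h1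
    exact h1
  rintro w (hw | hw)
  swap
  · exact hDnz w hw
  by_contra hne
  obtain ⟨u, hu, humax⟩ := Finset.exists_max_image (z'.support.filter Up) (fun u => ρ (m u))
    ⟨w, by simp [hw, hne]⟩
  simp only [Finset.mem_filter, Finsupp.mem_support_iff] at hu humax
  have huP : u ∈ P := (by_contra fun h => hu.1 (hz'mem' u fun h' => h h'.1))
  obtain ⟨hmP, hmD, hgm, hmne⟩ := hm u huP hu.2
  have h0 := hDz' (m u) hmP hmD
  rw [diff_apply, Finsupp.sum, Finset.sum_eq_single_of_mem u (by simpa using hu.1)] at h0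
  · exact mul_ne_zero hu.1 hmne h0
  · intro v hv hvu
    by_contra hne'
    have hv1 := left_ne_zero_of_mul hne'
    have hv2 := right_ne_zero_of_mul hne'
    have hvc : v ∈ cell hd P n := by_contra fun h => hv1 (hz'mem' v h)
    have hvP := hvc.1
    by_cases hvU : Up v
    · rcases hlt v hvP hvU _ hmP hmD hv2 with h | h
      · apply hvu
        rw [← hgm, h, (hm v hvP hvU).2.2.1]
      · exact absurd (humax v ⟨hv1, hvU⟩) (not_le.2 h)
    · by_cases hvD : Dn v
      · exact hv1 (hDnz v hvD)
      · exact hv2 (hcrit v hvc hvU hvD _ hmP hmD)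

lemma IsSubquot.of_closed (hP : IsSubquot D hd P) {C : Set W} (hC : C ⊆ P)
    (hclosed : ∀ u ∈ C, ∀ v ∈ P, D (Finsupp.single u 1) v ≠ 0 → v ∈ C) : IsSubquot D hd C := by
  refine ⟨fun n => (hP.fin n).subset fun w h => ⟨hC h.1, h.2⟩, ?_⟩
  intro u hu v hv a hua hav
  exact hclosed u hu a (hP.convex u (hC hu) v (hC hv) a hua hav) hua

/-- Passing from a subquotient to its quotient by an exact subcomplex preserves homology. -/
lemma hdim_eq_of_exact_sub (hD : IsDiff D hd) (hP : IsSubquot D hd P) {N : Set W} (hN : N ⊆ P)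
    (hclosed : ∀ u ∈ N, ∀ v ∈ P, D (Finsupp.single u 1) v ≠ 0 → v ∈ N)
    (hbot : ∀ w, hd w = 0 → D (Finsupp.single w 1) = 0)
    (hex : ∀ n, ∀ z ∈ Finsupp.supported k k (cell hd N n), subD D N z = 0 →
      ∃ y ∈ Finsupp.supported k k (cell hd N (n + 1)), subD D N y = z) (n : ℕ) :
    IsSubquot D hd (P \ N) ∧ hdim D hd P n = hdim D hd (P \ N) n := by
  have hQ : IsSubquot D hd (P \ N) := by
    refine ⟨fun n => (hP.fin n).subset fun w h => ⟨h.1.1, h.2⟩, ?_⟩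
    intro u hu v hv a hua hav
    have := hP.convex u hu.1 v hv.1 a hua hav
    exact ⟨this, fun h => hv.2 (hclosed a h v hv.1 hav)⟩
  refine ⟨hQ, ?_⟩
  have hNP : ∀ n, Finsupp.supported k k (cell hd N n) ≤ Finsupp.supported k k (cell hd P n) :=
    fun n => Finsupp.supported_mono fun w h => ⟨hN h.1, h.2⟩
  have hsubN : ∀ e ∈ Finsupp.supported k k N, subD D P e = subD D N e := by
    intro e he
    ext v
    rw [subD_apply, subD_apply]
    by_cases hv : v ∈ N
    · rw [if_pos hv, if_pos (hN hv)]
    · rw [if_neg hv]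
      split_ifs with hvP
      · by_contra hne
        obtain ⟨u, hu, huv⟩ := diff_apply_ne_zero hne
        have huN : u ∈ N := by_contra fun h => hu ((Finsupp.mem_supported' k e).1 he u h)
        exact hv (hclosed u huN v hvP huv)
      · rfl
  have hexP : ∀ n, ∀ z ∈ Finsupp.supported k k (cell hd N n), subD D P z = 0 →
      ∃ y ∈ Finsupp.supported k k (cell hd N (n + 1)), subD D P y = z := by
    intro n z hz h
    rw [hsubN z (supported_cell_le _ hz)] at h
    obtain ⟨y, hy, h⟩ := hex n z hz h
    exact ⟨y, hy, by rw [hsubN y (supported_cell_le _ hy), h]⟩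
  -- an element whose projection vanishes lies in the subcomplex
  have hcellN : ∀ {n} {e : W →₀ k}, e ∈ Finsupp.supported k k (cell hd P n) →
      projOn (P \ N) e = 0 → e ∈ Finsupp.supported k k (cell hd N n) := by
    intro n e he h
    rw [Finsupp.mem_supported'] at he ⊢
    intro x hx
    by_contra hne
    have hxP : x ∈ cell hd P n := by_contra fun h => hne (he x h)
    have := DFunLike.congr_fun h x
    rw [projOn_apply, if_pos ⟨hxP.1, fun h => hx ⟨h, hxP.2⟩⟩] at this
    exact hne this
  have hproj : ∀ {n} {e : W →₀ k}, e ∈ Finsupp.supported k k (cell hd P n) →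
      projOn (P \ N) e ∈ Finsupp.supported k k (cell hd (P \ N) n) := by
    intro n e he
    rw [Finsupp.mem_supported'] at he ⊢
    intro x hx
    rw [projOn_apply]
    split_ifs with h
    · exact he x fun h' => hx ⟨h, h'.2⟩
    · rfl
  have hcomm : ∀ {e : W →₀ k}, e ∈ Finsupp.supported k k P →
      subD D (P \ N) (projOn (P \ N) e) = projOn (P \ N) (subD D P e) := by
    intro e he
    have h1 : subD D (P \ N) (e - projOn (P \ N) e) = 0 := by
      ext v
      rw [subD_apply]
      split_ifs with hv
      · by_contra hne
        obtain ⟨u, hu, huv⟩ := diff_apply_ne_zero hne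
        rw [Finsupp.sub_apply, projOn_apply] at hu
        split_ifs at hu with h
        · simp at hu
        · have huP : u ∈ P := by_contra fun h =>
            hu (by rw [(Finsupp.mem_supported' k e).1 he u h, sub_zero])
          have huN : u ∈ N := by_contra fun h' => h ⟨huP, h'⟩
          exact hv.2 (hclosed u huN v hv.1 huv)
      · rfl
    rw [map_sub, sub_eq_zero] at h1
    rw [← h1]
    ext v
    rw [projOn_apply, subD_apply, subD_apply]
    by_cases hv : v ∈ P \ N
    · simp [hv, hv.1]
    · simp [hv]
  have hQP : ∀ n, Finsupp.supported k k (cell hd (P \ N) n)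
      ≤ Finsupp.supported k k (cell hd P n) :=
    fun n => Finsupp.supported_mono fun w h => ⟨h.1.1, h.2⟩
  have := hP.finiteDimensional n
  have := hQ.finiteDimensional n
  refine finrank_sub_eq_of_quasiIso (projOn (P \ N)) (hP.boundary_le hD n) (hQ.boundary_le hD n)
    ?_ ?_ ?_ ?_
  · intro z hz
    refine Submodule.mem_inf.2 ⟨hproj hz.1, ?_⟩
    rw [LinearMap.mem_ker, hcomm (supported_cell_le _ hz.1), LinearMap.mem_ker.1 hz.2, map_zero]
  · rintro _ ⟨y, hy, rfl⟩
    exact ⟨_, hproj hy, hcomm (supported_cell_le _ hy)⟩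
  · intro z hz
    have hz1 := hQP n hz.1
    have hself : projOn (P \ N) z = z := projOn_eq_self (supported_cell_le _ hz.1)
    have h0 : projOn (P \ N) (subD D P z) = 0 := by
      rw [← hcomm (supported_cell_le _ hz1), hself]
      exact hz.2
    obtain ⟨x, hx, hxz⟩ : ∃ x ∈ Finsupp.supported k k (cell hd N n), subD D P x = subD D P z := by
      cases n with
      | zero =>
        refine ⟨0, Submodule.zero_mem _, ?_⟩
        rw [map_zero, eq_comm]
        ext v
        rw [subD_apply]
        split_ifs
        · by_contra hne
          obtain ⟨u, hu, huv⟩ := diff_apply_ne_zero hne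
          have huc : u ∈ cell hd P 0 :=
            by_contra fun h => hu ((Finsupp.mem_supported' k z).1 hz1 u h)
          rw [hbot u huc.2] at huv
          exact huv rfl
        · rfl
      | succ n =>
        exact hexP n _ (hcellN (subD_mem hD hz1) h0) (hP.sq hD (supported_cell_le _ hz1))
    refine ⟨z - x, Submodule.mem_inf.2 ⟨Submodule.sub_mem _ hz1 (hNP n hx), ?_⟩, ?_⟩
    · rw [LinearMap.mem_ker, map_sub, hxz, sub_self]
    · have hx0 : projOn (P \ N) x = 0 := by
        ext v
        rw [projOn_apply]
        split_ifs with hv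
        · exact (Finsupp.mem_supported' k x).1 hx v fun h => hv.2 h.1
        · rfl
      rw [map_sub, hself, hx0, sub_zero, sub_self]
      exact Submodule.zero_mem _
  · rintro z hz ⟨y, hy, hyz⟩
    have hy1 := hQP (n + 1) hy
    have h0 : projOn (P \ N) (z - subD D P y) = 0 := by
      rw [map_sub, ← hcomm (supported_cell_le _ hy1), projOn_eq_self (supported_cell_le _ hy),
        hyz, sub_self]
    have hmem := hcellN (Submodule.sub_mem _ hz.1 (subD_mem hD hy1)) h0
    obtain ⟨x, hx, hxz⟩ := hexP n _ hmem (by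
      rw [map_sub, LinearMap.mem_ker.1 hz.2, hP.sq hD (supported_cell_le _ hy1), sub_zero])
    refine ⟨x + y, Submodule.add_mem _ (hNP _ hx) hy1, ?_⟩
    rw [map_add, hxz, sub_add_cancel]

/-- Passing to a subcomplex with exact quotient preserves homology. -/
lemma hdim_eq_of_exact_quot (hD : IsDiff D hd) (hP : IsSubquot D hd P) {C : Set W} (hC : C ⊆ P)
    (hclosed : ∀ u ∈ C, ∀ v ∈ P, D (Finsupp.single u 1) v ≠ 0 → v ∈ C) (n : ℕ)
    (hex₁ : ∀ z ∈ Finsupp.supported k k (cell hd P n),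
      subD D P z = 0 → ∃ y ∈ Finsupp.supported k k (cell hd P (n + 1)),
        z - subD D P y ∈ Finsupp.supported k k C)
    (hex₂ : ∀ z ∈ Finsupp.supported k k (cell hd P (n + 1)),
      subD D P z ∈ Finsupp.supported k k C → ∃ y ∈ Finsupp.supported k k C,
        y ∈ Finsupp.supported k k (cell hd P (n + 1)) ∧ subD D P y = subD D P z) :
    hdim D hd C n = hdim D hd P n := by
  have hQ : IsSubquot D hd C := hP.of_closed hC hclosed
  have hsub : ∀ e ∈ Finsupp.supported k k C, subD D P e = subD D C e := by
    intro e he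
    ext v
    rw [subD_apply, subD_apply]
    by_cases hv : v ∈ C
    · rw [if_pos hv, if_pos (hC hv)]
    · rw [if_neg hv]
      split_ifs with hvP
      · by_contra hne
        obtain ⟨u, hu, huv⟩ := diff_apply_ne_zero hne
        have huN : u ∈ C := by_contra fun h => hu ((Finsupp.mem_supported' k e).1 he u h)
        exact hv (hclosed u huN v hvP huv)
      · rfl
  have hCP : ∀ n, Finsupp.supported k k (cell hd C n) ≤ Finsupp.supported k k (cell hd P n) :=
    fun n => Finsupp.supported_mono fun w h => ⟨hC h.1, h.2⟩
  have hcap : ∀ {n} {e : W →₀ k}, e ∈ Finsupp.supported k k (cell hd P n) →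
      e ∈ Finsupp.supported k k C → e ∈ Finsupp.supported k k (cell hd C n) := by
    intro n e h1 h2 x hx
    exact ⟨h2 hx, (h1 hx).2⟩
  have := hP.finiteDimensional n
  have := hQ.finiteDimensional n
  refine finrank_sub_eq_of_quasiIso LinearMap.id (hQ.boundary_le hD n) (hP.boundary_le hD n)
    ?_ ?_ ?_ ?_
  · intro z hz
    refine Submodule.mem_inf.2 ⟨hCP n hz.1, ?_⟩
    rw [LinearMap.id_apply, LinearMap.mem_ker, hsub z (supported_cell_le _ hz.1)]
    exact hz.2
  · rintro _ ⟨y, hy, rfl⟩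
    exact ⟨y, hCP _ hy, hsub y (supported_cell_le _ hy)⟩
  · intro z hz
    obtain ⟨y, hy, h⟩ := hex₁ z hz.1 hz.2
    have h1 := hcap (Submodule.sub_mem _ hz.1 (subD_mem hD hy)) h
    refine ⟨z - subD D P y, Submodule.mem_inf.2 ⟨h1, ?_⟩, ?_⟩
    · rw [LinearMap.mem_ker, ← hsub _ h, map_sub, LinearMap.mem_ker.1 hz.2,
        hP.sq hD (supported_cell_le _ hy), sub_zero]
    · rw [LinearMap.id_apply, sub_sub_cancel]
      exact ⟨y, hy, rfl⟩
  · rintro z hz ⟨y, hy, hyz⟩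
    rw [LinearMap.id_apply] at hyz
    obtain ⟨x, hx, hxP, hxy⟩ := hex₂ y hy (by rw [hyz]; exact supported_cell_le _ hz.1)
    refine ⟨x, hcap hxP hx, ?_⟩
    rw [← hsub x hx, hxy, hyz]

end BasedComplex

end MonomialRings

namespace MonomialRings

section WordSets

variable {k : Type*} [Field k] {σ : Type*}

/-- The multidegree of a word. -/
def wdeg (w : Word σ) : Mon σ := (w.map (fun a => a.1)).sum

/-- The homological degree of a word. -/
def whd (w : Word σ) : ℕ := (w.map (fun a => a.2.card + 1)).sum

@[simp] lemma wdeg_nil : wdeg ([] : Word σ) = 0 := rfl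
@[simp] lemma whd_nil : whd ([] : Word σ) = 0 := rfl
@[simp] lemma wdeg_cons (a : Letter σ) (w : Word σ) : wdeg (a :: w) = a.1 + wdeg w := by
  simp [wdeg]
@[simp] lemma whd_cons (a : Letter σ) (w : Word σ) : whd (a :: w) = a.2.card + 1 + whd w := by
  simp [whd]

lemma Step.wdeg {u v : Word σ} (h : Step u v) : wdeg v = wdeg u := h.length.1

lemma Step.whd {u v : Word σ} (h : Step u v) : whd v + 1 = whd u := h.length.2

lemma Step.of_coeff {u v : Word σ} (h : wordDiff k σ (Finsupp.single u 1) v ≠ 0) : Step u v :=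
  Step.of_wordCoeff_ne_zero h

lemma isDiff_wordDiff : IsDiff (wordDiff k σ) whd :=
  ⟨wordDiff_wordDiff, fun _ _ h => (Step.of_coeff h).whd⟩

lemma wordDiff_of_whd_eq_zero (w : Word σ) (h : MonomialRings.whd w = 0) :
    wordDiff k σ (Finsupp.single w 1) = 0 := by
  ext v
  by_contra hne
  have := (Step.of_coeff hne).whd
  omega

/-- The words of multidegree `α` all of whose letters lie in `L`. -/
def wset (L : Set (Letter σ)) (α : Mon σ) : Set (Word σ) :=
  {w | (∀ a ∈ w, a ∈ L) ∧ MonomialRings.wdeg w = α}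

/-- Closure of a set of letters under the terms of the differential and the product. -/
structure LetterClosed (A : Set (Letter σ)) : Prop where
  erase : ∀ γ S s, (γ, S) ∈ A → s ∈ S → (γ, S.erase s) ∈ A
  mul : ∀ a ∈ A, ∀ b ∈ A, Disjoint a.2 b.2 → (a.1 + b.1, a.2 ∪ b.2) ∈ A

/-- A set of letters stable under the differential and under products with letters from `L`,
as long as the outcome lies in `L`. -/
structure LetterIdeal (L B : Set (Letter σ)) : Prop where
  erase : ∀ γ S s, (γ, S) ∈ L → (γ, S) ∈ B → s ∈ S → (γ, S.erase s) ∈ L → (γ, S.erase s) ∈ B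
  mul : ∀ a ∈ L, ∀ b ∈ L, Disjoint a.2 b.2 → (a ∈ B ∨ b ∈ B) → (a.1 + b.1, a.2 ∪ b.2) ∈ L →
    (a.1 + b.1, a.2 ∪ b.2) ∈ B

lemma Step.closed {A : Set (Letter σ)} (hA : LetterClosed A) {u v : Word σ} (h : Step u v)
    (hu : ∀ a ∈ u, a ∈ A) : ∀ a ∈ v, a ∈ A := by
  induction h with
  | int γ S w s hs =>
    simp only [List.mem_cons, forall_eq_or_imp] at hu ⊢
    exact ⟨hA.erase _ _ _ hu.1 hs, hu.2⟩
  | mrg a b w h =>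
    simp only [List.mem_cons, forall_eq_or_imp] at hu ⊢
    exact ⟨hA.mul _ hu.1 _ hu.2.1 h, hu.2.2⟩
  | cons a h ih =>
    simp only [List.mem_cons, forall_eq_or_imp] at hu ⊢
    exact ⟨hu.1, ih hu.2⟩

lemma Step.ideal {L B : Set (Letter σ)} (hB : LetterIdeal L B) {u v : Word σ} (h : Step u v)
    (hu : ∀ a ∈ u, a ∈ L) (hv : ∀ a ∈ v, a ∈ L) (huB : ∃ a ∈ u, a ∈ B) : ∃ a ∈ v, a ∈ B := by
  induction h with
  | int γ S w s hs =>
    simp only [List.mem_cons, forall_eq_or_imp, exists_eq_or_imp] at hu hv huB ⊢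
    exact huB.imp (fun h => hB.erase _ _ _ hu.1 h hs hv.1) id
  | mrg a b w h =>
    simp only [List.mem_cons, forall_eq_or_imp, exists_eq_or_imp] at hu hv huB ⊢
    rcases huB with h1 | h1 | h1
    · exact Or.inl (hB.mul _ hu.1 _ hu.2.1 h (Or.inl h1) hv.1)
    · exact Or.inl (hB.mul _ hu.1 _ hu.2.1 h (Or.inr h1) hv.1)
    · exact Or.inr h1
  | cons a h ih =>
    simp only [List.mem_cons, forall_eq_or_imp, exists_eq_or_imp] at hu hv huB ⊢
    exact huB.imp id (ih hu.2 hv.2)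

lemma finite_cell_wset [Finite σ] {L : Set (Letter σ)} {G : Finset (Mon σ)}
    (hG : ∀ a ∈ L, a.2 ⊆ G) (α : Mon σ) (n : ℕ) :
    (cell MonomialRings.whd (wset L α) n).Finite := by
  have := Fintype.ofFinite σ
  set s : Set (Letter σ) := Set.Iic α ×ˢ (G.powerset : Set (Finset (Mon σ)))
  have hs : s.Finite := (Set.finite_Iic α).prod (Finset.finite_toSet _)
  have := hs.to_subtype
  refine ((List.finite_length_le s n).image (List.map Subtype.val)).subset ?_
  rintro w ⟨⟨hw, hα⟩, hn⟩
  have hlen : w.length ≤ n := by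
    rw [← hn]
    clear hn hα hw
    induction w with
    | nil => simp
    | cons a w ih => simp only [List.length_cons, whd_cons]; omega
  have hmem : ∀ a ∈ w, a ∈ s := by
    intro a ha
    refine ⟨?_, ?_⟩
    · rw [← hα]
      exact List.single_le_sum (l := w.map fun a => a.1) (by simp) _ (List.mem_map_of_mem ha)
    · simpa using hG a (hw a ha)
  lift w to List s using hmem
  exact ⟨w, by simpa using hlen, rfl⟩

lemma isSubquot_wset [Finite σ] {A B : Set (Letter σ)} {G : Finset (Mon σ)}
    (hG : ∀ a ∈ A, a.2 ⊆ G) (hA : LetterClosed A) (hB : LetterIdeal A B) (α : Mon σ) :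
    IsSubquot (wordDiff k σ) MonomialRings.whd (wset (A \ B) α) := by
  refine ⟨finite_cell_wset (G := G) (fun a ha => hG a ha.1) α, ?_⟩
  intro u hu v hv a hua hav
  have h1 := Step.of_coeff hua
  have h2 := Step.of_coeff hav
  have haA : ∀ x ∈ a, x ∈ A := h1.closed hA fun x hx => (hu.1 x hx).1
  refine ⟨fun x hx => ⟨haA x hx, fun hxB => ?_⟩, h1.wdeg.trans hu.2⟩
  obtain ⟨y, hy, hyB⟩ := h2.ideal hB haA (fun x hx => (hv.1 x hx).1) ⟨x, hx, hxB⟩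
  exact (hv.1 y hy).2 hyB

end WordSets

section Toggle

variable {k : Type*} [Field k] {σ : Type*}

/-- Adding or removing a generator, depending on the multidegree, in a letter. -/
def toggleLetter (n : Mon σ → Mon σ) (a : Letter σ) : Letter σ :=
  (a.1, if n a.1 ∈ a.2 then a.2.erase (n a.1) else insert (n a.1) a.2)

lemma toggleLetter_toggleLetter (n : Mon σ → Mon σ) (a : Letter σ) :
    toggleLetter n (toggleLetter n a) = a := by
  obtain ⟨γ, S⟩ := a
  by_cases h : n γ ∈ S <;> simp [toggleLetter, h]

lemma mem_toggleLetter (n : Mon σ → Mon σ) (a : Letter σ) :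
    n (toggleLetter n a).1 ∈ (toggleLetter n a).2 ↔ n a.1 ∉ a.2 := by
  obtain ⟨γ, S⟩ := a
  by_cases h : n γ ∈ S <;> simp [toggleLetter, h]

variable (Sp : Set (Letter σ)) (n : Mon σ → Mon σ)

/-- The first special letter contains its distinguished generator. -/
def toggleUp : Word σ → Prop
  | [] => False
  | a :: w => if a ∈ Sp then n a.1 ∈ a.2 else toggleUp w

/-- The first special letter does not contain its distinguished generator. -/
def toggleDn : Word σ → Prop
  | [] => False
  | a :: w => if a ∈ Sp then n a.1 ∉ a.2 else toggleDn w

/-- Toggling the first special letter. -/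
def toggleWord : Word σ → Word σ
  | [] => []
  | a :: w => if a ∈ Sp then toggleLetter n a :: w else a :: toggleWord w

variable {Sp n}

lemma not_toggleUp_and_toggleDn {w : Word σ} (h : toggleUp Sp n w) : ¬ toggleDn Sp n w := by
  induction w with
  | nil => simp [toggleDn]
  | cons a w ih =>
    simp only [toggleUp, toggleDn] at h ⊢
    split_ifs with ha
    · simpa [ha] using h
    · exact ih (by simpa [ha] using h)

lemma toggleUp_or_toggleDn {w : Word σ} (h : ∃ a ∈ w, a ∈ Sp) :
    toggleUp Sp n w ∨ toggleDn Sp n w := by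
  induction w with
  | nil => simp at h
  | cons a w ih =>
    simp only [toggleUp, toggleDn]
    split_ifs with ha
    · exact em _
    · exact ih (by simpa [ha] using h)

/-- The hypotheses making `toggleWord` an acyclic matching. -/
structure ToggleData (L Sp : Set (Letter σ)) (n : Mon σ → Mon σ) (rk : Letter σ → ℕ) : Prop where
  ne_zero : ∀ a ∈ L, a.1 ≠ 0
  ideal : LetterIdeal L Sp
  toggle : ∀ a ∈ L, a ∈ Sp → toggleLetter n a ∈ L ∧ toggleLetter n a ∈ Sp
  rk_erase : ∀ γ S s, (γ, S) ∈ L → (γ, S) ∉ Sp → s ∈ S → (γ, S.erase s) ∈ L →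
    (γ, S.erase s) ∈ Sp → rk (γ, S.erase s) < rk (γ, S)
  rk_mul : ∀ a ∈ L, ∀ b ∈ L, Disjoint a.2 b.2 → rk (a.1 + b.1, a.2 ∪ b.2) ≤ rk a + rk b
  rk_toggle : ∀ a ∈ L, a ∈ Sp → rk (toggleLetter n a) = rk a

variable {L : Set (Letter σ)} {rk : Letter σ → ℕ}

lemma ToggleData.toggleWord_spec (hT : ToggleData L Sp n rk) {w : Word σ} (hw : ∀ a ∈ w, a ∈ L)
    (hs : ∃ a ∈ w, a ∈ Sp) :
    (∀ a ∈ toggleWord Sp n w, a ∈ L) ∧ (∃ a ∈ toggleWord Sp n w, a ∈ Sp) ∧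
    wdeg (toggleWord Sp n w) = wdeg w ∧
    (toggleUp Sp n (toggleWord Sp n w) ↔ toggleDn Sp n w) ∧
    (toggleDn Sp n (toggleWord Sp n w) ↔ toggleUp Sp n w) ∧
    toggleWord Sp n (toggleWord Sp n w) = w ∧
    ((toggleWord Sp n w).map (fun a => rk a + 1)).sum = (w.map (fun a => rk a + 1)).sum ∧
    (toggleUp Sp n w → Step w (toggleWord Sp n w)) := by
  induction w with
  | nil => simp at hs
  | cons a w ih =>
    simp only [List.mem_cons, forall_eq_or_imp, exists_eq_or_imp] at hw hs
    by_cases ha : a ∈ Sp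
    · obtain ⟨h1, h2⟩ := hT.toggle a hw.1 ha
      simp only [toggleWord, toggleUp, toggleDn, ha, h2, if_true, List.mem_cons, forall_eq_or_imp,
        exists_eq_or_imp, true_or, List.map_cons, List.sum_cons, hT.rk_toggle a hw.1 ha,
        mem_toggleLetter, toggleLetter_toggleLetter, not_not, wdeg_cons, h1, true_and]
      refine ⟨hw.2, rfl, fun h => ?_⟩
      obtain ⟨γ, S⟩ := a
      simp only at h
      simp only [toggleLetter, h, if_true]
      exact Step.int _ _ _ _ h
    · obtain ⟨i1, i2, i3, i4, i5, i6, i7, i8⟩ := ih hw.2 (by simpa [ha] using hs)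
      simp only [toggleWord, toggleUp, toggleDn, ha, if_false, List.mem_cons, forall_eq_or_imp,
        exists_eq_or_imp, false_or, List.map_cons, List.sum_cons, wdeg_cons, hw.1, true_and]
      exact ⟨i1, i2, by rw [i3], i4, i5, by rw [i6], by rw [i7], fun h => (i8 h).cons _⟩

lemma ToggleData.lt (hT : ToggleData L Sp n rk) {u d : Word σ} (h : Step u d)
    (hu : ∀ a ∈ u, a ∈ L) (hd : ∀ a ∈ d, a ∈ L) (hup : toggleUp Sp n u) (hdn : toggleDn Sp n d) :
    d = toggleWord Sp n u ∨ (d.map (fun a => rk a + 1)).sum < (u.map (fun a => rk a + 1)).sum := by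
  induction h with
  | int γ S w s hs =>
    simp only [List.mem_cons, forall_eq_or_imp] at hu hd
    by_cases ha : (γ, S) ∈ Sp
    · have ha' := hT.ideal.erase _ _ _ hu.1 ha hs hd.1
      simp only [toggleUp, toggleDn, ha, ha', if_true] at hup hdn
      left
      have : s = n γ := by
        by_contra hne
        exact hdn (Finset.mem_erase.2 ⟨fun h => hne h.symm, hup⟩)
      subst this
      simp [toggleWord, ha, toggleLetter, hup]
    · by_cases ha' : (γ, S.erase s) ∈ Sp
      · right
        have := hT.rk_erase _ _ _ hu.1 ha hs hd.1 ha'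
        simp only [List.map_cons, List.sum_cons]
        omega
      · simp only [toggleUp, toggleDn, ha, ha', if_false] at hup hdn
        exact absurd hdn (not_toggleUp_and_toggleDn hup)
  | mrg a b w h =>
    right
    simp only [List.mem_cons, forall_eq_or_imp] at hu hd
    have := hT.rk_mul a hu.1 b hu.2.1 h
    simp only [List.map_cons, List.sum_cons]
    omega
  | cons a h ih =>
    simp only [List.mem_cons, forall_eq_or_imp] at hu hd
    by_cases ha : a ∈ Sp
    · simp only [toggleUp, toggleDn, ha, if_true] at hup hdn
      exact absurd hup hdn
    · simp only [toggleUp, toggleDn, ha, if_false] at hup hdn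
      rcases ih hu.2 hd.2 hup hdn with h | h
      · left; simp [toggleWord, ha, h]
      · right; simp only [List.map_cons, List.sum_cons]; omega

lemma ToggleData.hdim_eq (hT : ToggleData L Sp n rk) {α : Mon σ}
    (hP : IsSubquot (wordDiff k σ) whd (wset L α)) (m : ℕ) :
    hdim (wordDiff k σ) whd (wset L α) m = hdim (wordDiff k σ) whd (wset (L \ Sp) α) m := by
  set N : Set (Word σ) := {w | w ∈ wset L α ∧ ∃ a ∈ w, a ∈ Sp} with hN
  have hdiff : wset L α \ N = wset (L \ Sp) α := by
    ext w
    simp only [hN, wset, Set.mem_sdiff, Set.mem_ofPred_eq, not_and, not_exists]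
    constructor
    · rintro ⟨⟨h1, h2⟩, h3⟩
      exact ⟨fun a ha => ⟨h1 a ha, h3 ⟨h1, h2⟩ a ha⟩, h2⟩
    · rintro ⟨h1, h2⟩
      exact ⟨⟨fun a ha => (h1 a ha).1, h2⟩, fun _ a ha => (h1 a ha).2⟩
  have hclosed : ∀ u ∈ N, ∀ v ∈ wset L α, wordDiff k σ (Finsupp.single u 1) v ≠ 0 → v ∈ N :=
    fun u hu v hv huv => ⟨hv, (Step.of_coeff huv).ideal hT.ideal hu.1.1 hv.1 hu.2⟩
  have hNP : N ⊆ wset L α := fun w h => h.1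
  have hNsub := hP.of_closed hNP hclosed
  rw [← hdiff]
  refine (hdim_eq_of_exact_sub isDiff_wordDiff hP hNP hclosed wordDiff_of_whd_eq_zero ?_ m).2
  intro m z hz hDz
  obtain ⟨y, hy, h⟩ := exists_sub_boundary isDiff_wordDiff hNsub (toggleUp Sp n) (toggleDn Sp n)
    (toggleWord Sp n) (toggleWord Sp n) (fun w => (w.map (fun a => rk a + 1)).sum)
    (fun u hu hup => by
      obtain ⟨i1, i2, i3, i4, i5, i6, i7, i8⟩ := hT.toggleWord_spec hu.1.1 hu.2
      exact ⟨⟨⟨i1, i3.trans hu.1.2⟩, i2⟩, i5.2 hup, i6,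
        (i8 hup).wordCoeff_ne_zero fun a ha => hT.ne_zero a (hu.1.1 a ha)⟩)
    (fun u hu hup d hd hdn hne => by
      obtain ⟨i1, i2, i3, i4, i5, i6, i7, i8⟩ := hT.toggleWord_spec hu.1.1 hu.2
      simp only [i7]
      exact hT.lt (Step.of_coeff hne) hu.1.1 hd.1.1 hup hdn)
    (fun d hd hdn => by
      obtain ⟨i1, i2, i3, i4, i5, i6, i7, i8⟩ := hT.toggleWord_spec hd.1.1 hd.2
      exact ⟨⟨⟨i1, i3.trans hd.1.2⟩, i2⟩, i4.2 hdn, i6⟩)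
    (fun c hc h1 h2 => absurd (toggleUp_or_toggleDn hc.1.2) (by tauto))
    hz (fun d _ _ => by rw [hDz]; rfl)
  refine ⟨y, hy, ?_⟩
  rw [eq_comm, ← sub_eq_zero]
  ext w
  by_cases hw : w ∈ cell whd N m
  · exact h w (toggleUp_or_toggleDn hw.1.2)
  · exact (Finsupp.mem_supported' k _).1 (Submodule.sub_mem _ hz (subD_mem isDiff_wordDiff hy)) w hw

end Toggle

end MonomialRings

namespace MonomialRings

section LetterSets

variable {σ : Type*}

lemma mlcm_empty : mlcm (∅ : Finset (Mon σ)) = 0 := rfl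

lemma mlcm_insert (s : Mon σ) (S : Finset (Mon σ)) : mlcm (insert s S) = s ⊔ mlcm S := by
  simp [mlcm]

lemma mlcm_union (S T : Finset (Mon σ)) : mlcm (S ∪ T) = mlcm S ⊔ mlcm T := by
  simp [mlcm, Finset.sup_union]

lemma mlcm_mono {S T : Finset (Mon σ)} (h : S ⊆ T) : mlcm S ≤ mlcm T := Finset.sup_mono h

lemma le_mlcm {s : Mon σ} {S : Finset (Mon σ)} (h : s ∈ S) : s ≤ mlcm S :=
  Finset.le_sup (f := id) h

lemma Mon.le_apply {a b : Mon σ} (h : a ≤ b) (i : σ) : a i ≤ b i := h i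

lemma mlcm_insert_zero (S : Finset (Mon σ)) : mlcm (insert 0 S) = mlcm S := by
  rw [mlcm_insert]
  exact sup_eq_right.2 (fun i => Nat.zero_le _)

lemma mlcm_erase_zero (S : Finset (Mon σ)) : mlcm (S.erase 0) = mlcm S := by
  by_cases h : (0 : Mon σ) ∈ S
  · conv_rhs => rw [← Finset.insert_erase h, mlcm_insert_zero]
  · rw [Finset.erase_eq_of_notMem h]

/-- The smallest multidegree of a letter with exterior part `S`: the least common multiple
of `S`, corrected by the multidegree `ξ` of an additional exterior generator, which is encoded
by `0 ∈ S`. -/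
def baseDeg (ξ : Mon σ) (S : Finset (Mon σ)) : Mon σ := mlcm S + if 0 ∈ S then ξ else 0

/-- The letters with exterior part in `G`. -/
def ambient (ξ : Mon σ) (G : Finset (Mon σ)) : Set (Letter σ) :=
  {a | a.1 ≠ 0 ∧ a.2 ⊆ G ∧ baseDeg ξ a.2 ≤ a.1}

/-- The letters whose multidegree exceeds the least common multiple of the exterior part
in some direction from `J`. -/
def excess (J : Set σ) : Set (Letter σ) := {a | ∃ j ∈ J, mlcm a.2 j ≠ a.1 j}

variable {ξ : Mon σ} {G : Finset (Mon σ)} {J : Set σ}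

lemma mlcm_le_baseDeg (S : Finset (Mon σ)) : mlcm S ≤ baseDeg ξ S :=
  le_add_of_nonneg_right (fun _ => Nat.zero_le _)

lemma baseDeg_of_notMem {S : Finset (Mon σ)} (h : 0 ∉ S) : baseDeg ξ S = mlcm S := by
  simp [baseDeg, h]

lemma ambient.mlcm_le {a : Letter σ} (h : a ∈ ambient ξ G) : mlcm a.2 ≤ a.1 :=
  (mlcm_le_baseDeg _).trans h.2.2

lemma baseDeg_mono {S T : Finset (Mon σ)} (h : S ⊆ T) : baseDeg ξ S ≤ baseDeg ξ T := by
  refine add_le_add (mlcm_mono h) ?_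
  split_ifs with h1 h2 h2
  · exact le_rfl
  · exact absurd (h h1) h2
  · exact fun i => Nat.zero_le _
  · exact le_rfl

lemma baseDeg_union {S T : Finset (Mon σ)} :
    baseDeg ξ (S ∪ T) ≤ baseDeg ξ S + baseDeg ξ T := by
  intro i
  simp only [baseDeg, mlcm_union, Finset.mem_union, Pi.add_apply, Pi.sup_apply]
  by_cases h1 : (0 : Mon σ) ∈ S <;> by_cases h2 : (0 : Mon σ) ∈ T <;>
    simp only [h1, h2, or_true, true_or, or_self, if_true, if_false, Pi.zero_apply] <;>
    rcases le_total (mlcm S i) (mlcm T i) with h | h <;>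
    simp only [sup_eq_right.2 h, sup_eq_left.2 h] <;> omega

lemma letterClosed_ambient : LetterClosed (ambient ξ G) := by
  refine ⟨fun γ S s h _ => ?_, fun a ha b hb _ => ?_⟩
  · exact ⟨h.1, (Finset.erase_subset _ _).trans h.2.1,
      (baseDeg_mono (Finset.erase_subset _ _)).trans h.2.2⟩
  · refine ⟨fun h0 => ha.1 ?_, Finset.union_subset ha.2.1 hb.2.1,
      baseDeg_union.trans (add_le_add ha.2.2 hb.2.2)⟩
    ext i
    have := congrFun h0 i
    simp only [Pi.add_apply, Pi.zero_apply] at this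
    simp only [Pi.zero_apply]
    omega

lemma letterIdeal_excess : LetterIdeal (ambient ξ G) (excess J) := by
  refine ⟨fun γ S s hL h _ _ => ?_, fun a ha b hb _ h _ => ?_⟩
  · obtain ⟨j, hj, hne⟩ := h
    refine ⟨j, hj, ?_⟩
    have h1 := Mon.le_apply (mlcm_mono (Finset.erase_subset s S)) j
    have h2 := Mon.le_apply (ambient.mlcm_le hL) j
    simp only at hne h2 ⊢
    omega
  · rcases h with ⟨j, hj, hne⟩ | ⟨j, hj, hne⟩ <;> refine ⟨j, hj, ?_⟩ <;>
      have h1 := Mon.le_apply (ambient.mlcm_le ha) j <;> have h2 := Mon.le_apply (ambient.mlcm_le hb) j <;>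
      simp only [mlcm_union, Pi.sup_apply, Pi.add_apply] <;>
      rcases le_total (mlcm a.2 j) (mlcm b.2 j) with h | h <;>
      simp only [sup_eq_right.2 h, sup_eq_left.2 h] <;> omega

lemma LetterIdeal.mono {L L' B : Set (Letter σ)} (h : LetterIdeal L B) (hL : L' ⊆ L) :
    LetterIdeal L' B :=
  ⟨fun γ S s h1 h2 h3 h4 => h.erase γ S s (hL h1) h2 h3 (hL h4),
    fun a ha b hb h1 h2 h3 => h.mul a (hL ha) b (hL hb) h1 h2 (hL h3)⟩

lemma baseDeg_insert_zero_le {γ : Mon σ} {S : Finset (Mon σ)} {i : σ} (h : mlcm S ≤ γ)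
    (hi : mlcm S i ≠ γ i) : baseDeg (Pi.single i 1) (insert 0 S) ≤ γ := by
  intro j
  have h1 := Mon.le_apply h j
  rw [baseDeg, if_pos (Finset.mem_insert_self _ _), mlcm_insert_zero, Pi.add_apply]
  by_cases hj : j = i
  · subst hj
    rw [Pi.single_eq_same]
    exact Nat.lt_of_le_of_ne h1 hi
  · rw [Pi.single_eq_of_ne hj]
    exact h1

lemma mem_excess_of_zero_mem {γ : Mon σ} {S : Finset (Mon σ)} {i : σ}
    (h : (γ, S) ∈ ambient (Pi.single i 1) G) (h0 : 0 ∈ S) : (γ, S) ∈ excess {i} := by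
  refine ⟨i, rfl, ?_⟩
  have := h.2.2 i
  simp only [baseDeg, h0, if_true, Pi.add_apply, Pi.single_eq_same] at this ⊢
  omega

lemma ambient_insert_zero_sdiff {M : Finset (Mon σ)} (hM : 0 ∉ M) (i : σ) :
    (ambient (Pi.single i 1) (insert 0 M) \ excess J) \ excess {i} =
      ambient 0 M \ excess (insert i J) := by
  ext ⟨γ, S⟩
  have h3 : (γ, S) ∈ excess (insert i J) ↔ (γ, S) ∈ excess {i} ∨ (γ, S) ∈ excess J := by
    simp [excess]
  simp only [Set.mem_sdiff, h3, not_or]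
  constructor
  · rintro ⟨⟨h1, h2⟩, h4⟩
    have h0 : (0 : Mon σ) ∉ S := fun h0 => h4 (mem_excess_of_zero_mem h1 h0)
    refine ⟨⟨h1.1, (Finset.subset_insert_iff_of_notMem h0).1 h1.2.1, ?_⟩, h4, h2⟩
    have := h1.2.2
    rwa [baseDeg_of_notMem h0] at this ⊢
  · rintro ⟨h1, h4, h2⟩
    have h0 : (0 : Mon σ) ∉ S := fun h => hM (h1.2.1 h)
    refine ⟨⟨⟨h1.1, h1.2.1.trans (Finset.subset_insert _ _), ?_⟩, h2⟩, h4⟩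
    have := h1.2.2
    rwa [baseDeg_of_notMem h0] at this ⊢

lemma toggleData_zero {M : Finset (Mon σ)} {i : σ} (hi : i ∉ J) :
    ToggleData (ambient (Pi.single i 1) (insert 0 M) \ excess J) (excess {i}) (fun _ => 0)
      (fun a => (a.2.erase 0).card) := by
  refine ⟨fun a ha => ha.1.1, letterIdeal_excess.mono Set.sdiff_subset, ?_, ?_, ?_, ?_⟩
  · rintro ⟨γ, S⟩ ⟨h1, h2⟩ h3
    have hlcm : mlcm (toggleLetter (fun _ => (0 : Mon σ)) (γ, S)).2 = mlcm S := by
      simp only [toggleLetter]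
      split_ifs
      · exact mlcm_erase_zero S
      · exact mlcm_insert_zero S
    have hex : ∀ J : Set σ, toggleLetter (fun _ => 0) (γ, S) ∈ excess J ↔ (γ, S) ∈ excess J := by
      intro J
      simp only [excess, Set.mem_ofPred_eq, hlcm]
      rfl
    refine ⟨⟨⟨h1.1, ?_, ?_⟩, by rwa [hex]⟩, (hex _).2 h3⟩
    · simp only [toggleLetter]
      split_ifs
      · exact (Finset.erase_subset _ _).trans h1.2.1
      · exact Finset.insert_subset (Finset.mem_insert_self _ _) h1.2.1
    · simp only [toggleLetter]
      split_ifs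
      · exact (baseDeg_mono (Finset.erase_subset _ _)).trans h1.2.2
      · obtain ⟨j, rfl, hne⟩ := h3
        exact baseDeg_insert_zero_le (ambient.mlcm_le h1) hne
  · intro γ S s h1 h2 hs _ _
    have h0 : (0 : Mon σ) ∉ S := fun h0 => h2 (mem_excess_of_zero_mem h1.1 h0)
    simp only [Finset.erase_right_comm (a := s), Finset.erase_eq_of_notMem h0]
    exact Finset.card_lt_card (Finset.erase_ssubset hs)
  · intro a _ b _ _
    simp only [Finset.erase_union_distrib]
    exact Finset.card_union_le _ _
  · intro a _ _
    simp only [toggleLetter]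
    split_ifs with h <;> simp

/-- A chosen element of `M` dividing `γ`. -/
def divisor (M : Finset (Mon σ)) (γ : Mon σ) : Mon σ :=
  if h : γ ∈ upperSet M then h.choose else 0

lemma toggleData_divisor {M : Finset (Mon σ)} (hM : 0 ∉ M) :
    ToggleData (ambient 0 M) {a : Letter σ | a.1 ∈ upperSet M} (divisor M) (fun _ => 0) := by
  refine ⟨fun a ha => ha.1, ⟨fun γ S s _ h _ _ => h, ?_⟩, ?_, ?_, ?_, ?_⟩
  · rintro a - b - - (⟨m, hm, h⟩ | ⟨m, hm, h⟩) -
    · exact ⟨m, hm, h.trans (le_add_of_nonneg_right fun i => Nat.zero_le _)⟩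
    · exact ⟨m, hm, h.trans (le_add_of_nonneg_left fun i => Nat.zero_le _)⟩
  · rintro ⟨γ, S⟩ h1 h2
    have hd : divisor M γ ∈ M ∧ divisor M γ ≤ γ := by
      have h2 : γ ∈ upperSet M := h2
      rw [divisor, dif_pos h2]
      exact h2.choose_spec
    refine ⟨⟨h1.1, ?_, ?_⟩, h2⟩
    · simp only [toggleLetter]
      split_ifs
      · exact (Finset.erase_subset _ _).trans h1.2.1
      · exact Finset.insert_subset hd.1 h1.2.1
    · simp only [toggleLetter]
      split_ifs
      · exact (baseDeg_mono (Finset.erase_subset _ _)).trans h1.2.2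
      · rw [baseDeg_of_notMem, mlcm_insert]
        · exact sup_le hd.2 (ambient.mlcm_le h1)
        · intro h0
          rcases Finset.mem_insert.1 h0 with h0 | h0
          · exact hM (h0 ▸ hd.1)
          · exact hM (h1.2.1 h0)
  · intro γ S s _ h _ _ h'
    exact absurd h' h
  · intros; simp
  · intros; rfl

lemma ambient_sdiff_upperSet {M : Finset (Mon σ)} :
    ambient 0 M \ {a : Letter σ | a.1 ∈ upperSet M} =
      {a | a.2 = ∅ ∧ a.1 ≠ 0 ∧ a.1 ∉ upperSet M} := by
  ext ⟨γ, S⟩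
  constructor
  · rintro ⟨h1, h2⟩
    refine ⟨?_, h1.1, h2⟩
    by_contra hne
    obtain ⟨s, hs⟩ := Finset.nonempty_iff_ne_empty.2 hne
    exact h2 ⟨s, h1.2.1 hs, (le_mlcm hs).trans (ambient.mlcm_le h1)⟩
  · rintro ⟨h1, h2, h3⟩
    simp only at h1
    subst h1
    refine ⟨⟨h2, Finset.empty_subset _, ?_⟩, h3⟩
    rw [baseDeg_of_notMem (by simp)]
    exact fun i => Nat.zero_le _

variable (k : Type*) [Field k] [Finite σ]

lemma isSubquot_ambient (ξ : Mon σ) (G : Finset (Mon σ)) (J : Set σ) (α : Mon σ) :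
    IsSubquot (wordDiff k σ) whd (wset (ambient ξ G \ excess J) α) :=
  isSubquot_wset (G := G) (fun _ h => h.2.1) letterClosed_ambient letterIdeal_excess α

lemma hdim_ambient_insert_zero {M : Finset (Mon σ)} (hM : 0 ∉ M) {i : σ} (hi : i ∉ J)
    (α : Mon σ) (n : ℕ) :
    hdim (wordDiff k σ) whd (wset (ambient (Pi.single i 1) (insert 0 M) \ excess J) α) n =
      hdim (wordDiff k σ) whd (wset (ambient 0 M \ excess (insert i J)) α) n := by
  rw [(toggleData_zero hi).hdim_eq (isSubquot_ambient k _ _ _ _), ambient_insert_zero_sdiff hM]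

lemma hdim_ambient_empty {M : Finset (Mon σ)} (hM : 0 ∉ M) (α : Mon σ) (n : ℕ) :
    hdim (wordDiff k σ) whd (wset (ambient 0 M \ excess ∅) α) n =
      hdim (wordDiff k σ) whd (wset {a | a.2 = ∅ ∧ a.1 ≠ 0 ∧ a.1 ∉ upperSet M} α) n := by
  have h := isSubquot_ambient k 0 M ∅ α
  have h0 : ambient 0 M \ excess ∅ = ambient 0 M := by
    simp [excess]
  rw [h0] at h ⊢
  rw [(toggleData_divisor hM).hdim_eq h, ambient_sdiff_upperSet]

end LetterSets

end MonomialRings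

namespace MonomialRings

section BarComparison

variable {k : Type*} [Field k] {σ : Type*} {J : Set (Mon σ)}

lemma mergeAt_cons_succ (a : Mon σ) (l : List (Mon σ)) (j : ℕ) :
    mergeAt (a :: l) (j + 1) = a :: mergeAt l j := by
  simp [mergeAt]

lemma barAux_cons_cons (a b : Mon σ) (l : List (Mon σ)) :
    barAux k J (a :: b :: l) = -((if a + b ∉ J then Finsupp.single ((a + b) :: l) (1 : k) else 0)
      + prep (Finsupp.single a 1) (barAux k J (b :: l))) := by
  have h : (a :: b :: l).length - 1 = ((b :: l).length - 1) + 1 := by simp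
  rw [barAux, h, Finset.sum_range_succ', neg_add_rev]
  congr 1
  · rw [barAux, map_sum, ← Finset.sum_neg_distrib]
    refine Finset.sum_congr rfl fun j _ => ?_
    simp only [List.getD_cons_succ, mergeAt_cons_succ]
    split_ifs
    · simp
    · simp [pow_succ (-1 : k) (j + 1)]
  · simp only [List.getD_cons_succ, List.getD_cons_zero, mergeAt]
    split_ifs <;> simp

/-- The word in letters without exterior part given by a list of monomials. -/
def plainWord : List (Mon σ) → Word σ := List.map fun β => (β, ∅)

lemma plainWord_injective : Function.Injective (plainWord (σ := σ)) :=
  List.map_injective_iff.2 fun _ _ h => (Prod.ext_iff.1 h).1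

variable (J) in
/-- The letters corresponding to the non-trivial monomials outside of `J`. -/
def plainLetters : Set (Letter σ) := {a | a.2 = ∅ ∧ a.1 ≠ 0 ∧ a.1 ∉ J}

lemma lmapDomain_plainWord_prep (a : Mon σ) (e : List (Mon σ) →₀ k) :
    Finsupp.lmapDomain k k plainWord (prep (Finsupp.single a 1) e) =
      prep (Finsupp.single (a, ∅) 1) (Finsupp.lmapDomain k k plainWord e) := by
  induction e using Finsupp.induction_linear with
  | zero => simp
  | add f g hf hg => simp only [map_add, hf, hg]
  | single w r => simp [plainWord]

lemma projOn_prep {L : Set (Letter σ)} {a : Letter σ} (ha : a ∈ L) (e : Word σ →₀ k) :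
    projOn {w | ∀ x ∈ w, x ∈ L} (prep (Finsupp.single a 1) e) =
      prep (Finsupp.single a 1) (projOn {w | ∀ x ∈ w, x ∈ L} e) := by
  ext v
  cases v with
  | nil => simp [projOn_apply, prep_apply_nil]
  | cons c v =>
    simp only [projOn_apply, prep_apply_cons, Set.mem_ofPred_eq, List.mem_cons, forall_eq_or_imp,
      Finsupp.single_apply]
    by_cases hc : a = c
    · subst hc; simp [ha]
    · simp [hc]

lemma projOn_single {W : Type*} (P : Set W) (w : W) (r : k) :
    projOn P (Finsupp.single w r) = if w ∈ P then Finsupp.single w r else 0 := by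
  ext v
  rw [projOn_apply]
  by_cases h : w = v
  · subst h; split_ifs <;> simp
  · split_ifs <;> simp [h]

lemma projOn_barDiffAux_plainWord (l : List (Mon σ)) (hl : ∀ β ∈ l, β ≠ 0 ∧ β ∉ J) :
    projOn {w | ∀ x ∈ w, x ∈ plainLetters J}
        (barDiffAux (letterDiff k) (letterMul k) (letterSign k) (plainWord l)) =
      Finsupp.lmapDomain k k plainWord (barAux k J l) := by
  induction l with
  | nil => simp [plainWord, barDiffAux, barAux]
  | cons a l ih =>
    cases l with
    | nil => simp [plainWord, barDiffAux, barAux, headMulAux, letterDiff]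
    | cons b l =>
      have ha : (a, ∅) ∈ plainLetters J := ⟨rfl, hl a (by simp)⟩
      have h1 : letterDiff k (a, ∅) = 0 := by simp [letterDiff]
      have h2 : letterMul k (a, ∅) (b, ∅) = Finsupp.single (a + b, ∅) 1 := by
        simp [letterMul, shuffleSign]
      have h3 : letterSign k (a, (∅ : Finset (Mon σ))) = -1 := by simp [letterSign]
      have h4 : plainWord (a :: b :: l) = (a, ∅) :: plainWord (b :: l) := rfl
      have h5 : headMulAux (letterMul k) (a, ∅) (plainWord (b :: l)) =
          Finsupp.single ((a + b, ∅) :: plainWord l) 1 := by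
        simp only [plainWord, List.map_cons, headMulAux]
        rw [h2, prep_single, one_mul]
      rw [h4, barDiffAux, h1, h3, h5, map_zero, LinearMap.zero_apply, zero_add, neg_one_smul,
        map_neg, map_add, projOn_prep ha, ih fun β hβ => hl β (by simp [hβ]),
        barAux_cons_cons, map_neg, map_add, lmapDomain_plainWord_prep, projOn_single]
      congr 2
      have hab : a + b ≠ 0 := fun h => (hl a (by simp)).1 (by
        ext i
        have := congrFun h i
        simp only [Pi.add_apply, Pi.zero_apply] at this ⊢
        omega)
      have hrest : ∀ x ∈ plainWord l, x ∈ plainLetters J := by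
        intro x hx
        obtain ⟨β, hβ, rfl⟩ := List.mem_map.1 hx
        exact ⟨rfl, hl β (by simp [hβ])⟩
      by_cases hJ : a + b ∈ J
      · rw [if_neg, if_neg (not_not.2 hJ), map_zero]
        intro h
        exact (h _ (List.mem_cons_self)).2.2 hJ
      · rw [if_pos, if_pos hJ, Finsupp.lmapDomain_apply, Finsupp.mapDomain_single]
        · rfl
        · rintro x hx
          rcases List.mem_cons.1 hx with rfl | hx
          · exact ⟨rfl, hab, hJ⟩
          · exact hrest x hx

lemma wdeg_plainWord (l : List (Mon σ)) : wdeg (plainWord l) = l.sum := by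
  simp [wdeg, plainWord, Function.comp_def]

lemma whd_plainWord (l : List (Mon σ)) : whd (plainWord l) = l.length := by
  simp [whd, plainWord, Function.comp_def]

lemma plainWord_mem_cell {n : ℕ} {α : Mon σ} {l : List (Mon σ)} (hl : l ∈ barBasis J n α) :
    plainWord l ∈ cell whd (wset (plainLetters J) α) n := by
  refine ⟨⟨fun x hx => ?_, (wdeg_plainWord l).trans hl.2.1⟩, (whd_plainWord l).trans hl.1⟩
  obtain ⟨β, hβ, rfl⟩ := List.mem_map.1 hx
  exact ⟨rfl, hl.2.2 β hβ⟩

lemma exists_plainWord {n : ℕ} {α : Mon σ} {w : Word σ}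
    (hw : w ∈ cell whd (wset (plainLetters J) α) n) : ∃ l ∈ barBasis J n α, plainWord l = w := by
  have h : plainWord (w.map Prod.fst) = w := by
    rw [plainWord, List.map_map]
    conv_rhs => rw [← List.map_id w]
    refine List.map_congr_left fun a ha => ?_
    exact Prod.ext rfl (hw.1.1 a ha).1.symm
  refine ⟨w.map Prod.fst, ⟨?_, ?_, ?_⟩, h⟩
  · rw [← whd_plainWord, h, hw.2]
  · rw [← wdeg_plainWord, h, hw.1.2]
  · intro β hβ
    obtain ⟨a, ha, rfl⟩ := List.mem_map.1 hβ
    exact (hw.1.1 a ha).2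

lemma map_barSub (n : ℕ) (α : Mon σ) :
    (barSub k J n α).map (Finsupp.lmapDomain k k plainWord) =
      Finsupp.supported k k (cell whd (wset (plainLetters J) α) n) := by
  rw [barSub, Submodule.map_span, Finsupp.supported_eq_span_single, ← Set.image_comp]
  congr 1
  ext x
  constructor
  · rintro ⟨l, hl, rfl⟩
    exact ⟨plainWord l, plainWord_mem_cell hl, by simp⟩
  · rintro ⟨w, hw, rfl⟩
    obtain ⟨l, hl, rfl⟩ := exists_plainWord hw
    exact ⟨l, hl, by simp⟩

lemma lmapDomain_plainWord_barD {n : ℕ} {α : Mon σ} {e : List (Mon σ) →₀ k}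
    (he : e ∈ barSub k J n α) :
    Finsupp.lmapDomain k k plainWord (barD k J e) =
      subD (wordDiff k σ) (wset (plainLetters J) α) (Finsupp.lmapDomain k k plainWord e) := by
  induction he using Submodule.span_induction with
  | zero => simp
  | add x y _ _ hx hy => simp only [map_add, hx, hy]
  | smul r x _ hx => simp only [map_smul, hx]
  | mem x hx =>
    obtain ⟨l, hl, rfl⟩ := hx
    rw [barD, Finsupp.linearCombination_single, one_smul,
      ← projOn_barDiffAux_plainWord l hl.2.2, Finsupp.lmapDomain_apply, Finsupp.mapDomain_single]
    ext v
    have h1 : wordDiff k σ (Finsupp.single (plainWord l) 1) =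
        barDiffAux (letterDiff k) (letterMul k) (letterSign k) (plainWord l) := by
      rw [wordDiff, barDiff_single, one_smul]
    rw [subD_apply, projOn_apply, ← h1]
    by_cases h0 : wordDiff k σ (Finsupp.single (plainWord l) 1) v = 0
    · simp [h0]
    · have := (Step.of_coeff h0).wdeg
      have hα : wdeg v = α := by rw [this, wdeg_plainWord, hl.2.1]
      have hiff : v ∈ wset (plainLetters J) α ↔ v ∈ {w : Word σ | ∀ x ∈ w, x ∈ plainLetters J} :=
        ⟨fun h => h.1, fun h => ⟨h, hα⟩⟩
      by_cases hv : v ∈ wset (plainLetters J) α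
      · rw [if_pos hv, if_pos (hiff.1 hv)]
      · rw [if_neg hv, if_neg (mt hiff.2 hv)]

lemma torDim_eq_hdim (n : ℕ) (α : Mon σ) :
    torDim k J n α = hdim (wordDiff k σ) whd (wset (plainLetters J) α) n := by
  set φ := Finsupp.lmapDomain k k (plainWord (σ := σ)) with hφ
  have hinj : Function.Injective φ := Finsupp.mapDomain_injective plainWord_injective
  have e1 : (barSub k J n α ⊓ LinearMap.ker (barD k J)).map φ =
      Finsupp.supported k k (cell whd (wset (plainLetters J) α) n) ⊓
        LinearMap.ker (subD (wordDiff k σ) (wset (plainLetters J) α)) := by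
    ext x
    rw [← map_barSub]
    constructor
    · rintro ⟨e, he, rfl⟩
      refine Submodule.mem_inf.2 ⟨⟨e, he.1, rfl⟩, ?_⟩
      rw [LinearMap.mem_ker, ← lmapDomain_plainWord_barD he.1, LinearMap.mem_ker.1 he.2, map_zero]
    · rintro ⟨⟨e, he, rfl⟩, h⟩
      refine ⟨e, Submodule.mem_inf.2 ⟨he, ?_⟩, rfl⟩
      rw [LinearMap.mem_ker]
      apply hinj
      rw [lmapDomain_plainWord_barD he, map_zero]
      exact h
  have e2 : ((barSub k J (n + 1) α).map (barD k J)).map φ =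
      (Finsupp.supported k k (cell whd (wset (plainLetters J) α) (n + 1))).map
        (subD (wordDiff k σ) (wset (plainLetters J) α)) := by
    rw [← map_barSub]
    ext x
    constructor
    · rintro ⟨_, ⟨e, he, rfl⟩, rfl⟩
      exact ⟨_, ⟨e, he, rfl⟩, (lmapDomain_plainWord_barD he).symm⟩
    · rintro ⟨_, ⟨e, he, rfl⟩, rfl⟩
      exact ⟨_, ⟨e, he, rfl⟩, lmapDomain_plainWord_barD he⟩
  rw [torDim, hdim, ← e1, ← e2, ← (Submodule.equivMapOfInjective φ hinj _).finrank_eq,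
    ← (Submodule.equivMapOfInjective φ hinj _).finrank_eq]

lemma torDim_eq_hdim_ambient [Finite σ] {M : Finset (Mon σ)} (hM : 0 ∉ M) (n : ℕ) (α : Mon σ) :
    torDim k (upperSet M) n α =
      hdim (wordDiff k σ) whd (wset (ambient 0 M \ excess ∅) α) n := by
  rw [hdim_ambient_empty k hM, torDim_eq_hdim]
  rfl

end BarComparison

end MonomialRings

namespace MonomialRings

section Adjunction

variable {k : Type*} [Field k] {σ : Type*} (i : σ)

/-- The letter given by the additional exterior generator in direction `i`. -/
def extLetter : Letter σ := (Pi.single i 1, {0})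

/-- The letter given by the variable `i`. -/
def varLetter : Letter σ := (Pi.single i 1, ∅)

/-- The first letter involving the additional generator is `extLetter i`, and it does not stand
at the beginning. -/
def splitUp : Word σ → Prop
  | [] => False
  | b :: w => 0 ∉ b.2 ∧ (w.head? = some (extLetter i) ∨ splitUp w)

/-- The first letter involving the additional generator is different from `extLetter i`. -/
def splitDn : Word σ → Prop
  | [] => False
  | c :: w => if 0 ∈ c.2 then c ≠ extLetter i else splitDn w

/-- Merging the first letter `extLetter i` into its predecessor. -/
def joinWord : Word σ → Word σ
  | [] => []
  | b :: w => if w.head? = some (extLetter i) then (b.1 + Pi.single i 1, insert 0 b.2) :: w.tail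
    else b :: joinWord w

/-- Splitting a letter `extLetter i` off the first letter involving the additional generator. -/
def splitWord : Word σ → Word σ
  | [] => []
  | c :: w => if 0 ∈ c.2 then (c.1 - Pi.single i 1, c.2.erase 0) :: extLetter i :: w
    else c :: splitWord w

/-- The number of letters behind the first one involving the additional generator. -/
def tailLength : Word σ → ℕ
  | [] => 0
  | c :: w => if 0 ∈ c.2 then w.length else tailLength w

variable {i}

lemma zero_mem_extLetter : (0 : Mon σ) ∈ (extLetter i).2 := Finset.mem_singleton_self _

lemma not_splitDn_of_head {w : Word σ} (h : w.head? = some (extLetter i)) : ¬ splitDn i w := by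
  cases w with
  | nil => simp at h
  | cons a w =>
    simp only [List.head?_cons, Option.some.injEq] at h
    subst h
    simp [splitDn, zero_mem_extLetter]

lemma not_splitDn {w : Word σ} (h : splitUp i w) : ¬ splitDn i w := by
  induction w with
  | nil => exact h.elim
  | cons a w ih =>
    simp only [splitUp, splitDn] at h ⊢
    rw [if_neg h.1]
    exact h.2.elim not_splitDn_of_head ih

lemma splitDn.exists {w : Word σ} (h : splitDn i w) : ∃ a ∈ w, 0 ∈ a.2 := by
  induction w with
  | nil => exact h.elim
  | cons a w ih =>
    rw [splitDn] at h
    split_ifs at h with h0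
    · exact ⟨a, by simp, h0⟩
    · obtain ⟨b, hb, h⟩ := ih h
      exact ⟨b, by simp [hb], h⟩

lemma splitUp.exists {w : Word σ} (h : splitUp i w) : ∃ a ∈ w, 0 ∈ a.2 := by
  induction w with
  | nil => exact h.elim
  | cons a w ih =>
    rcases h.2 with h | h
    · exact ⟨_, List.mem_cons_of_mem _ (List.mem_of_mem_head? h), zero_mem_extLetter⟩
    · obtain ⟨b, hb, h⟩ := ih h
      exact ⟨b, by simp [hb], h⟩

lemma splitUp_or_splitDn {w : Word σ} (h : ∃ a ∈ w, 0 ∈ a.2) (hX : w.head? ≠ some (extLetter i)) :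
    splitUp i w ∨ splitDn i w := by
  induction w with
  | nil => simp at h
  | cons a w ih =>
    simp only [splitUp, splitDn]
    by_cases h0 : 0 ∈ a.2
    · right
      simpa [h0] using hX
    · have h1 : ∃ a ∈ w, 0 ∈ a.2 := by simpa [h0] using h
      by_cases h2 : w.head? = some (extLetter i)
      · exact Or.inl ⟨h0, Or.inl h2⟩
      · rw [if_neg h0]
        exact (ih h1 h2).imp (fun h => ⟨h0, Or.inr h⟩) id

lemma tailLength_lt {w : Word σ} (h : splitDn i w) : tailLength w < w.length := by
  induction w with
  | nil => exact h.elim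
  | cons a w ih =>
    rw [splitDn] at h
    rw [tailLength, List.length_cons]
    split_ifs at h ⊢
    · omega
    · exact (ih h).trans (Nat.lt_succ_self _)

lemma tailLength_lt_joinWord {u d : Word σ} (h : Step u d) (hup : splitUp i u)
    (hdn : splitDn i d) : d = joinWord i u ∨ tailLength d < tailLength (joinWord i u) := by
  induction h with
  | int γ S w s hs =>
    have h0 : 0 ∉ S.erase s := fun h => hup.1 (Finset.mem_of_mem_erase h)
    rw [splitDn, if_neg h0] at hdn
    exact absurd hdn (hup.2.elim not_splitDn_of_head not_splitDn)
  | mrg a b w h =>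
    by_cases hb : b = extLetter i
    · subst hb
      left
      simp [joinWord, extLetter]
    · rcases hup.2 with h1 | h1
      · simp [hb] at h1
      · have h0 : 0 ∉ a.2 ∪ b.2 := by
          simp [hup.1, h1.1]
        rw [splitDn, if_neg h0] at hdn
        exact absurd hdn (h1.2.elim not_splitDn_of_head not_splitDn)
  | cons a h ih =>
    rename_i v w
    rw [splitDn, if_neg hup.1] at hdn
    by_cases hv : v.head? = some (extLetter i)
    · right
      rw [joinWord, if_pos hv, tailLength, if_neg hup.1, tailLength,
        if_pos (Finset.mem_insert_self _ _)]
      cases h with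
      | int γ S q s hs =>
        simp only [List.head?_cons, Option.some.injEq, extLetter, Prod.mk.injEq] at hv
        obtain ⟨-, rfl⟩ := hv
        rw [Finset.mem_singleton] at hs
        subst hs
        rw [splitDn, if_neg (by simp)] at hdn
        rw [tailLength, if_neg (by simp)]
        exact tailLength_lt hdn
      | mrg b c q h =>
        simp only [List.head?_cons, Option.some.injEq] at hv
        subst hv
        rw [tailLength, if_pos (Finset.mem_union_left _ zero_mem_extLetter)]
        simp
      | cons b h =>
        simp only [List.head?_cons, Option.some.injEq] at hv
        subst hv
        simp [splitDn, zero_mem_extLetter] at hdn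
    · rw [joinWord, if_neg hv, tailLength, if_neg hup.1, tailLength, if_neg hup.1]
      exact (ih (hup.2.resolve_left hv) hdn).imp (fun h => by rw [h]) id

variable {M : Finset (Mon σ)} {J : Set σ}

lemma mem_excess_congr {a b : Letter σ} (h : mlcm a.2 = mlcm b.2) (hi : i ∉ J)
    (hne : ∀ j, j ≠ i → a.1 j = b.1 j) : a ∈ excess J ↔ b ∈ excess J := by
  simp only [excess, Set.mem_ofPred_eq, h]
  refine exists_congr fun j => and_congr_right fun hj => ?_
  rw [hne j fun h => hi (h ▸ hj)]

lemma extLetter_mem (hi : i ∉ J) :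
    extLetter i ∈ ambient (Pi.single i 1) (insert 0 M) \ excess J := by
  have h0 : mlcm ({0} : Finset (Mon σ)) = 0 := by simp [mlcm]
  refine ⟨⟨fun h => ?_, by simp [extLetter], ?_⟩, ?_⟩
  · have := congrFun h i
    simp [extLetter] at this
  · simp [extLetter, baseDeg, h0]
  · rintro ⟨j, hj, h⟩
    have hji : j ≠ i := fun h => hi (h ▸ hj)
    simp [extLetter, h0, hji] at h

lemma join_mem (hi : i ∉ J) {b : Letter σ} (hb0 : 0 ∉ b.2)
    (hb : b ∈ ambient (Pi.single i 1) (insert 0 M) \ excess J) :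
    (b.1 + Pi.single i 1, insert 0 b.2) ∈ ambient (Pi.single i 1) (insert 0 M) \ excess J := by
  have h := letterClosed_ambient.mul b hb.1 _ (extLetter_mem (J := J) hi).1 (by simpa [extLetter])
  have h2 : b.2 ∪ (extLetter i).2 = insert 0 b.2 := by simp [extLetter]
  rw [h2] at h
  refine ⟨h, ?_⟩
  rw [mem_excess_congr (b := b) (i := i) (mlcm_insert_zero _) hi]
  · exact hb.2
  · intro j hj
    simp [hj]

lemma single_le_of_mem {c : Letter σ} (hc0 : 0 ∈ c.2)
    (hc : c ∈ ambient (Pi.single i 1) (insert 0 M)) : mlcm c.2 + Pi.single i 1 ≤ c.1 := by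
  have := hc.2.2
  rwa [baseDeg, if_pos hc0] at this

lemma eq_extLetter {c : Letter σ} (hc0 : 0 ∈ c.2)
    (hc : c ∈ ambient (Pi.single i 1) (insert 0 M)) (h : c.1 = Pi.single i 1) :
    c = extLetter i := by
  have h1 := single_le_of_mem hc0 hc
  have h2 : mlcm c.2 = 0 := by
    ext j
    have := Mon.le_apply h1 j
    rw [h, Pi.add_apply] at this
    simp only [Pi.zero_apply]
    omega
  refine Prod.ext h (Finset.eq_singleton_iff_unique_mem.2 ⟨hc0, fun s hs => ?_⟩)
  ext j
  have := Mon.le_apply (le_mlcm hs) j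
  rw [h2] at this
  simpa using this

lemma split_mem (hi : i ∉ J) {c : Letter σ} (hc0 : 0 ∈ c.2) (hcX : c ≠ extLetter i)
    (hc : c ∈ ambient (Pi.single i 1) (insert 0 M) \ excess J) :
    (c.1 - Pi.single i 1, c.2.erase 0) ∈ ambient (Pi.single i 1) (insert 0 M) \ excess J := by
  have h1 := single_le_of_mem hc0 hc.1
  refine ⟨⟨fun h => hcX (eq_extLetter hc0 hc.1 ?_),
    (Finset.erase_subset _ _).trans hc.1.2.1, ?_⟩, ?_⟩
  · ext j
    have h2 := Mon.le_apply h1 j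
    have h3 := congrFun h j
    simp only [Pi.sub_apply, Pi.zero_apply, Pi.add_apply] at h2 h3
    omega
  · rw [baseDeg_of_notMem (by simp), mlcm_erase_zero]
    exact le_tsub_of_add_le_right h1
  · rw [mem_excess_congr (b := c) (i := i) (mlcm_erase_zero _) hi]
    · exact hc.2
    · intro j hj
      simp [hj]

lemma joinWord_spec (hi : i ∉ J) {w : Word σ}
    (hw : ∀ a ∈ w, a ∈ ambient (Pi.single i 1) (insert 0 M) \ excess J) (h : splitUp i w) :
    (∀ a ∈ joinWord i w, a ∈ ambient (Pi.single i 1) (insert 0 M) \ excess J) ∧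
    splitDn i (joinWord i w) ∧ splitWord i (joinWord i w) = w ∧ Step w (joinWord i w) := by
  induction w with
  | nil => exact h.elim
  | cons b w ih =>
    simp only [List.mem_cons, forall_eq_or_imp] at hw
    rw [joinWord]
    split_ifs with hX
    · cases w with
      | nil => simp at hX
      | cons c w =>
        simp only [List.head?_cons, Option.some.injEq] at hX
        subst hX
        simp only [List.mem_cons, forall_eq_or_imp, List.tail_cons] at hw ⊢
        refine ⟨⟨join_mem hi h.1 hw.1, hw.2.2⟩, ?_, ?_, ?_⟩
        · rw [splitDn, if_pos (Finset.mem_insert_self _ _)]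
          intro hX
          refine hw.1.1.1 ?_
          simpa [extLetter] using congrArg Prod.fst hX
        · simp [splitWord, h.1]
        · have := Step.mrg b (extLetter i) w (by simpa [extLetter] using h.1)
          simpa [extLetter] using this
    · obtain ⟨h1, h2, h3, h4⟩ := ih hw.2 (h.2.resolve_left hX)
      simp only [List.mem_cons, forall_eq_or_imp, splitDn, splitWord, if_neg h.1, h3]
      exact ⟨⟨hw.1, h1⟩, h2, trivial, h4.cons b⟩

lemma splitWord_spec (hi : i ∉ J) {w : Word σ}
    (hw : ∀ a ∈ w, a ∈ ambient (Pi.single i 1) (insert 0 M) \ excess J) (h : splitDn i w) :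
    (∀ a ∈ splitWord i w, a ∈ ambient (Pi.single i 1) (insert 0 M) \ excess J) ∧
    splitUp i (splitWord i w) ∧ joinWord i (splitWord i w) = w := by
  induction w with
  | nil => exact h.elim
  | cons c w ih =>
    simp only [List.mem_cons, forall_eq_or_imp] at hw
    rw [splitWord]
    rw [splitDn] at h
    split_ifs at h ⊢ with h0
    · simp only [List.mem_cons, forall_eq_or_imp, splitUp, joinWord]
      refine ⟨⟨split_mem hi h0 h hw.1, extLetter_mem hi, hw.2⟩, ⟨by simp, by simp⟩, ?_⟩
      have h1 : Pi.single i 1 ≤ c.1 :=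
        le_trans (le_add_of_nonneg_left fun j => Nat.zero_le _) (single_le_of_mem h0 hw.1.1)
      simp [tsub_add_cancel_of_le h1, Finset.insert_erase h0]
    · obtain ⟨h1, h2, h3⟩ := ih hw.2 h
      simp only [List.mem_cons, forall_eq_or_imp, splitUp, joinWord]
      have h4 : (splitWord i w).head? ≠ some (extLetter i) := by
        cases hs : splitWord i w with
        | nil => simp
        | cons d q =>
          rw [hs] at h2
          intro hd
          simp only [List.head?_cons, Option.some.injEq] at hd
          exact h2.1 (hd ▸ zero_mem_extLetter)
      rw [if_neg h4, h3]
      exact ⟨⟨hw.1, h1⟩, ⟨h0, Or.inr h2⟩, rfl⟩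

end Adjunction

end MonomialRings

namespace MonomialRings

section HeadFree

variable (k : Type*) [Field k] {σ : Type*} {i : σ} {M : Finset (Mon σ)} {J : Set σ}

/-- The words that do not start with `extLetter i`. -/
def headFree (i : σ) (P : Set (Word σ)) : Set (Word σ) :=
  {w | w ∈ P ∧ w.head? ≠ some (extLetter i)}

lemma ne_zero_add_ne_single {a b : Mon σ} (ha : a ≠ 0) (hb : b ≠ 0) : a + b ≠ Pi.single i 1 := by
  intro h
  have h1 : ∀ j, j ≠ i → a j = 0 ∧ b j = 0 := by
    intro j hj
    have := congrFun h j
    simpa [hj] using this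
  have h2 := congrFun h i
  simp only [Pi.add_apply, Pi.single_eq_same] at h2
  rcases (by omega : a i = 0 ∨ b i = 0) with h3 | h3
  · refine ha (funext fun j => ?_)
    by_cases hj : j = i
    · rw [hj]; exact h3
    · exact (h1 j hj).1
  · refine hb (funext fun j => ?_)
    by_cases hj : j = i
    · rw [hj]; exact h3
    · exact (h1 j hj).2

lemma head_of_step {u v : Word σ} (h : Step u v)
    (hu : ∀ a ∈ u, a ∈ ambient (Pi.single i 1) (insert 0 M))
    (hv : v.head? = some (extLetter i)) : u.head? = some (extLetter i) := by
  cases h with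
  | int γ S w s hs =>
    exfalso
    simp only [List.mem_cons, forall_eq_or_imp] at hu
    simp only [List.head?_cons, Option.some.injEq, extLetter, Prod.mk.injEq] at hv
    have h0 : 0 ∈ S.erase s := by rw [hv.2]; simp
    have h1 := eq_extLetter (Finset.mem_of_mem_erase h0) hu.1 hv.1
    have h2 : S = {0} := congrArg Prod.snd h1
    rw [h2, Finset.mem_singleton] at hs
    subst hs
    simp at h0
  | mrg a b w h =>
    exfalso
    simp only [List.mem_cons, forall_eq_or_imp] at hu
    simp only [List.head?_cons, Option.some.injEq, extLetter, Prod.mk.injEq] at hv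
    exact ne_zero_add_ne_single hu.1.1 hu.2.1.1 hv.1
  | cons a h => exact hv

lemma headFree_closed {α : Mon σ} :
    ∀ u ∈ headFree i (wset (ambient (Pi.single i 1) (insert 0 M) \ excess J) α),
      ∀ v ∈ wset (ambient (Pi.single i 1) (insert 0 M) \ excess J) α,
      wordDiff k σ (Finsupp.single u 1) v ≠ 0 →
      v ∈ headFree i (wset (ambient (Pi.single i 1) (insert 0 M) \ excess J) α) :=
  fun _ hu _ hv huv => ⟨hv, fun h =>
    hu.2 (head_of_step (Step.of_coeff huv) (fun a ha => (hu.1.1 a ha).1) h)⟩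

lemma mem_wset_ambient_iff {α : Mon σ} (hM : 0 ∉ M) {w : Word σ} :
    w ∈ wset (ambient 0 M \ excess J) α ↔
      w ∈ headFree i (wset (ambient (Pi.single i 1) (insert 0 M) \ excess J) α) ∧
        ∀ a ∈ w, 0 ∉ a.2 := by
  constructor
  · intro h
    have h0 : ∀ a ∈ w, 0 ∉ a.2 := fun a ha h0 => hM ((h.1 a ha).1.2.1 h0)
    refine ⟨⟨⟨fun a ha => ⟨⟨(h.1 a ha).1.1, ?_, ?_⟩, (h.1 a ha).2⟩, h.2⟩, fun hX => ?_⟩, h0⟩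
    · exact (h.1 a ha).1.2.1.trans (Finset.subset_insert _ _)
    · have := (h.1 a ha).1.2.2
      rwa [baseDeg_of_notMem (h0 a ha)] at this ⊢
    · exact h0 _ (List.mem_of_mem_head? hX) zero_mem_extLetter
  · rintro ⟨h, h0⟩
    refine ⟨fun a ha => ⟨⟨(h.1.1 a ha).1.1, ?_, ?_⟩, (h.1.1 a ha).2⟩, h.1.2⟩
    · exact (Finset.subset_insert_iff_of_notMem (h0 a ha)).1 (h.1.1 a ha).1.2.1
    · have := (h.1.1 a ha).1.2.2
      rwa [baseDeg_of_notMem (h0 a ha)] at this ⊢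

lemma Step.zero_notMem {u v : Word σ} (h : Step u v) (hu : ∀ a ∈ u, 0 ∉ a.2) :
    ∀ a ∈ v, 0 ∉ a.2 :=
  h.closed (A := {a | 0 ∉ a.2}) ⟨fun _ _ _ h _ h0 => h (Finset.mem_of_mem_erase h0),
    fun _ ha _ hb _ h0 => (Finset.mem_union.1 h0).elim ha hb⟩ hu

lemma hdim_ambient_eq_headFree [Finite σ] (hM : 0 ∉ M) (hi : i ∉ J) (α : Mon σ) (n : ℕ) :
    hdim (wordDiff k σ) whd (wset (ambient 0 M \ excess J) α) n = hdim (wordDiff k σ) whd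
      (headFree i (wset (ambient (Pi.single i 1) (insert 0 M) \ excess J) α)) n := by
  set W := wset (ambient (Pi.single i 1) (insert 0 M) \ excess J) α with hW
  have hU : IsSubquot (wordDiff k σ) whd (headFree i W) :=
    (isSubquot_ambient k _ _ _ α).of_closed (fun _ h => h.1) (headFree_closed k)
  have hmem : ∀ w, w ∈ wset (ambient 0 M \ excess J) α ↔ w ∈ headFree i W ∧ ∀ a ∈ w, 0 ∉ a.2 :=
    fun w => mem_wset_ambient_iff hM
  have key : ∀ m, ∀ z ∈ Finsupp.supported k k (cell whd (headFree i W) m),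
      (∀ d ∈ headFree i W, splitDn i d → subD (wordDiff k σ) (headFree i W) z d = 0) →
      ∃ y ∈ Finsupp.supported k k (cell whd (headFree i W) (m + 1)),
        z - subD (wordDiff k σ) (headFree i W) y ∈
          Finsupp.supported k k (wset (ambient 0 M \ excess J) α) := by
    intro m z hz hDz
    obtain ⟨y, hy, h⟩ := exists_sub_boundary isDiff_wordDiff hU (splitUp i) (splitDn i)
      (joinWord i) (splitWord i) tailLength
      (fun u hu hup => by
        obtain ⟨i1, i2, i3, i4⟩ := joinWord_spec hi hu.1.1 hup
        refine ⟨⟨⟨i1, i4.wdeg.trans hu.1.2⟩, fun h => not_splitDn_of_head h i2⟩, i2, i3,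
          i4.wordCoeff_ne_zero fun a ha => (hu.1.1 a ha).1.1⟩)
      (fun u hu hup d hd hdn hne => tailLength_lt_joinWord (Step.of_coeff hne) hup hdn)
      (fun d hd hdn => by
        obtain ⟨i1, i2, i3⟩ := splitWord_spec hi hd.1.1 hdn
        obtain ⟨-, -, -, i4⟩ := joinWord_spec hi i1 i2
        refine ⟨⟨⟨i1, ?_⟩, fun h => ?_⟩, i2, i3⟩
        · rw [← i4.wdeg, i3, hd.1.2]
        · cases hs : splitWord i d with
          | nil => rw [hs] at i2; exact i2
          | cons b q =>
            rw [hs] at i2 h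
            simp only [List.head?_cons, Option.some.injEq] at h
            exact i2.1 (h ▸ zero_mem_extLetter))
      (fun c hc h1 h2 d hd hdn => by
        by_contra hne
        by_cases h0 : ∃ a ∈ c, 0 ∈ a.2
        · exact (splitUp_or_splitDn h0 hc.1.2).elim h1 h2
        · push Not at h0
          obtain ⟨a, ha, ha0⟩ := hdn.exists
          exact (Step.of_coeff hne).zero_notMem h0 a ha ha0)
      hz hDz
    refine ⟨y, hy, (Finsupp.mem_supported' k _).2 fun w hw => ?_⟩
    by_cases hwU : w ∈ headFree i W
    · refine h w ?_
      by_contra h0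
      refine hw ((hmem w).2 ⟨hwU, fun a ha ha0 => ?_⟩)
      exact h0 (splitUp_or_splitDn ⟨a, ha, ha0⟩ hwU.2)
    · exact (Finsupp.mem_supported' k _).1 (Submodule.sub_mem _ (supported_cell_le _ hz)
        (supported_cell_le _ (subD_mem isDiff_wordDiff hy))) w hwU
  refine hdim_eq_of_exact_quot isDiff_wordDiff hU (fun w hw => ((hmem w).1 hw).1) ?_ n ?_ ?_
  · intro u hu v hv huv
    exact (hmem v).2 ⟨hv, (Step.of_coeff huv).zero_notMem ((hmem u).1 hu).2⟩
  · intro z hz hDz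
    exact key n z hz fun d _ _ => by rw [hDz]; rfl
  · intro z hz hDz
    obtain ⟨y, hy, h⟩ := key (n + 1) z hz fun d _ hdn => by
      refine (Finsupp.mem_supported' k _).1 hDz d fun hd => ?_
      obtain ⟨a, ha, ha0⟩ := hdn.exists
      exact ((hmem d).1 hd).2 a ha ha0
    refine ⟨_, h, Submodule.sub_mem _ hz (subD_mem isDiff_wordDiff hy), ?_⟩
    rw [map_sub, hU.sq isDiff_wordDiff (supported_cell_le _ hy), sub_zero]

end HeadFree

end MonomialRings

namespace MonomialRings

section Behead

variable {k : Type*} [Field k] {σ : Type*} {i : σ} {M : Finset (Mon σ)} {J : Set σ}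

/-- Removing a given first letter. -/
def behead (c : Letter σ) : (Word σ →₀ k) →ₗ[k] (Word σ →₀ k) :=
  Finsupp.lcomapDomain (List.cons c) List.cons_injective

lemma behead_apply (c : Letter σ) (e : Word σ →₀ k) (v : Word σ) : behead c e v = e (c :: v) := rfl

lemma behead_single_nil (c : Letter σ) (r : k) : behead c (Finsupp.single ([] : Word σ) r) = 0 := by
  ext v
  simp [behead_apply]

lemma behead_single_cons (c a : Letter σ) (u : Word σ) (r : k) :
    behead c (Finsupp.single (a :: u) r) = if a = c then Finsupp.single u r else 0 := by
  ext v
  by_cases h : a = c <;> simp [behead_apply, Finsupp.single_apply, h]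

lemma letterDiff_ne_zero {a c : Letter σ} (h : letterDiff k a c ≠ 0) :
    ∃ s ∈ a.2, c = (a.1, a.2.erase s) := by
  rw [letterDiff_apply] at h
  split_ifs at h with h1
  · obtain ⟨s, hs, h2⟩ := Finset.exists_ne_zero_of_sum_ne_zero h
    split_ifs at h2 with h3
    · exact ⟨s, hs, Prod.ext h1 h3.symm⟩
    · exact absurd rfl h2
  · exact absurd rfl h

lemma letterMul_ne_zero {a b c : Letter σ} (h : letterMul k a b c ≠ 0) :
    c = (a.1 + b.1, a.2 ∪ b.2) := by
  rw [letterMul] at h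
  split_ifs at h with h1
  · by_contra hne
    exact h (Finsupp.single_eq_of_ne hne)
  · exact absurd rfl h

lemma letterMul_single_eq_zero {a b : Letter σ} {S : Finset (Mon σ)} (ha : a.1 ≠ 0)
    (hb : b.1 ≠ 0) : letterMul k a b (Pi.single i 1, S) = 0 := by
  by_contra h
  exact ne_zero_add_ne_single (i := i) ha hb (congrArg Prod.fst (letterMul_ne_zero h)).symm

lemma letterDiff_extLetter_eq_zero {a : Letter σ}
    (ha : a ∈ ambient (Pi.single i 1) (insert 0 M)) : letterDiff k a (extLetter i) = 0 := by
  by_contra h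
  obtain ⟨s, hs, h1⟩ := letterDiff_ne_zero h
  have h0 : 0 ∈ a.2.erase s := (congrArg Prod.snd h1).subset zero_mem_extLetter
  have h2 := eq_extLetter (Finset.mem_of_mem_erase h0) ha (congrArg Prod.fst h1).symm
  subst h2
  rw [extLetter, Finset.mem_singleton] at hs
  subst hs
  simp at h0

lemma letterDiff_varLetter (hM : ∀ m ∈ M, ¬ m ≤ Pi.single i 1) {a : Letter σ}
    (ha : a ∈ ambient (Pi.single i 1) (insert 0 M)) :
    letterDiff k a (varLetter i) = if a = extLetter i then 1 else 0 := by
  split_ifs with h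
  · subst h
    simp [letterDiff, extLetter, varLetter, contrSign]
  · by_contra hne
    obtain ⟨s, hs, h1⟩ := letterDiff_ne_zero hne
    have h2 : a.1 = Pi.single i 1 := (congrArg Prod.fst h1).symm
    rcases Finset.mem_insert.1 (ha.2.1 hs) with rfl | hsM
    · exact h (eq_extLetter hs ha h2)
    · exact hM s hsM (h2 ▸ (le_mlcm hs).trans (ambient.mlcm_le ha))

lemma wordCoeff_extLetter {a : Letter σ} {u : Word σ}
    (h : ∀ b ∈ a :: u, b ∈ ambient (Pi.single i 1) (insert 0 M)) (v : Word σ) :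
    wordCoeff k (a :: u) (extLetter i :: v) = if a = extLetter i then wordCoeff k u v else 0 := by
  cases u with
  | nil =>
    rw [wordCoeff_singleton, letterDiff_extLetter_eq_zero (h a (by simp)), wordCoeff_nil]
    simp
  | cons b u =>
    rw [wordCoeff_cons_cons, letterDiff_extLetter_eq_zero (h a (by simp)), extLetter,
      letterMul_single_eq_zero (h a (by simp)).1 (h b (by simp)).1, ite_self, ite_self, zero_add,
      zero_add]
    by_cases ha : a = (Pi.single i 1, {0})
    · subst ha
      simp [letterSign]
    · simp [ha, Ne.symm ha]

lemma wordCoeff_varLetter (hM : ∀ m ∈ M, ¬ m ≤ Pi.single i 1) {a : Letter σ} {u : Word σ}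
    (h : ∀ b ∈ a :: u, b ∈ ambient (Pi.single i 1) (insert 0 M)) (v : Word σ) :
    wordCoeff k (a :: u) (varLetter i :: v) =
      (if a = extLetter i ∧ u = v then 1 else 0) -
        if a = varLetter i then wordCoeff k u v else 0 := by
  cases u with
  | nil =>
    rw [wordCoeff_singleton, letterDiff_varLetter hM (h a (by simp)), wordCoeff_nil]
    by_cases h1 : v = [] <;> by_cases h2 : a = extLetter i <;> simp [h1, h2, eq_comm]
  | cons b u =>
    rw [wordCoeff_cons_cons, letterDiff_varLetter hM (h a (by simp)), varLetter,
      letterMul_single_eq_zero (h a (by simp)).1 (h b (by simp)).1, ite_self, zero_add,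
      sub_eq_add_neg]
    congr 1
    · by_cases h1 : v = b :: u <;> by_cases h2 : a = extLetter i <;> simp [h1, h2, eq_comm]
    · by_cases ha : a = (Pi.single i 1, ∅)
      · subst ha
        simp [letterSign]
      · simp [ha, Ne.symm ha]

lemma varLetter_mem (hi : i ∉ J) :
    varLetter i ∈ ambient (Pi.single i 1) (insert 0 M) \ excess J := by
  refine ⟨⟨fun h => ?_, by simp [varLetter], ?_⟩, ?_⟩
  · have := congrFun h i
    simp [varLetter] at this
  · rw [baseDeg_of_notMem (by simp [varLetter])]
    exact fun j => Nat.zero_le _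
  · rintro ⟨j, hj, h⟩
    have hji : j ≠ i := fun h => hi (h ▸ hj)
    simp [varLetter, mlcm_empty, hji] at h

lemma cons_mem_wset {L : Set (Letter σ)} {c : Letter σ} {α : Mon σ} {v : Word σ}
    (hc : c ∈ L) : c :: v ∈ wset L (c.1 + α) ↔ v ∈ wset L α := by
  simp only [wset, Set.mem_ofPred_eq, List.mem_cons, forall_eq_or_imp, wdeg_cons, hc, true_and,
    add_right_inj]

variable {α : Mon σ}

lemma behead_subD (hi : i ∉ J) {e : Word σ →₀ k}
    (he : e ∈ Finsupp.supported k k (wset (ambient (Pi.single i 1) (insert 0 M) \ excess J) (Pi.single i 1 + α))) :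
    behead (extLetter i) (subD (wordDiff k σ) (wset (ambient (Pi.single i 1) (insert 0 M) \ excess J) (Pi.single i 1 + α)) e) =
      subD (wordDiff k σ) (wset (ambient (Pi.single i 1) (insert 0 M) \ excess J) α) (behead (extLetter i) e) := by
  rw [Finsupp.supported_eq_span_single] at he
  induction he using Submodule.span_induction with
  | zero => simp
  | add x y _ _ hx hy => simp only [map_add, hx, hy]
  | smul r x _ hx => simp only [map_smul, hx]
  | mem x hx =>
    obtain ⟨u, hu, rfl⟩ := hx
    ext v
    have hv := cons_mem_wset (v := v) (α := α) (extLetter_mem (M := M) hi)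
    rw [behead_apply, subD_apply, subD_apply]
    refine ite_congr (propext hv) (fun _ => ?_) (fun _ => rfl)
    change wordCoeff k u _ = _
    cases u with
    | nil => rw [wordCoeff_nil, behead_single_nil, map_zero, Finsupp.zero_apply]
    | cons a u =>
      rw [wordCoeff_extLetter (fun b hb => (hu.1 b hb).1), behead_single_cons]
      split_ifs
      · rfl
      · simp

lemma behead_varLetter_subD (hM : ∀ m ∈ M, ¬ m ≤ Pi.single i 1) (hi : i ∉ J) {e : Word σ →₀ k}
    (he : e ∈ Finsupp.supported k k (wset (ambient (Pi.single i 1) (insert 0 M) \ excess J) (Pi.single i 1 + α))) :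
    behead (varLetter i) (subD (wordDiff k σ) (wset (ambient (Pi.single i 1) (insert 0 M) \ excess J) (Pi.single i 1 + α)) e) =
      behead (extLetter i) e - subD (wordDiff k σ) (wset (ambient (Pi.single i 1) (insert 0 M) \ excess J) α) (behead (varLetter i) e) := by
  rw [Finsupp.supported_eq_span_single] at he
  induction he using Submodule.span_induction with
  | zero => simp
  | add x y _ _ hx hy => simp only [map_add, hx, hy]; abel
  | smul r x _ hx => simp only [map_smul, hx, smul_sub]
  | mem x hx =>
    obtain ⟨u, hu, rfl⟩ := hx
    ext v
    have hv := cons_mem_wset (v := v) (α := α) (varLetter_mem (M := M) hi)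
    have hv' : varLetter i :: v ∈ wset (ambient (Pi.single i 1) (insert 0 M) \ excess J) (Pi.single i 1 + α) ↔ v ∈ wset (ambient (Pi.single i 1) (insert 0 M) \ excess J) α := hv
    rw [behead_apply, subD_apply, Finsupp.sub_apply, subD_apply, behead_apply]
    have hc : wordDiff k σ (Finsupp.single u 1) (varLetter i :: v) =
      wordCoeff k u (varLetter i :: v) := rfl
    rw [hc]
    cases u with
    | nil => simp [wordCoeff_nil, behead_single_nil]
    | cons a u =>
      rw [wordCoeff_varLetter hM (fun b hb => (hu.1 b hb).1), behead_single_cons]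
      by_cases hvW : v ∈ wset (ambient (Pi.single i 1) (insert 0 M) \ excess J) α
      · rw [if_pos (hv'.2 hvW), if_pos hvW]
        congr 1
        · simp [Finsupp.single_apply]
        · split_ifs
          · rfl
          · simp
      · rw [if_neg (mt hv'.1 hvW), if_neg hvW, sub_zero, Finsupp.single_eq_of_ne]
        rintro h
        obtain ⟨rfl, rfl⟩ := List.cons.inj h
        exact hvW ((cons_mem_wset (extLetter_mem hi)).1 hu)

end Behead

end MonomialRings

namespace MonomialRings

section HeadFreeCount

variable {k : Type*} [Field k] {σ : Type*} {i : σ} {M : Finset (Mon σ)} {J : Set σ} {α : Mon σ}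

lemma supported_cell_headFree (W : Set (Word σ)) (n : ℕ) :
    Finsupp.supported k k (cell whd (headFree i W) n) =
      Finsupp.supported k k (cell whd W n) ⊓ LinearMap.ker (behead (k := k) (extLetter i)) := by
  ext e
  constructor
  · intro he
    have hsub : cell whd (headFree i W) n ⊆ cell whd W n := fun w h => ⟨h.1.1, h.2⟩
    refine Submodule.mem_inf.2 ⟨Finsupp.supported_mono hsub he, ?_⟩
    rw [LinearMap.mem_ker]
    ext v
    rw [behead_apply]
    exact (Finsupp.mem_supported' k e).1 he _ fun (h : _ ∈ cell whd (headFree i W) n) => h.1.2 rfl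
  · intro he
    obtain ⟨h1, h2⟩ := Submodule.mem_inf.1 he
    refine (Finsupp.mem_supported' k e).2 fun w hw => ?_
    by_cases hwW : w ∈ cell whd W n
    · have h3 : w.head? = some (extLetter i) := by_contra fun h => hw ⟨⟨hwW.1, h⟩, hwW.2⟩
      obtain ⟨v, rfl⟩ := List.head?_eq_some_iff.1 h3
      exact DFunLike.congr_fun (LinearMap.mem_ker.1 h2) v
    · exact (Finsupp.mem_supported' k e).1 h1 w hwW

lemma subD_headFree {W : Set (Word σ)}
    (hcl : ∀ u ∈ headFree i W, ∀ v ∈ W, wordDiff k σ (Finsupp.single u 1) v ≠ 0 →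
      v ∈ headFree i W) {e : Word σ →₀ k} (he : e ∈ Finsupp.supported k k (headFree i W)) :
    subD (wordDiff k σ) (headFree i W) e = subD (wordDiff k σ) W e := by
  ext v
  rw [subD_apply, subD_apply]
  by_cases hv : v ∈ headFree i W
  · rw [if_pos hv, if_pos hv.1]
  · rw [if_neg hv]
    split_ifs with hvP
    · by_contra hne
      obtain ⟨u, hu, huv⟩ := diff_apply_ne_zero (Ne.symm hne)
      exact hv (hcl u (by_contra fun h => hu ((Finsupp.mem_supported' k e).1 he u h)) v hvP huv)
    · rfl

/-- Adding a given first letter. -/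
lemma exists_behead_eq (hi : i ∉ J) {n : ℕ} {e : Word σ →₀ k}
    (he : e ∈ Finsupp.supported k k
      (cell whd (wset (ambient (Pi.single i 1) (insert 0 M) \ excess J) α) n)) :
    ∃ y ∈ Finsupp.supported k k (cell whd
      (wset (ambient (Pi.single i 1) (insert 0 M) \ excess J) (Pi.single i 1 + α)) (n + 1 + 1)),
      behead (extLetter i) y = e := by
  refine ⟨Finsupp.mapDomain (List.cons (extLetter i)) e, ?_, ?_⟩
  · intro w hw
    obtain ⟨v, hv, rfl⟩ := Finset.mem_image.1 (Finsupp.mapDomain_support hw)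
    refine ⟨(cons_mem_wset (extLetter_mem hi)).2 (he hv).1, ?_⟩
    rw [whd_cons, (he hv).2, extLetter, Finset.card_singleton]
    ring
  · ext v
    rw [behead_apply, Finsupp.mapDomain_apply List.cons_injective]

lemma behead_mem {c : Letter σ}
    (hc : c ∈ ambient (Pi.single i 1) (insert 0 M) \ excess J) (hci : c.1 = Pi.single i 1)
    {n : ℕ} {e : Word σ →₀ k} (he : e ∈ Finsupp.supported k k (cell whd
      (wset (ambient (Pi.single i 1) (insert 0 M) \ excess J) (Pi.single i 1 + α))
      (c.2.card + 1 + n))) :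
    behead c e ∈ Finsupp.supported k k
      (cell whd (wset (ambient (Pi.single i 1) (insert 0 M) \ excess J) α) n) := by
  refine (Finsupp.mem_supported' k _).2 fun v hv => ?_
  rw [behead_apply]
  refine (Finsupp.mem_supported' k _).1 he _ fun h => hv ⟨?_, ?_⟩
  · exact (cons_mem_wset hc).1 (hci.symm ▸ h.1)
  · have := h.2
    rw [whd_cons] at this
    omega

lemma hdim_headFree_succ [Finite σ] (hM : ∀ m ∈ M, ¬ m ≤ Pi.single i 1) (hi : i ∉ J) (n : ℕ) :
    hdim (wordDiff k σ) whd (headFree i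
        (wset (ambient (Pi.single i 1) (insert 0 M) \ excess J) (Pi.single i 1 + α))) (n + 1) =
      hdim (wordDiff k σ) whd
        (wset (ambient (Pi.single i 1) (insert 0 M) \ excess J) (Pi.single i 1 + α)) (n + 1) +
      hdim (wordDiff k σ) whd
        (wset (ambient (Pi.single i 1) (insert 0 M) \ excess J) α) n := by
  have hP := isSubquot_ambient k (Pi.single i 1) (insert 0 M) J (Pi.single i 1 + α)
  have hP' := isSubquot_ambient k (Pi.single i 1) (insert 0 M) J α
  have hcl := headFree_closed (i := i) (M := M) (J := J) k (α := Pi.single i 1 + α)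
  have hX := fun e he => behead_subD (k := k) (M := M) (α := α) (e := e) hi he
  have hx := fun e he => behead_varLetter_subD (k := k) (α := α) (e := e) hM hi he
  have hlift := fun n e he => exists_behead_eq (k := k) (M := M) (α := α) (n := n) (e := e) hi he
  have hXm := fun n e he => behead_mem (k := k) (M := M) (α := α) (n := n) (e := e)
    (extLetter_mem hi) rfl he
  have hxm := fun n e he => behead_mem (k := k) (M := M) (α := α) (n := n) (e := e)
    (varLetter_mem hi) rfl he
  simp only [extLetter, varLetter, Finset.card_singleton, Finset.card_empty] at hXm hxm
  set W := wset (ambient (Pi.single i 1) (insert 0 M) \ excess J) (Pi.single i 1 + α)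
  set W' := wset (ambient (Pi.single i 1) (insert 0 M) \ excess J) α
  have hZ : ∀ m, (Finsupp.supported k k (cell whd W (m + 1)) ⊓
      LinearMap.ker (subD (wordDiff k σ) W)).map (behead (extLetter i)) =
      (Finsupp.supported k k (cell whd W' m)).map (subD (wordDiff k σ) W') := by
    intro m
    apply le_antisymm
    · rintro _ ⟨z, hz, rfl⟩
      refine ⟨behead (varLetter i) z, hxm m z (by rw [zero_add, add_comm]; exact hz.1), ?_⟩
      have := hx z (supported_cell_le _ hz.1)
      rw [LinearMap.mem_ker.1 hz.2, map_zero] at this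
      exact (sub_eq_zero.1 this.symm).symm
    · rintro _ ⟨e, he, rfl⟩
      obtain ⟨y, hy, rfl⟩ := hlift m e he
      exact ⟨_, hP.boundary_le isDiff_wordDiff (m + 1) ⟨y, hy, rfl⟩,
        hX y (supported_cell_le _ hy)⟩
  have hV : (Finsupp.supported k k (cell whd W (n + 1 + 1))).map (behead (extLetter i)) =
      Finsupp.supported k k (cell whd W' n) := by
    apply le_antisymm
    · rintro _ ⟨y, hy, rfl⟩
      exact hXm n y (by rw [add_comm]; exact hy)
    · intro e he
      obtain ⟨y, hy, rfl⟩ := hlift n e he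
      exact ⟨y, hy, rfl⟩
  have hU : ∀ m, Finsupp.supported k k (cell whd (headFree i W) m) ⊓
      LinearMap.ker (subD (wordDiff k σ) (headFree i W)) =
      (Finsupp.supported k k (cell whd W m) ⊓ LinearMap.ker (subD (wordDiff k σ) W)) ⊓
        LinearMap.ker (behead (extLetter i)) := by
    intro m
    rw [inf_right_comm, ← supported_cell_headFree]
    ext e
    simp only [Submodule.mem_inf, LinearMap.mem_ker]
    refine and_congr_right fun he => ?_
    rw [subD_headFree hcl (supported_cell_le _ he)]
  have hB : (Finsupp.supported k k (cell whd (headFree i W) (n + 1 + 1))).map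
      (subD (wordDiff k σ) (headFree i W)) =
      (Finsupp.supported k k (cell whd W (n + 1 + 1)) ⊓
        LinearMap.ker (behead (k := k) (extLetter i))).map (subD (wordDiff k σ) W) := by
    rw [← supported_cell_headFree]
    apply le_antisymm
    · rintro _ ⟨e, he, rfl⟩
      exact ⟨e, he, (subD_headFree hcl (supported_cell_le _ he)).symm⟩
    · rintro _ ⟨e, he, rfl⟩
      exact ⟨e, he, subD_headFree hcl (supported_cell_le _ he)⟩
  have := fun m => hP.finiteDimensional m
  have := fun m => hP'.finiteDimensional m
  have h1 := finrank_map_add_finrank_inf_ker (behead (extLetter i))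
    (Finsupp.supported k k (cell whd W (n + 1)) ⊓ LinearMap.ker (subD (wordDiff k σ) W))
  have h2 := finrank_map_add_finrank_inf_ker (behead (extLetter i))
    (Finsupp.supported k k (cell whd W (n + 1 + 1)) ⊓ LinearMap.ker (subD (wordDiff k σ) W))
  have h3 := finrank_map_add_finrank_inf_ker (behead (extLetter i))
    (Finsupp.supported k k (cell whd W (n + 1 + 1)))
  have h4 := finrank_map_add_finrank_inf_ker (subD (wordDiff k σ) W)
    (Finsupp.supported k k (cell whd W (n + 1 + 1)) ⊓ LinearMap.ker (behead (k := k) (extLetter i)))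
  have h5 := finrank_map_add_finrank_inf_ker (subD (wordDiff k σ) W)
    (Finsupp.supported k k (cell whd W (n + 1 + 1)))
  have h6 := finrank_map_add_finrank_inf_ker (subD (wordDiff k σ) W')
    (Finsupp.supported k k (cell whd W' n))
  have h7 := Submodule.finrank_mono (hP.boundary_le isDiff_wordDiff (n + 1))
  have h8 := Submodule.finrank_mono (hP'.boundary_le isDiff_wordDiff n)
  rw [hZ] at h1 h2
  rw [hV] at h3
  rw [inf_right_comm] at h4
  unfold hdim
  rw [hU, hB]
  omega

lemma hdim_congr_cell {D : (Word σ →₀ k) →ₗ[k] (Word σ →₀ k)} (hD : IsDiff D whd)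
    {P Q : Set (Word σ)} {n : ℕ} (h₀ : ∀ m ≤ n + 1, cell whd P m = cell whd Q m) :
    hdim D whd P n = hdim D whd Q n := by
  have key : ∀ m ≤ n + 1, ∀ e ∈ Finsupp.supported k k (cell whd P m), subD D P e = subD D Q e := by
    intro m hm e he
    ext v
    rw [subD_apply, subD_apply]
    by_cases hne : D e v = 0
    · rw [hne, ite_self, ite_self]
    · obtain ⟨u, hu, huv⟩ := diff_apply_ne_zero hne
      have h1 : u ∈ cell whd P m := by_contra fun h => hu ((Finsupp.mem_supported' k e).1 he u h)
      have h2 := hD.deg u v huv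
      have h3 := h₀ (whd v) (by have := h1.2; omega)
      have : v ∈ P ↔ v ∈ Q := ⟨fun h => (h3.subset ⟨h, rfl⟩).1, fun h => (h3.superset ⟨h, rfl⟩).1⟩
      simp only [this]
  have h1 : Finsupp.supported k k (cell whd P n) ⊓ LinearMap.ker (subD D P) =
      Finsupp.supported k k (cell whd Q n) ⊓ LinearMap.ker (subD D Q) := by
    rw [← h₀ n (by omega)]
    ext e
    simp only [Submodule.mem_inf, LinearMap.mem_ker]
    exact and_congr_right fun he => by rw [key n (by omega) e he]
  have h2 : (Finsupp.supported k k (cell whd P (n + 1))).map (subD D P) =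
      (Finsupp.supported k k (cell whd Q (n + 1))).map (subD D Q) := by
    rw [← h₀ (n + 1) le_rfl]
    apply le_antisymm
    · rintro _ ⟨e, he, rfl⟩
      exact ⟨e, he, (key _ le_rfl e he).symm⟩
    · rintro _ ⟨e, he, rfl⟩
      exact ⟨e, he, key _ le_rfl e he⟩
  rw [hdim, hdim, h1, h2]

lemma hdim_headFree_of_lt {W : Set (Word σ)} {n : ℕ}
    (h : ∀ v, extLetter i :: v ∈ W → n + 1 < whd (extLetter i :: v)) :
    hdim (wordDiff k σ) whd (headFree i W) n = hdim (wordDiff k σ) whd W n := by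
  refine hdim_congr_cell isDiff_wordDiff fun m hm => ?_
  ext w
  refine ⟨fun hw => ⟨hw.1.1, hw.2⟩, fun hw => ⟨⟨hw.1, fun hX => ?_⟩, hw.2⟩⟩
  obtain ⟨v, rfl⟩ := List.head?_eq_some_iff.1 hX
  have h1 := h v hw.1
  have h2 := hw.2
  omega

lemma hdim_excess_insert [Finite σ] (h0 : 0 ∉ M) (hM : ∀ m ∈ M, ¬ m ≤ Pi.single i 1) (hi : i ∉ J)
    (α : Mon σ) (n : ℕ) :
    hdim (wordDiff k σ) whd (wset (ambient 0 M \ excess J) α) n =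
      hdim (wordDiff k σ) whd (wset (ambient 0 M \ excess (insert i J)) α) n +
      if Pi.single i 1 ≤ α ∧ 1 ≤ n then hdim (wordDiff k σ) whd
        (wset (ambient 0 M \ excess (insert i J)) (α - Pi.single i 1)) (n - 1) else 0 := by
  rw [hdim_ambient_eq_headFree k h0 hi, ← hdim_ambient_insert_zero k h0 hi]
  split_ifs with h
  · obtain ⟨β, rfl⟩ := exists_add_of_le h.1
    obtain ⟨m, rfl⟩ := Nat.exists_eq_add_of_le' h.2
    rw [add_tsub_cancel_left, Nat.add_sub_cancel, ← hdim_ambient_insert_zero k h0 hi,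
      hdim_headFree_succ hM hi]
  · rw [add_zero]
    refine hdim_headFree_of_lt fun v hv => ?_
    have h1 : Pi.single i 1 ≤ α := by
      rw [← hv.2, wdeg_cons]
      exact le_self_add
    have h2 : ¬ 1 ≤ n := fun h2 => h ⟨h1, h2⟩
    rw [whd_cons, extLetter, Finset.card_singleton]
    omega

end HeadFreeCount

section Series

variable (k : Type*) [Field k] {σ : Type*} (M : Finset (Mon σ))

/-- The generating series of the dimensions of the homology of the words in `L`. -/
def wordSeries (L : Set (Letter σ)) : MvPowerSeries (Option σ) ℤ :=
  fun e => (hdim (wordDiff k σ) whd (wset L fun i => e (some i)) (e none) : ℤ)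

variable {M}

lemma wordSeries_excess_insert [Finite σ] {i : σ} {J : Set σ} (h0 : 0 ∉ M)
    (hM : ∀ m ∈ M, ¬ m ≤ Pi.single i 1) (hi : i ∉ J) :
    wordSeries k (ambient 0 M \ excess J) =
      (1 + MvPowerSeries.X (some i) * MvPowerSeries.X none) *
        wordSeries k (ambient 0 M \ excess (insert i J)) := by
  ext e
  rw [add_mul, one_mul, map_add, MvPowerSeries.X, MvPowerSeries.X,
    MvPowerSeries.monomial_mul_monomial, MvPowerSeries.coeff_monomial_mul]
  change ((hdim (wordDiff k σ) whd _ _ : ℕ) : ℤ) = ((hdim (wordDiff k σ) whd _ _ : ℕ) : ℤ) +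
    if _ then 1 * 1 * ((hdim (wordDiff k σ) whd _ _ : ℕ) : ℤ) else 0
  rw [hdim_excess_insert h0 hM hi, Nat.cast_add, Nat.cast_ite, one_mul, one_mul, Nat.cast_zero]
  congr 1
  have h1 : (Pi.single i 1 ≤ (fun j => e (some j)) ∧ 1 ≤ e none) ↔
      Finsupp.single (some i) 1 + Finsupp.single none 1 ≤ e := by
    constructor
    · rintro ⟨h1, h2⟩ o
      cases o with
      | none => simpa using h2
      | some j => simpa [Finsupp.single_apply, Pi.single_apply, eq_comm] using h1 j
    · intro h
      refine ⟨fun j => ?_, by simpa using h none⟩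
      simpa [Finsupp.single_apply, Pi.single_apply, eq_comm] using h (some j)
  refine ite_congr (propext h1) (fun _ => ?_) fun _ => rfl
  congr 3
  · congr 1
    funext j
    simp [Finsupp.single_apply, Pi.single_apply, eq_comm]
  · simp

lemma wordSeries_eq_prod [Fintype σ] (h0 : 0 ∉ M) (hM : ∀ i, ∀ m ∈ M, ¬ m ≤ Pi.single i 1) :
    wordSeries k (ambient 0 M \ excess ∅) =
      (∏ i, (1 + MvPowerSeries.X (some i) * MvPowerSeries.X none)) *
        wordSeries k (ambient 0 M \ excess Set.univ) := by
  have key : ∀ T : Finset σ, wordSeries k (ambient 0 M \ excess ∅) =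
      (∏ i ∈ T, (1 + MvPowerSeries.X (some i) * MvPowerSeries.X none)) *
        wordSeries k (ambient 0 M \ excess (T : Set σ)) := by
    intro T
    induction T using Finset.induction_on with
    | empty => simp
    | insert i T hi ih =>
      rw [ih, wordSeries_excess_insert k h0 (hM i) (by simpa using hi), Finset.prod_insert hi,
        Finset.coe_insert]
      ring
  simpa using key Finset.univ

end Series

end MonomialRings

namespace MonomialRings

section Components

variable {σ : Type*} {S T : Finset (Mon σ)}

/-- No monomial of `S` has a common factor with a monomial of `T`. -/
def CoprimeSets (S T : Finset (Mon σ)) : Prop := ∀ a ∈ S, ∀ b ∈ T, ¬ NCF a b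

lemma NCF.symm {a b : Mon σ} (h : NCF a b) : NCF b a := by
  obtain ⟨i, h1, h2⟩ := h
  exact ⟨i, h2, h1⟩

lemma NCF.refl {a : Mon σ} (h : a ≠ 0) : NCF a a := by
  obtain ⟨i, hi⟩ := Function.ne_iff.1 h
  exact ⟨i, hi, hi⟩

lemma CoprimeSets.symm (h : CoprimeSets S T) : CoprimeSets T S :=
  fun a ha b hb hab => h b hb a ha hab.symm

lemma CoprimeSets.disjoint (h : CoprimeSets S T) (hS : 0 ∉ S) : Disjoint S T :=
  Finset.disjoint_left.2 fun a ha hb => h a ha a hb (NCF.refl fun h0 => hS (h0 ▸ ha))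

lemma ConnIn.refl {a : Mon σ} (ha : a ∈ S) : ConnIn S a a := ⟨ha, ha, .refl⟩

lemma ConnIn.trans {a b c : Mon σ} (h : ConnIn S a b) (h' : ConnIn S b c) : ConnIn S a c :=
  ⟨h.1, h'.2.1, h.2.2.trans h'.2.2⟩

lemma ConnIn.symm {a b : Mon σ} (h : ConnIn S a b) : ConnIn S b a := by
  obtain ⟨ha, hb, h⟩ := h
  refine ⟨hb, ha, ?_⟩
  clear hb
  induction h with
  | refl => exact .refl
  | tail _ h ih => exact .head ⟨h.2.1, h.1, Ne.symm h.2.2.1, h.2.2.2.symm⟩ ih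

lemma ConnIn.of_NCF {a b : Mon σ} (ha : a ∈ S) (hb : b ∈ S) (h : NCF a b) : ConnIn S a b := by
  by_cases hab : a = b
  · subst hab
    exact .refl ha
  · exact ⟨ha, hb, .single ⟨ha, hb, hab, h⟩⟩

lemma ConnIn.mono {a b : Mon σ} (h : ConnIn S a b) (hST : S ⊆ T) : ConnIn T a b := by
  refine ⟨hST h.1, hST h.2.1, Relation.ReflTransGen.mono ?_ _ _ h.2.2⟩
  exact fun u v h => ⟨hST h.1, hST h.2.1, h.2.2⟩

lemma ConnIn.of_closed {a b : Mon σ} (h : ConnIn T a b) (ha : a ∈ S)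
    (hST : ∀ u ∈ S, ∀ v ∈ T, NCF u v → v ∈ S) : ConnIn S a b := by
  obtain ⟨-, -, h⟩ := h
  induction h with
  | refl => exact .refl ha
  | tail _ h ih => exact ih.trans (.of_NCF ih.2.1 (hST _ ih.2.1 _ h.2.1 h.2.2.2) h.2.2.2)

lemma compOf_union_left (h : CoprimeSets S T) {a : Mon σ} (ha : a ∈ S) :
    compOf (S ∪ T) a = compOf S a := by
  have key : ∀ b, ConnIn (S ∪ T) a b ↔ ConnIn S a b := fun b =>
    ⟨fun hc => hc.of_closed ha fun u hu v hv huv =>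
      (Finset.mem_union.1 hv).resolve_right fun hvT => h u hu v hvT huv,
      fun hc => hc.mono Finset.subset_union_left⟩
  ext b
  simp only [compOf, Finset.mem_filter, key]
  exact ⟨fun hb => ⟨hb.2.2.1, hb.2⟩, fun hb => ⟨Finset.mem_union_left _ hb.1, hb.2⟩⟩

lemma components_union (h : CoprimeSets S T) :
    components (S ∪ T) = components S ∪ components T := by
  rw [components, Finset.image_union]
  congr 1
  · exact Finset.image_congr fun a ha => compOf_union_left h ha
  · rw [Finset.union_comm]
    exact Finset.image_congr fun a ha => compOf_union_left h.symm ha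

lemma components_of_isConnected (h : IsConnected S) : components S = {S} := by
  have key : ∀ a ∈ S, compOf S a = S := fun a ha => Finset.filter_true_of_mem (h.2 a ha)
  rw [components, Finset.image_congr key]
  exact Finset.image_const h.1 S

lemma components_nonempty (h : S.Nonempty) : (components S).Nonempty := h.image _

section Component

variable {C : Finset (Mon σ)}

lemma component_subset (hC : C ∈ components S) : C ⊆ S := by
  obtain ⟨a, -, rfl⟩ := Finset.mem_image.1 hC
  exact Finset.filter_subset _ _

lemma component_coprime (hC : C ∈ components S) : CoprimeSets C (S \ C) := by
  obtain ⟨a, ha, rfl⟩ := Finset.mem_image.1 hC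
  intro u hu v hv huv
  rw [Finset.mem_sdiff] at hv
  rw [compOf, Finset.mem_filter] at hu
  exact hv.2 (Finset.mem_filter.2 ⟨hv.1, hu.2.trans (.of_NCF hu.1 hv.1 huv)⟩)

lemma component_isConnected (hC : C ∈ components S) : IsConnected C := by
  have hcop := component_coprime hC
  obtain ⟨a, ha, rfl⟩ := Finset.mem_image.1 hC
  have haa : a ∈ compOf S a := Finset.mem_filter.2 ⟨ha, .refl ha⟩
  have key : ∀ b ∈ compOf S a, ConnIn (compOf S a) a b := fun b hb =>
    (Finset.mem_filter.1 hb).2.of_closed haa fun u hu v hv huv =>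
      by_contra fun hvC => hcop u hu v (Finset.mem_sdiff.2 ⟨hv, hvC⟩) huv
  exact ⟨⟨a, haa⟩, fun b hb c hc => (key b hb).symm.trans (key c hc)⟩

end Component

lemma disjoint_components (h : Disjoint S T) : Disjoint (components S) (components T) := by
  refine Finset.disjoint_left.2 fun C h1 h2 => ?_
  obtain ⟨a, ha⟩ := (component_isConnected h1).1
  exact Finset.disjoint_left.1 h (component_subset h1 ha) (component_subset h2 ha)

lemma ncomp_union (h : CoprimeSets S T) (hS : 0 ∉ S) : ncomp (S ∪ T) = ncomp S + ncomp T := by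
  rw [ncomp, components_union h, Finset.card_union_of_disjoint
    (disjoint_components (h.disjoint hS)), ncomp, ncomp]

lemma ncomp_pos (h : S.Nonempty) : 0 < ncomp S := (components_nonempty h).card_pos

lemma ncomp_of_isConnected (h : IsConnected S) : ncomp S = 1 := by
  rw [ncomp, components_of_isConnected h, Finset.card_singleton]

lemma not_isConnected_union (h : CoprimeSets S T) (hS : 0 ∉ S) (hSn : S.Nonempty)
    (hTn : T.Nonempty) : ¬ IsConnected (S ∪ T) := by
  intro hc
  have h1 := ncomp_union h hS
  rw [ncomp_of_isConnected hc] at h1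
  have := ncomp_pos hSn
  have := ncomp_pos hTn
  omega

lemma components_insert_sdiff {C : Finset (Mon σ)} (hC : C ∈ components S) :
    components S = insert C (components (S \ C)) := by
  have h := components_union (component_coprime hC)
  rwa [Finset.union_sdiff_of_subset (component_subset hC),
    components_of_isConnected (component_isConnected hC)] at h

lemma coprimeSets_of_components (h : ∀ C ∈ components T, CoprimeSets C S) : CoprimeSets T S := by
  intro a ha b hb
  refine h (compOf T a) (Finset.mem_image_of_mem _ ha) a ?_ b hb
  exact Finset.mem_filter.2 ⟨ha, .refl ha⟩

lemma exists_of_mlcm_apply_ne_zero {i : σ} (h : mlcm S i ≠ 0) : ∃ a ∈ S, a i ≠ 0 := by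
  by_contra! h0
  refine h (Finset.sup_induction (p := fun f : Mon σ => f i = 0) rfl ?_ h0)
  intro a ha b hb
  simp only [Pi.sup_apply, ha, hb, max_self]

lemma mlcm_union_of_coprimeSets (h : CoprimeSets S T) : mlcm (S ∪ T) = mlcm S + mlcm T := by
  funext i
  rw [mlcm_union, Pi.sup_apply, Pi.add_apply]
  by_cases h1 : mlcm S i = 0
  · simp [h1]
  by_cases h2 : mlcm T i = 0
  · simp [h2]
  obtain ⟨a, ha, hai⟩ := exists_of_mlcm_apply_ne_zero h1
  obtain ⟨b, hb, hbi⟩ := exists_of_mlcm_apply_ne_zero h2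
  exact absurd ⟨i, hai, hbi⟩ (h a ha b hb)

lemma coprimeSets_of_mlcm_union (h : mlcm (S ∪ T) = mlcm S + mlcm T) : CoprimeSets S T := by
  rintro a ha b hb ⟨i, h1, h2⟩
  have h3 := congrFun h i
  rw [mlcm_union] at h3
  have h4 := Mon.le_apply (le_mlcm ha) i
  have h5 := Mon.le_apply (le_mlcm hb) i
  simp only [Pi.sup_apply, Pi.add_apply] at h3
  rcases le_total (mlcm S i) (mlcm T i) with h | h <;>
    simp only [sup_eq_right.2 h, sup_eq_left.2 h] at h3 <;>
  omega

end Components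

end MonomialRings

namespace MonomialRings

section Fuse

variable {σ : Type*} (key : Finset (Mon σ) → ℕ)

/-- The components allowed after the connected letter `S`, given those allowed at `S`. -/
def allowNext (S : Finset (Mon σ)) (O : Set (Finset (Mon σ))) : Set (Finset (Mon σ)) :=
  {C | ¬ CoprimeSets C S ∨ (C ∈ O ∧ key S < key C)}

/-- The components of `S` that are allowed. -/
def allowed (O : Set (Finset (Mon σ))) (S : Finset (Mon σ)) : Finset (Finset (Mon σ)) :=
  (components S).filter (· ∈ O)

/-- The allowed component of `S` with the largest key. -/
def topAllowed (O : Set (Finset (Mon σ))) (S : Finset (Mon σ)) : Finset (Mon σ) :=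
  if h : (allowed O S).Nonempty then (Finset.exists_max_image _ key h).choose else ∅

/-- The initial connected allowed letters of the word are followed by a letter without allowed
components. -/
def fuseUp (O : Set (Finset (Mon σ))) : Word σ → Prop
  | [] => False
  | a :: w => (allowed O a.2).Nonempty → IsConnected a.2 ∧ fuseUp (allowNext key a.2 O) w

/-- The initial connected allowed letters of the word are followed by a disconnected letter with
allowed components. -/
def fuseDn (O : Set (Finset (Mon σ))) : Word σ → Prop
  | [] => False
  | a :: w => (allowed O a.2).Nonempty ∧ (IsConnected a.2 → fuseDn (allowNext key a.2 O) w)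

/-- Multiply the first letter without allowed components into its predecessor. -/
def fuseWord (O : Set (Finset (Mon σ))) : Word σ → Word σ
  | [] => []
  | [a] => [a]
  | a :: b :: w =>
    if (allowed (allowNext key a.2 O) b.2).Nonempty then
      a :: fuseWord (allowNext key a.2 O) (b :: w)
    else (a.1 + b.1, a.2 ∪ b.2) :: w

/-- Split the top allowed component off the first disconnected letter. -/
def unfuseWord (O : Set (Finset (Mon σ))) : Word σ → Word σ
  | [] => []
  | a :: w =>
    if IsConnected a.2 then a :: unfuseWord (allowNext key a.2 O) w
    else (mlcm (topAllowed key O a.2), topAllowed key O a.2) ::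
      (mlcm (a.2 \ topAllowed key O a.2), a.2 \ topAllowed key O a.2) :: w

/-- The keys of the initial connected letters and of the top component of the next one. -/
def fuseRank (O : Set (Finset (Mon σ))) : Word σ → List ℕ
  | [] => []
  | a :: w =>
    if IsConnected a.2 then key a.2 :: fuseRank (allowNext key a.2 O) w
    else [key (topAllowed key O a.2)]

/-- The letters `(m_S, S)` for non-empty `S ⊆ M`. -/
def lcmLetters (M : Finset (Mon σ)) : Set (Letter σ) :=
  {a | a.2 ⊆ M ∧ a.2.Nonempty ∧ a.1 = mlcm a.2}

variable {key} {O : Set (Finset (Mon σ))} {S T : Finset (Mon σ)} {M : Finset (Mon σ)}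

lemma topAllowed_mem (h : (allowed O S).Nonempty) : topAllowed key O S ∈ allowed O S := by
  rw [topAllowed, dif_pos h]
  exact (Finset.exists_max_image _ key h).choose_spec.1

lemma key_le_topAllowed {C : Finset (Mon σ)} (hC : C ∈ allowed O S) :
    key C ≤ key (topAllowed key O S) := by
  have h : (allowed O S).Nonempty := ⟨C, hC⟩
  rw [topAllowed, dif_pos h]
  exact (Finset.exists_max_image _ key h).choose_spec.2 C hC

lemma topAllowed_eq (hkey : Function.Injective key) {C : Finset (Mon σ)} (hC : C ∈ allowed O S)
    (h : ∀ D ∈ allowed O S, key D ≤ key C) : topAllowed key O S = C :=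
  hkey (le_antisymm (h _ (topAllowed_mem ⟨C, hC⟩)) (key_le_topAllowed hC))

lemma allowed_of_isConnected (hS : IsConnected S) : (allowed O S).Nonempty ↔ S ∈ O := by
  simp [allowed, components_of_isConnected hS, Finset.filter_singleton, apply_ite]

lemma allowed_union (h : CoprimeSets S T) : allowed O (S ∪ T) = allowed O S ∪ allowed O T := by
  rw [allowed, components_union h, Finset.filter_union, allowed, allowed]

lemma self_mem_allowed_union (h : CoprimeSets S T) (hS : IsConnected S) (hO : S ∈ O) :
    S ∈ allowed O (S ∪ T) := by
  simp [allowed, components_union h, components_of_isConnected hS, hO]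

lemma allowed_univ (hS : S.Nonempty) : (allowed Set.univ S).Nonempty := by
  simpa [allowed] using components_nonempty hS

/-- A letter without allowed components is coprime to its predecessor. -/
lemma coprimeSets_of_allowed_eq (h : ¬ (allowed (allowNext key S O) T).Nonempty) :
    CoprimeSets S T := by
  refine (coprimeSets_of_components fun C hC => ?_).symm
  by_contra hne
  exact h ⟨C, Finset.mem_filter.2 ⟨hC, Or.inl hne⟩⟩

lemma topAllowed_union (hkey : Function.Injective key) (hS : IsConnected S) (hO : S ∈ O)
    (h : ¬ (allowed (allowNext key S O) T).Nonempty) : topAllowed key O (S ∪ T) = S := by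
  have hc := coprimeSets_of_allowed_eq h
  refine topAllowed_eq hkey (self_mem_allowed_union hc hS hO) fun D hD => ?_
  rw [allowed_union hc, Finset.mem_union] at hD
  rcases hD with hD | hD
  · rw [allowed, components_of_isConnected hS, Finset.mem_filter, Finset.mem_singleton] at hD
    rw [hD.1]
  · by_contra hlt
    rw [allowed, Finset.mem_filter] at hD
    exact h ⟨D, Finset.mem_filter.2 ⟨hD.1, Or.inr ⟨hD.2, not_le.1 hlt⟩⟩⟩

lemma not_allowed_sdiff (h : (allowed O S).Nonempty) :
    ¬ (allowed (allowNext key (topAllowed key O S) O) (S \ topAllowed key O S)).Nonempty := by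
  rintro ⟨C, hC⟩
  have hB := topAllowed_mem (key := key) h
  set B := topAllowed key O S
  rw [allowed, Finset.mem_filter] at hB hC
  have hcop := component_coprime hB.1
  have hCS := component_subset hC.1
  rcases hC.2 with h1 | ⟨h1, h2⟩
  · exact h1 fun a ha b hb hab => hcop b hb a (hCS ha) hab.symm
  · refine absurd (key_le_topAllowed (key := key) (O := O) (S := S) (C := C) ?_) (not_le.2 h2)
    rw [allowed, Finset.mem_filter, components_insert_sdiff hB.1]
    exact ⟨Finset.mem_insert_of_mem hC.1, h1⟩

lemma sdiff_nonempty_of_component {C : Finset (Mon σ)} (hC : C ∈ components S)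
    (hS : ¬ IsConnected S) : (S \ C).Nonempty := by
  rw [Finset.sdiff_nonempty]
  intro h
  exact hS (h.antisymm (component_subset hC) ▸ component_isConnected hC)

lemma mul_mem_lcmLetters {a b : Letter σ} (ha : a ∈ lcmLetters M) (hb : b ∈ lcmLetters M)
    (h : CoprimeSets a.2 b.2) : (a.1 + b.1, a.2 ∪ b.2) ∈ lcmLetters M :=
  ⟨Finset.union_subset ha.1 hb.1, ha.2.1.mono Finset.subset_union_left, by
    rw [mlcm_union_of_coprimeSets h, ha.2.2, hb.2.2]⟩

lemma coprimeSets_of_mul_mem {a b : Letter σ} (ha : a ∈ lcmLetters M) (hb : b ∈ lcmLetters M)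
    (h : (a.1 + b.1, a.2 ∪ b.2) ∈ lcmLetters M) : CoprimeSets a.2 b.2 := by
  refine coprimeSets_of_mlcm_union ?_
  rw [← h.2.2, ha.2.2, hb.2.2]

/-- The first letter of the word has an allowed component. -/
def headAllowed (O : Set (Finset (Mon σ))) : Word σ → Prop
  | [] => False
  | a :: _ => (allowed O a.2).Nonempty

lemma fuseWord_spec (hM : 0 ∉ M) (hkey : Function.Injective key) :
    ∀ (O : Set (Finset (Mon σ))) (u : Word σ), (∀ a ∈ u, a ∈ lcmLetters M) → headAllowed O u →
      fuseUp key O u →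
      (∀ a ∈ fuseWord key O u, a ∈ lcmLetters M) ∧ headAllowed O (fuseWord key O u) ∧
        fuseDn key O (fuseWord key O u) ∧ unfuseWord key O (fuseWord key O u) = u ∧
        Step u (fuseWord key O u)
  | _, [], _, h, _ => h.elim
  | O, [a], _, h, hup => (hup h).2.elim
  | O, a :: b :: w, hL, h, hup => by
    obtain ⟨hc, hup⟩ := hup h
    have hLa := hL a (by simp)
    have hLb := hL b (by simp)
    have haO := (allowed_of_isConnected hc).1 h
    rw [fuseWord]
    split_ifs with hb
    · obtain ⟨i1, i2, i3, i4, i5⟩ := fuseWord_spec hM hkey (allowNext key a.2 O) (b :: w)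
        (fun c hc => hL c (List.mem_cons_of_mem _ hc)) hb hup
      refine ⟨fun c hc => ?_, h, ⟨h, fun _ => i3⟩, ?_, .cons a i5⟩
      · rcases List.mem_cons.1 hc with rfl | hc
        · exact hLa
        · exact i1 c hc
      · rw [unfuseWord, if_pos hc, i4]
    · have hcop := coprimeSets_of_allowed_eq hb
      have h0 : 0 ∉ a.2 := fun h => hM (hLa.1 h)
      have hdis := hcop.disjoint h0
      have hnc := not_isConnected_union hcop h0 hLa.2.1 hLb.2.1
      have hal : (allowed O (a.2 ∪ b.2)).Nonempty := ⟨_, self_mem_allowed_union hcop hc haO⟩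
      refine ⟨fun c hc => ?_, hal, ⟨hal, fun h => absurd h hnc⟩, ?_, .mrg a b w hdis⟩
      · rcases List.mem_cons.1 hc with rfl | hc
        · exact mul_mem_lcmLetters hLa hLb hcop
        · exact hL c (by simp [hc])
      · rw [unfuseWord, if_neg hnc, topAllowed_union hkey hc haO hb,
          Finset.union_sdiff_cancel_left hdis, ← hLa.2.2, ← hLb.2.2]

lemma unfuseWord_spec (hM : 0 ∉ M) (hkey : Function.Injective key) :
    ∀ (O : Set (Finset (Mon σ))) (d : Word σ), (∀ a ∈ d, a ∈ lcmLetters M) → fuseDn key O d →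
      (∀ a ∈ unfuseWord key O d, a ∈ lcmLetters M) ∧ headAllowed O (unfuseWord key O d) ∧
        fuseUp key O (unfuseWord key O d) ∧ fuseWord key O (unfuseWord key O d) = d
  | _, [], _, h => h.elim
  | O, a :: w, hL, h => by
    have hLa := hL a (by simp)
    rw [unfuseWord]
    split_ifs with hc
    · obtain ⟨i1, i2, i3, i4⟩ := unfuseWord_spec hM hkey (allowNext key a.2 O) w
        (fun c hc => hL c (List.mem_cons_of_mem _ hc)) (h.2 hc)
      refine ⟨fun c hc => ?_, h.1, fun _ => ⟨hc, i3⟩, ?_⟩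
      · rcases List.mem_cons.1 hc with rfl | hc
        · exact hLa
        · exact i1 c hc
      · cases hw : unfuseWord key (allowNext key a.2 O) w with
        | nil => rw [hw] at i2; exact i2.elim
        | cons b q =>
          rw [hw] at i2 i4
          have i2' : (allowed (allowNext key a.2 O) b.2).Nonempty := i2
          rw [fuseWord, if_pos i2', i4]
    · have hB := topAllowed_mem (key := key) h.1
      have hns := not_allowed_sdiff (key := key) h.1
      set B := topAllowed key O a.2
      have hB1 := (Finset.mem_filter.1 hB).1
      have hBc := component_isConnected hB1
      have hBO : (allowed O B).Nonempty :=
        (allowed_of_isConnected hBc).2 (Finset.mem_filter.1 hB).2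
      refine ⟨fun c hc => ?_, hBO, fun _ => ⟨hBc, fun h => absurd h hns⟩, ?_⟩
      · rcases List.mem_cons.1 hc with rfl | hc'
        · exact ⟨(component_subset hB1).trans hLa.1, hBc.1, rfl⟩
        · rcases List.mem_cons.1 hc' with rfl | hc'
          · exact ⟨Finset.sdiff_subset.trans hLa.1, sdiff_nonempty_of_component hB1 ‹_›, rfl⟩
          · exact hL c (by simp [hc'])
      · rw [fuseWord, if_neg hns, ← mlcm_union_of_coprimeSets (component_coprime hB1),
          Finset.union_sdiff_of_subset (component_subset hB1), ← hLa.2.2]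

lemma fuseRank_ne_nil {d : Word σ} (h : fuseDn key O d) : fuseRank key O d ≠ [] := by
  cases d with
  | nil => exact h.elim
  | cons a w =>
    rw [fuseRank]
    split_ifs <;> simp

lemma fuseRank_lt (hM : 0 ∉ M) (hkey : Function.Injective key)
    (hinj : ∀ S ⊆ M, ∀ T ⊆ M, mlcm S = mlcm T → S = T) {u d : Word σ} (hs : Step u d)
    (hu : ∀ a ∈ u, a ∈ lcmLetters M) (hd : ∀ a ∈ d, a ∈ lcmLetters M)
    (hh : headAllowed O u) (hup : fuseUp key O u) (hdn : fuseDn key O d) :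
    d = fuseWord key O u ∨ fuseRank key O (fuseWord key O u) < fuseRank key O d := by
  induction hs generalizing O with
  | int γ S w s hs =>
    have h1 := hu (γ, S) (by simp)
    have h2 := hd (γ, S.erase s) (by simp)
    have h3 : S = S.erase s := hinj _ h1.1 _ h2.1 (h1.2.2.symm.trans h2.2.2)
    rw [h3] at hs
    simp at hs
  | mrg a b w h =>
    have hLa := hu a (by simp)
    have hLb := hu b (by simp)
    have hcop := coprimeSets_of_mul_mem hLa hLb (hd _ (by simp))
    obtain ⟨hc, hup⟩ := hup hh
    have hnc := not_isConnected_union hcop (fun h => hM (hLa.1 h)) hLa.2.1 hLb.2.1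
    rw [fuseWord]
    split_ifs with hb
    · right
      rw [fuseRank, if_pos hc, fuseRank, if_neg hnc]
      obtain ⟨C, hC⟩ := hb
      rw [allowed, Finset.mem_filter] at hC
      have hCb := component_subset hC.1
      rcases hC.2 with h1 | ⟨h1, h2⟩
      · exact absurd (fun x hx y hy hxy => hcop y hy x (hCb hx) hxy.symm) h1
      · refine List.Lex.rel (h2.trans_le (key_le_topAllowed ?_))
        rw [allowed_union hcop]
        exact Finset.mem_union_right _ (Finset.mem_filter.2 ⟨hC.1, h1⟩)
    · exact Or.inl rfl
  | cons a h ih =>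
    rename_i v w
    have hLa := hu a (by simp)
    obtain ⟨hc, hup⟩ := hup hh
    have hdn' := hdn.2 hc
    cases v with
    | nil => exact hup.elim
    | cons b v =>
      have hLb := hu b (by simp)
      rw [fuseWord]
      split_ifs with hb
      · rcases ih (fun c hc => hu c (List.mem_cons_of_mem _ hc))
          (fun c hc => hd c (List.mem_cons_of_mem _ hc)) hb hup hdn' with h1 | h1
        · exact Or.inl (by rw [← h1])
        · right
          rw [fuseRank, if_pos hc, fuseRank, if_pos hc]
          exact List.Lex.cons h1
      · right
        have hcop := coprimeSets_of_allowed_eq hb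
        have hnc := not_isConnected_union hcop (fun h => hM (hLa.1 h)) hLa.2.1 hLb.2.1
        rw [fuseRank, if_neg hnc, fuseRank, if_pos hc,
          topAllowed_union hkey hc ((allowed_of_isConnected hc).1 hh) hb]
        refine List.Lex.cons ?_
        obtain ⟨x, l, hl⟩ := List.exists_cons_of_ne_nil (fuseRank_ne_nil hdn')
        rw [hl]
        exact List.Lex.nil

lemma isConnected_of_not_fuse :
    ∀ (O : Set (Finset (Mon σ))) (c : Word σ), ¬ fuseUp key O c → ¬ fuseDn key O c →
      ∀ a ∈ c, IsConnected a.2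
  | _, [], _, _ => by simp
  | O, a :: w, hup, hdn => by
    rw [fuseUp, Classical.not_imp] at hup
    rw [fuseDn, not_and, Classical.not_imp] at hdn
    obtain ⟨h1, h2⟩ := hdn hup.1
    intro b hb
    rcases List.mem_cons.1 hb with rfl | hb
    · exact h1
    · exact isConnected_of_not_fuse _ w (fun h => hup.2 ⟨h1, h⟩) h2 b hb

end Fuse

end MonomialRings

namespace MonomialRings

section Weight

variable {σ : Type*} {M : Finset (Mon σ)}

lemma ambient_sdiff_excess_univ (h0 : 0 ∉ M) :
    ambient 0 M \ excess Set.univ = lcmLetters M := by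
  ext ⟨γ, S⟩
  have hex : (γ, S) ∈ excess (Set.univ : Set σ) ↔ γ ≠ mlcm S := by
    simp [excess, Function.ne_iff, eq_comm]
  have hb : baseDeg 0 S = mlcm S := by simp [baseDeg]
  rw [Set.mem_sdiff, hex, not_not]
  constructor
  · rintro ⟨⟨h1, h2, -⟩, h3⟩
    refine ⟨h2, Finset.nonempty_iff_ne_empty.2 ?_, h3⟩
    rintro rfl
    exact h1 (h3.trans mlcm_empty)
  · rintro ⟨h1, ⟨m, hm⟩, h3⟩
    refine ⟨⟨fun h => h0 ?_, h1, ?_⟩, h3⟩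
    · have h4 : m = 0 := le_antisymm ((le_mlcm hm).trans (h3.symm.trans h).le) zero_le
      exact h4 ▸ h1 hm
    · exact hb.le.trans h3.ge

/-- The number of generators plus the number of components of a word. -/
def wordWeight (w : Word σ) : ℕ := (w.map fun a => a.2.card + ncomp a.2).sum

@[simp] lemma wordWeight_nil : wordWeight ([] : Word σ) = 0 := rfl

@[simp] lemma wordWeight_cons (a : Letter σ) (w : Word σ) :
    wordWeight (a :: w) = a.2.card + ncomp a.2 + wordWeight w := by
  simp [wordWeight]

lemma Step.wordWeight (h0 : 0 ∉ M)
    (hinj : ∀ S ⊆ M, ∀ T ⊆ M, mlcm S = mlcm T → S = T) {u v : Word σ} (h : Step u v)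
    (hu : ∀ a ∈ u, a ∈ lcmLetters M) (hv : ∀ a ∈ v, a ∈ lcmLetters M) :
    wordWeight v = wordWeight u := by
  induction h with
  | int γ S w s hs =>
    have h1 := hu (γ, S) (by simp)
    have h2 := hv (γ, S.erase s) (by simp)
    have h3 : S = S.erase s := hinj _ h1.1 _ h2.1 (h1.2.2.symm.trans h2.2.2)
    rw [h3] at hs
    simp at hs
  | mrg a b w h =>
    have hLa := hu a (by simp)
    have hcop := coprimeSets_of_mul_mem hLa (hu b (by simp)) (hv _ (by simp))
    simp only [wordWeight_cons, ncomp_union hcop fun h => h0 (hLa.1 h),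
      Finset.card_union_of_disjoint h]
    ring
  | cons a h ih =>
    rw [wordWeight_cons, wordWeight_cons, ih (fun c hc => hu c (List.mem_cons_of_mem _ hc))
      fun c hc => hv c (List.mem_cons_of_mem _ hc)]

lemma whd_le_wordWeight {w : Word σ} (hw : ∀ a ∈ w, a ∈ lcmLetters M) :
    whd w ≤ wordWeight w := by
  induction w with
  | nil => simp
  | cons a w ih =>
    have h1 := ih fun c hc => hw c (List.mem_cons_of_mem _ hc)
    have h2 := ncomp_pos (hw a (by simp)).2.1
    rw [wordWeight_cons, whd_cons]
    omega

lemma whd_eq_wordWeight {w : Word σ} (hw : ∀ a ∈ w, IsConnected a.2) :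
    whd w = wordWeight w := by
  induction w with
  | nil => simp
  | cons a w ih =>
    rw [wordWeight_cons, whd_cons, ih fun c hc => hw c (List.mem_cons_of_mem _ hc),
      ncomp_of_isConnected (hw a (by simp))]

/-- The words in the letters `(m_S, S)` of a given degree with weight in `A`. -/
def weightSet (M : Finset (Mon σ)) (α : Mon σ) (A : Set ℕ) : Set (Word σ) :=
  {w | w ∈ wset (lcmLetters M) α ∧ wordWeight w ∈ A}

lemma weightSet_subset (α : Mon σ) (A : Set ℕ) :
    weightSet M α A ⊆ wset (lcmLetters M) α := fun _ h => h.1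

end Weight

section Exactness

variable (k : Type*) [Field k] {σ : Type*} {M : Finset (Mon σ)}

lemma isSubquot_lcmLetters [Finite σ] (h0 : 0 ∉ M) (α : Mon σ) :
    IsSubquot (wordDiff k σ) whd (wset (lcmLetters M) α) := by
  rw [← ambient_sdiff_excess_univ h0]
  exact isSubquot_ambient k 0 M Set.univ α

variable {k} {α : Mon σ}

lemma mem_weightSet_iff (h0 : 0 ∉ M) (hinj : ∀ S ⊆ M, ∀ T ⊆ M, mlcm S = mlcm T → S = T)
    {A : Set ℕ} {u v : Word σ} (hu : u ∈ wset (lcmLetters M) α)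
    (hv : v ∈ wset (lcmLetters M) α) (huv : wordDiff k σ (Finsupp.single u 1) v ≠ 0) :
    v ∈ weightSet M α A ↔ u ∈ weightSet M α A := by
  have := (Step.of_coeff huv).wordWeight h0 hinj hu.1 hv.1
  simp only [weightSet, Set.mem_ofPred_eq, hu, hv, true_and, this]

lemma isSubquot_weightSet [Finite σ] (h0 : 0 ∉ M) (hinj : ∀ S ⊆ M, ∀ T ⊆ M, mlcm S = mlcm T → S = T)
    (A : Set ℕ) :
    IsSubquot (wordDiff k σ) whd (weightSet M α A) :=
  (isSubquot_lcmLetters k h0 α).of_closed (weightSet_subset α A) fun _ hu _ hv huv =>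
    (mem_weightSet_iff h0 hinj hu.1 hv huv).2 hu

lemma wordDiff_projOn_weightSet (h0 : 0 ∉ M) (hinj : ∀ S ⊆ M, ∀ T ⊆ M, mlcm S = mlcm T → S = T)
    {A : Set ℕ} {e : Word σ →₀ k}
    (he : e ∈ Finsupp.supported k k (wset (lcmLetters M) α)) {v : Word σ}
    (hv : v ∈ wset (lcmLetters M) α) :
    wordDiff k σ (projOn (weightSet M α A) e) v =
      if v ∈ weightSet M α A then wordDiff k σ e v else 0 := by
  have hmem : ∀ u, e u ≠ 0 → u ∈ wset (lcmLetters M) α := fun u hu =>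
    by_contra fun h => hu ((Finsupp.mem_supported' k e).1 he u h)
  split_ifs with hvA
  · rw [eq_comm, ← sub_eq_zero, ← Finsupp.sub_apply, ← map_sub]
    by_contra hne
    obtain ⟨u, hu, huv⟩ := diff_apply_ne_zero hne
    rw [Finsupp.sub_apply, projOn_apply] at hu
    split_ifs at hu with huA
    · simp at hu
    · rw [sub_zero] at hu
      exact huA ((mem_weightSet_iff h0 hinj (hmem u hu) hv huv).1 hvA)
  · by_contra hne
    obtain ⟨u, hu, huv⟩ := diff_apply_ne_zero hne
    rw [projOn_apply] at hu
    split_ifs at hu with huA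
    · exact hvA ((mem_weightSet_iff h0 hinj huA.1 hv huv).2 huA)
    · exact hu rfl

lemma exact_weightSet [Finite σ] (h0 : 0 ∉ M) (hinj : ∀ S ⊆ M, ∀ T ⊆ M, mlcm S = mlcm T → S = T)
    {A : Set ℕ} {n : ℕ} (hn : n ∉ A) {z : Word σ →₀ k}
    (hz : z ∈ Finsupp.supported k k (cell whd (weightSet M α A) n))
    (hDz : subD (wordDiff k σ) (weightSet M α A) z = 0) :
    ∃ y ∈ Finsupp.supported k k (cell whd (weightSet M α A) (n + 1)),
      subD (wordDiff k σ) (weightSet M α A) y = z := by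
  obtain ⟨key, hkey⟩ := exists_injective_nat (Finset (Mon σ))
  have hP := isSubquot_weightSet (k := k) h0 hinj (α := α) A
  have hhead : ∀ u ∈ weightSet M α A, u ≠ [] → headAllowed Set.univ u := by
    rintro (_ | ⟨a, u⟩) hu hne
    · exact absurd rfl hne
    · exact allowed_univ (hu.1.1 a (by simp)).2.1
  have hup : ∀ u ∈ weightSet M α A, fuseUp key Set.univ u → headAllowed Set.univ u := fun u hu h =>
    hhead u hu (by rintro rfl; exact h)
  have hne : ∀ u ∈ weightSet M α A, ∀ v, Step u v → wordDiff k σ (Finsupp.single u 1) v ≠ 0 :=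
    fun u hu v h => h.wordCoeff_ne_zero fun a ha => by
      have := hu.1.1 a ha
      rw [← ambient_sdiff_excess_univ h0] at this
      exact this.1.1
  obtain ⟨y, hy, h⟩ := exists_sub_boundary isDiff_wordDiff hP (fuseUp key Set.univ)
    (fuseDn key Set.univ) (fuseWord key Set.univ) (unfuseWord key Set.univ)
    (fun w => OrderDual.toDual (fuseRank key Set.univ w))
    (fun u hu h => by
      obtain ⟨i1, -, i3, i4, i5⟩ := fuseWord_spec h0 hkey Set.univ u hu.1.1 (hup u hu h) h
      have hne := hne u hu _ i5
      exact ⟨(mem_weightSet_iff h0 hinj hu.1 ⟨i1, i5.wdeg.trans hu.1.2⟩ hne).2 hu, i3, i4, hne⟩)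
    (fun u hu h d hd hdn huv =>
      fuseRank_lt h0 hkey hinj (Step.of_coeff huv) hu.1.1 hd.1.1 (hup u hu h) h hdn)
    (fun d hd hdn => by
      obtain ⟨i1, i2, i3, i4⟩ := unfuseWord_spec h0 hkey Set.univ d hd.1.1 hdn
      obtain ⟨-, -, -, -, i5⟩ := fuseWord_spec h0 hkey Set.univ _ i1 i2 i3
      rw [i4] at i5
      refine ⟨⟨⟨i1, i5.wdeg.symm.trans hd.1.2⟩, ?_⟩, i3, i4⟩
      rw [← i5.wordWeight h0 hinj i1 hd.1.1]
      exact hd.2)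
    (fun c hc h1 h2 => absurd (hc.2 ▸ whd_eq_wordWeight (isConnected_of_not_fuse _ c h1 h2) ▸ hc.1.2)
      hn)
    hz (fun d _ _ => by rw [hDz]; rfl)
  refine ⟨y, hy, ?_⟩
  rw [eq_comm, ← sub_eq_zero]
  ext w
  by_cases hw : w ∈ cell whd (weightSet M α A) n
  · refine h w ?_
    by_contra hc
    rw [not_or] at hc
    exact hn (hw.2 ▸ whd_eq_wordWeight (isConnected_of_not_fuse _ w hc.1 hc.2) ▸ hw.1.2)
  · exact (Finsupp.mem_supported' k _).1 (Submodule.sub_mem _ hz (subD_mem isDiff_wordDiff hy)) w hw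

lemma hdim_weightSet_singleton [Finite σ] (h0 : 0 ∉ M) (hinj : ∀ S ⊆ M, ∀ T ⊆ M, mlcm S = mlcm T → S = T)
    (n : ℕ) :
    hdim (wordDiff k σ) whd (weightSet M α {n}) n =
      hdim (wordDiff k σ) whd (wset (lcmLetters M) α) n := by
  refine hdim_eq_of_exact_quot isDiff_wordDiff (isSubquot_lcmLetters k h0 α)
    (weightSet_subset α {n}) (fun u hu v hv huv => (mem_weightSet_iff h0 hinj hu.1 hv huv).2 hu) n
    (fun z hz hDz => ?_) fun z hz hDz => ?_
  · have hzL := supported_cell_le n hz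
    obtain ⟨y, hy, hyz⟩ := exact_weightSet (k := k) h0 hinj (α := α) (A := {n}ᶜ) (n := n)
      (z := projOn (weightSet M α {n}ᶜ) z) (by simp)
      (by
        rw [Finsupp.mem_supported']
        intro w hw
        rw [projOn_apply]
        split_ifs with h
        · exact (Finsupp.mem_supported' k z).1 hz w fun hc => hw ⟨h, hc.2⟩
        · rfl)
      (by
        ext v
        rw [subD_apply]
        split_ifs with h
        · rw [wordDiff_projOn_weightSet h0 hinj hzL h.1, if_pos h]
          have := DFunLike.congr_fun hDz v
          rwa [subD_apply, if_pos h.1] at this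
        · rfl)
    have hsub : cell whd (weightSet M α {n}ᶜ) (n + 1) ⊆ cell whd (wset (lcmLetters M) α) (n + 1) :=
      fun w hw => ⟨hw.1.1, hw.2⟩
    refine ⟨y, Finsupp.supported_mono hsub hy, ?_⟩
    rw [Finsupp.mem_supported']
    intro w hw
    have h1 := DFunLike.congr_fun hyz w
    rw [subD_apply, projOn_apply] at h1
    rw [Finsupp.sub_apply, subD_apply]
    by_cases hwL : w ∈ wset (lcmLetters M) α
    · have hwA : w ∈ weightSet M α {n}ᶜ := ⟨hwL, fun h => hw ⟨hwL, h⟩⟩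
      rw [if_pos hwA, if_pos hwA] at h1
      rw [if_pos hwL, h1, sub_self]
    · rw [if_neg hwL, (Finsupp.mem_supported' k z).1 hzL w hwL, sub_zero]
  · have hzL := supported_cell_le (n + 1) hz
    refine ⟨projOn (weightSet M α {n}) z, projOn_mem _ _, ?_, ?_⟩
    · rw [Finsupp.mem_supported']
      intro w hw
      rw [projOn_apply, (Finsupp.mem_supported' k z).1 hz w hw, ite_self]
    · ext v
      rw [subD_apply]
      split_ifs with h
      · rw [wordDiff_projOn_weightSet h0 hinj hzL h]
        split_ifs with hA
        · rw [subD_apply, if_pos h]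
        · exact ((Finsupp.mem_supported' k _).1 hDz v hA).symm
      · rw [subD_apply, if_neg h]

end Exactness

end MonomialRings

namespace MonomialRings

section Euler

variable (k : Type*) [Field k] {σ : Type*} {M : Finset (Mon σ)}

lemma finite_weightSet [Finite σ] (h0 : 0 ∉ M) (α : Mon σ) (n : ℕ) :
    (weightSet M α {n}).Finite := by
  refine ((Set.finite_Iic n).biUnion fun i _ => (isSubquot_lcmLetters ℚ h0 α).fin i).subset ?_
  intro w hw
  exact Set.mem_biUnion (x := whd w) ((whd_le_wordWeight hw.1.1).trans hw.2.le) ⟨hw.1, rfl⟩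

lemma neg_one_pow_mul_hdim [Finite σ] (h0 : 0 ∉ M)
    (hinj : ∀ S ⊆ M, ∀ T ⊆ M, mlcm S = mlcm T → S = T) (α : Mon σ) (n : ℕ) :
    (-1) ^ n * (hdim (wordDiff k σ) whd (wset (lcmLetters M) α) n : ℤ) =
      ∑ᶠ w ∈ weightSet M α {n}, (-1) ^ whd w := by
  have hP := isSubquot_weightSet (k := k) h0 hinj (α := α) {n}
  have := fun m => hP.finiteDimensional m
  rw [← hdim_weightSet_singleton h0 hinj]
  set P := weightSet M α {n}
  set z : ℕ → ℕ := fun m => Module.finrank k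
    ↥(Finsupp.supported k k (cell whd P m) ⊓ LinearMap.ker (subD (wordDiff k σ) P)) with hz
  have hz0 : z 0 = (cell whd P 0).ncard := by
    rw [← finrank_supported_cell (k := k), hz]
    simp only
    rw [inf_eq_left.2]
    intro e he
    rw [LinearMap.mem_ker]
    ext v
    rw [subD_apply]
    split_ifs
    · by_contra hne
      obtain ⟨u, hu, huv⟩ := diff_apply_ne_zero hne
      refine huv ?_
      rw [wordDiff_of_whd_eq_zero u, Finsupp.zero_apply]
      by_contra hu0
      exact hu ((Finsupp.mem_supported' k e).1 he u fun h => hu0 h.2)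
    · rfl
  have hsucc : ∀ m < n, z m + z (m + 1) = (cell whd P (m + 1)).ncard := by
    intro m hm
    rw [← finrank_supported_cell (k := k),
      ← finrank_map_add_finrank_inf_ker (subD (wordDiff k σ) P)]
    refine congrArg (fun V : Submodule k (Word σ →₀ k) => Module.finrank k V + z (m + 1))
      (le_antisymm (fun e he => ?_) (hP.boundary_le isDiff_wordDiff m))
    obtain ⟨y, hy, rfl⟩ := exact_weightSet (k := k) h0 hinj (α := α) (A := {n}) (by simpa using hm.ne)
      he.1 he.2
    exact ⟨y, hy, rfl⟩
  have hcell : cell whd P (n + 1) = ∅ := by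
    refine Set.eq_empty_of_forall_notMem fun w hw => ?_
    have h1 := whd_le_wordWeight hw.1.1.1
    have h2 := hw.2
    have h3 : wordWeight w = n := hw.1.2
    omega
  have hsum : ∀ m ≤ n, (-1) ^ m * (z m : ℤ) =
      ∑ i ∈ Finset.range (m + 1), (-1) ^ i * ((cell whd P i).ncard : ℤ) := by
    intro m
    induction m with
    | zero => simp [hz0]
    | succ m ih =>
      intro hm
      rw [Finset.sum_range_succ, ← ih (by omega), ← hsucc m hm]
      push_cast
      ring
  have hfin : P.Finite := finite_weightSet h0 α n
  have hmaps : ∀ w ∈ hfin.toFinset, whd w ∈ Finset.range (n + 1) := by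
    intro w hw
    have hw := hfin.mem_toFinset.1 hw
    rw [Finset.mem_range_succ_iff]
    exact (whd_le_wordWeight hw.1.1).trans hw.2.le
  have hdim_eq : hdim (wordDiff k σ) whd P n = z n := by
    rw [hdim, hcell, Finsupp.supported_empty, Submodule.map_bot, finrank_bot, Nat.sub_zero]
  rw [hdim_eq, hsum n le_rfl, finsum_mem_eq_finite_toFinset_sum _ hfin,
    ← Finset.sum_fiberwise_of_maps_to hmaps]
  refine Finset.sum_congr rfl fun i _ => ?_
  rw [Finset.sum_congr rfl fun w hw => by rw [(Finset.mem_filter.1 hw).2], Finset.sum_const,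
    nsmul_eq_mul, mul_comm, ← Set.ncard_coe_finset]
  congr 3
  ext w
  simp [cell]

lemma weightSet_eq_union [Finite σ] (α : Mon σ) (n : ℕ) :
    weightSet M α {n} = (if α = 0 ∧ n = 0 then {[]} else ∅) ∪
      ⋃ S ∈ ((M.powerset.filter fun S => S.Nonempty ∧ mlcm S ≤ α ∧ S.card + ncomp S ≤ n :
          Finset (Finset (Mon σ))) : Set (Finset (Mon σ))),
        List.cons (mlcm S, S) '' weightSet M (α - mlcm S) {n - (S.card + ncomp S)} := by
  ext w
  constructor
  · rintro ⟨⟨h1, h2⟩, h3⟩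
    cases w with
    | nil =>
      left
      rw [if_pos ⟨h2.symm, h3.symm⟩]
      rfl
    | cons a w =>
      right
      obtain ⟨γ, S⟩ := a
      obtain ⟨ha1, ha2, ha3⟩ := h1 _ List.mem_cons_self
      simp only at ha1 ha2 ha3
      subst ha3
      have h3' : wordWeight _ = n := h3
      rw [wordWeight_cons] at h3'
      rw [wdeg_cons] at h2
      simp only at h2 h3'
      refine Set.mem_biUnion (x := S) ?_ ⟨w, ⟨⟨fun b hb => h1 b (List.mem_cons_of_mem _ hb), ?_⟩, ?_⟩, rfl⟩
      · rw [Finset.mem_coe, Finset.mem_filter, Finset.mem_powerset]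
        exact ⟨ha1, ha2, h2 ▸ le_self_add, by omega⟩
      · rw [← h2, add_tsub_cancel_left]
      · change wordWeight w = _
        omega
  · rintro (h | h)
    · split_ifs at h with h0
      · rw [Set.mem_singleton_iff.1 h, h0.1, h0.2]
        exact ⟨⟨by simp, rfl⟩, rfl⟩
      · exact h.elim
    · simp only [Set.mem_iUnion] at h
      obtain ⟨S, hS, w, ⟨⟨h1, h2⟩, h3⟩, rfl⟩ := h
      rw [Finset.mem_coe, Finset.mem_filter, Finset.mem_powerset] at hS
      refine ⟨⟨fun a ha => ?_, ?_⟩, ?_⟩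
      · rcases List.mem_cons.1 ha with rfl | ha
        · exact ⟨hS.1, hS.2.1, rfl⟩
        · exact h1 a ha
      · rw [wdeg_cons, h2]
        exact add_tsub_cancel_of_le hS.2.2.1
      · change wordWeight _ = _
        rw [wordWeight_cons, show wordWeight w = _ from h3]
        exact Nat.add_sub_of_le hS.2.2.2

lemma finsum_weightSet [Finite σ] (h0 : 0 ∉ M) (α : Mon σ) (n : ℕ) :
    ∑ᶠ w ∈ weightSet M α {n}, (-1 : ℤ) ^ whd w = (if α = 0 ∧ n = 0 then 1 else 0) +
      ∑ S ∈ M.powerset.filter fun S => S.Nonempty ∧ mlcm S ≤ α ∧ S.card + ncomp S ≤ n,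
        (-1) ^ (S.card + 1) *
          ∑ᶠ w ∈ weightSet M (α - mlcm S) {n - (S.card + ncomp S)}, (-1 : ℤ) ^ whd w := by
  have hfin := fun S => finite_weightSet h0 (α - mlcm S) (n - (S.card + ncomp S))
  rw [weightSet_eq_union, finsum_mem_union, finsum_mem_biUnion, finsum_mem_coe_finset]
  · congr 1
    · split_ifs
      · rw [finsum_mem_singleton, whd_nil, pow_zero]
      · rw [finsum_mem_empty]
    · refine Finset.sum_congr rfl fun S _ => ?_
      rw [finsum_mem_image fun _ _ _ _ h => (List.cons_injective h), mul_finsum_mem' _ _ (hfin S)]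
      refine finsum_mem_congr rfl fun w _ => ?_
      rw [whd_cons, pow_add]
  · intro S _ T _ hST
    refine Set.disjoint_left.2 ?_
    rintro _ ⟨w, -, rfl⟩ ⟨v, -, h⟩
    exact hST (Prod.ext_iff.1 (List.cons_eq_cons.1 h).1).2.symm
  · exact Finset.finite_toSet _
  · exact fun S _ => (hfin S).image _
  · refine Set.disjoint_left.2 fun w h h' => ?_
    simp only [Set.mem_iUnion] at h'
    obtain ⟨S, -, v, -, rfl⟩ := h'
    split_ifs at h <;> simp at h
  · split_ifs
    · exact Set.finite_singleton _
    · exact Set.finite_empty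
  · exact (Finset.finite_toSet _).biUnion fun S _ => (hfin S).image _

lemma hdim_lcmLetters [Finite σ] (h0 : 0 ∉ M)
    (hinj : ∀ S ⊆ M, ∀ T ⊆ M, mlcm S = mlcm T → S = T) (α : Mon σ) (n : ℕ) :
    ∑ S ∈ M.powerset, (if mlcm S ≤ α ∧ S.card + ncomp S ≤ n then (-1) ^ ncomp S *
        (hdim (wordDiff k σ) whd (wset (lcmLetters M) (α - mlcm S))
          (n - (S.card + ncomp S)) : ℤ) else 0) = if α = 0 ∧ n = 0 then 1 else 0 := by
  have h := finsum_weightSet h0 α n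
  have hsq : ∀ m : ℕ, (-1 : ℤ) ^ m * (-1) ^ m = 1 := fun m => by
    rw [← mul_pow, neg_one_mul, neg_neg, one_pow]
  simp only [← neg_one_pow_mul_hdim k h0 hinj] at h
  have h' := congrArg ((-1) ^ n * ·) h
  simp only [← mul_assoc, hsq, one_mul, mul_add, Finset.mul_sum] at h'
  have hempty : ncomp (∅ : Finset (Mon σ)) = 0 := by simp [ncomp, components]
  rw [← Finset.sum_erase_add _ _ (Finset.empty_mem_powerset M), mlcm_empty, hempty, tsub_zero,
    Finset.card_empty, Nat.zero_add, Nat.sub_zero, if_pos ⟨zero_le, Nat.zero_le n⟩, pow_zero, one_mul,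
    h', ← sub_eq_zero]
  have h1 : (-1 : ℤ) ^ n * (if α = 0 ∧ n = 0 then 1 else 0) = if α = 0 ∧ n = 0 then 1 else 0 := by
    split_ifs with h
    · simp [h.2]
    · simp
  rw [h1, add_sub_assoc, add_sub_cancel_left, ← Finset.sum_filter]
  have h2 : (M.powerset.erase ∅).filter (fun S => mlcm S ≤ α ∧ S.card + ncomp S ≤ n) =
      M.powerset.filter fun S => S.Nonempty ∧ mlcm S ≤ α ∧ S.card + ncomp S ≤ n := by
    ext S
    simp only [Finset.mem_filter, Finset.mem_erase, Finset.nonempty_iff_ne_empty]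
    tauto
  rw [h2, ← Finset.sum_add_distrib]
  refine Finset.sum_eq_zero fun S hS => ?_
  rw [← add_mul]
  obtain ⟨m, rfl⟩ := Nat.exists_eq_add_of_le (Finset.mem_filter.1 hS).2.2.2
  rw [Nat.add_sub_cancel_left, mul_eq_zero]
  left
  have h3 : (-1 : ℤ) ^ (S.card + ncomp S + m) * (-1) ^ (S.card + 1) * (-1) ^ m =
      (-1) ^ S.card * (-1) ^ S.card * ((-1) ^ m * (-1) ^ m) * (-1) ^ ncomp S * (-1) := by
    ring
  rw [h3, hsq, hsq]
  ring

end Euler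

section Denominator

lemma saturated_of_injective {σ : Type*} {M : Finset (Mon σ)}
    (hinj : ∀ S ⊆ M, ∀ T ⊆ M, mlcm S = mlcm T → S = T)
    {S : Finset (Mon σ)} (hS : S ⊆ M) : Saturated M S := by
  refine ⟨hS, fun m hm T hT _ hle => ?_⟩
  have h := hinj (insert m T) (Finset.insert_subset hm (hT.trans hS)) T (hT.trans hS)
    (by rw [mlcm_insert, sup_eq_right.2 hle])
  exact hT (h ▸ Finset.mem_insert_self m T)

variable (k : Type*) [Field k] {t : ℕ} {M : Finset (Mon (Fin t))}

lemma taylor_mul_wordSeries (h0 : 0 ∉ M)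
    (hinj : ∀ S ⊆ M, ∀ T ⊆ M, mlcm S = mlcm T → S = T) :
    ((∑ S ∈ M.powerset, MvPolynomial.monomial (expOf (mlcm S) (S.card + ncomp S))
        ((-1 : ℤ) ^ ncomp S) : MvPolynomial (Option (Fin t)) ℤ) :
        MvPowerSeries (Option (Fin t)) ℤ) * wordSeries k (lcmLetters M) = 1 := by
  ext e
  rw [← MvPolynomial.coeToMvPowerSeries.ringHom_apply, map_sum, Finset.sum_mul, map_sum,
    MvPowerSeries.coeff_one]
  have h := hdim_lcmLetters k h0 hinj (fun i => e (some i)) (e none)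
  have he : ((fun i => e (some i)) = 0 ∧ e none = 0) ↔ e = 0 := by
    simp [Finsupp.ext_iff, Option.forall, funext_iff, and_comm]
  refine Eq.trans ?_ (h.trans (ite_congr (propext he) (fun _ => rfl) fun _ => rfl))
  refine Finset.sum_congr rfl fun S _ => ?_
  rw [MvPolynomial.coeToMvPowerSeries.ringHom_apply, MvPolynomial.coe_monomial,
    MvPowerSeries.coeff_monomial_mul]
  have hle : (mlcm S ≤ (fun i => e (some i)) ∧ S.card + ncomp S ≤ e none) ↔
      expOf (mlcm S) (S.card + ncomp S) ≤ e := by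
    simp [Finsupp.le_def, Option.forall, Pi.le_def, expOf, and_comm]
  exact ite_congr (propext hle.symm) (fun _ => rfl) fun _ => rfl

lemma expSet_eq_upperSet {I : Ideal (MvPolynomial (Fin t) k)} (h : IsMonomialIdealOf M I) :
    expSet I = upperSet M := by
  ext β
  have himg : ((fun m => MvPolynomial.monomial (Finsupp.equivFunOnFinite.symm m) (1 : k)) '' ↑M :
      Set (MvPolynomial (Fin t) k)) = (fun s => MvPolynomial.monomial s 1) ''
        (Finsupp.equivFunOnFinite.symm '' (M : Set (Mon (Fin t)))) := by
    rw [Set.image_image]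
  rw [expSet, Set.mem_ofPred_eq, show I = _ from h, himg,
    MvPolynomial.mem_ideal_span_monomial_image, MvPolynomial.support_monomial, if_neg one_ne_zero]
  simp only [Finset.mem_singleton, forall_eq, Set.exists_mem_image, Finset.mem_coe, upperSet,
    Set.mem_ofPred_eq]
  rfl

lemma poincareSeries_upperSet (h0 : 0 ∉ M) :
    poincareSeries k (upperSet M) = wordSeries k (ambient 0 M \ excess ∅) := by
  funext e
  rw [poincareSeries, torDim_eq_hdim_ambient h0]
  rfl

lemma zero_notMem_of_two_le_mdeg (hM : ∀ m ∈ M, 2 ≤ mdeg m) : 0 ∉ M := fun h => by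
  have := hM 0 h
  simp [mdeg] at this

lemma eq_of_isDenominator (hM : ∀ m ∈ M, 2 ≤ mdeg m)
    {b c : MvPolynomial (Option (Fin t)) ℤ} (hb : IsDenominator k (upperSet M) b)
    (hc : (c : MvPowerSeries (Option (Fin t)) ℤ) * wordSeries k (lcmLetters M) = 1) : b = c := by
  have h0 := zero_notMem_of_two_le_mdeg hM
  rw [IsDenominator, poincareSeries_upperSet k h0, wordSeries_eq_prod k h0 fun i m hm hle => by
      have h1 := hM m hm
      have h2 : m i ≤ 1 := by simpa using hle i
      rw [mdeg, Finset.sum_eq_single i (fun j _ hj => by simpa [hj] using hle j) (by simp)] at h1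
      omega,
    ambient_sdiff_excess_univ h0] at hb
  set p : MvPowerSeries (Option (Fin t)) ℤ :=
    ∏ i : Fin t, (1 + MvPowerSeries.X (some i) * MvPowerSeries.X none)
  have hp : p ≠ 0 := by
    intro h
    have := congrArg MvPowerSeries.constantCoeff h
    simp [p, map_prod] at this
  refine MvPolynomial.coe_injective _ _ (mul_left_cancel₀ hp ?_)
  calc p * b = p * b * (c * wordSeries k (lcmLetters M)) := by rw [hc, mul_one]
    _ = b * (p * wordSeries k (lcmLetters M)) * c := by ring
    _ = p * c := by rw [hb]

end Denominator

end MonomialRings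

/-- **Proposition (minimal Taylor complex case).**
Let `I ⊆ Q = k[x₁,…,x_t]` be a monomial ideal whose minimal generating set `M_I` consists
of monomials of degree at least 2, and suppose `m_S = m_T` implies `S = T` for
`S, T ⊆ M_I` (i.e. the Taylor complex on `M_I` is minimal).  Then every non-empty subset
of `M_I` is saturated, and
`b_R(x,z) = ∑_{S ⊆ M_I} (-1)^{c(S)} z^{|S|+c(S)} m_S`. -/
theorem denominator_of_minimal_taylor_complex
    (t : ℕ) (k : Type) [Field k]
    (M : Finset (Mon (Fin t)))
    (I : Ideal (MvPolynomial (Fin t) k))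
    (hgen : IsMonomialIdealOf M I)
    (hmin : IsAntichain' M)
    (hdeg : ∀ m ∈ M, 2 ≤ mdeg m)
    (htaylor : ∀ S ∈ M.powerset, ∀ T ∈ M.powerset, mlcm S = mlcm T → S = T)
    (b : MvPolynomial (Option (Fin t)) ℤ)
    (hb : IsDenominator k (expSet I) b) :
    (∀ S : Finset (Mon (Fin t)), S ⊆ M → S.Nonempty → Saturated M S) ∧
    b = ∑ S ∈ M.powerset,
        MvPolynomial.monomial (expOf (mlcm S) (S.card + ncomp S)) ((-1 : ℤ) ^ (ncomp S)) := by
  have hinj : ∀ S ⊆ M, ∀ T ⊆ M, mlcm S = mlcm T → S = T := fun S hS T hT =>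
    htaylor S (Finset.mem_powerset.2 hS) T (Finset.mem_powerset.2 hT)
  rw [expSet_eq_upperSet k hgen] at hb
  exact ⟨fun S hS _ => saturated_of_injective hinj hS, eq_of_isDenominator k hdeg hb
    (taylor_mul_wordSeries k (zero_notMem_of_two_le_mdeg hdeg) hinj)⟩
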